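/- arXiv:2406.06501 — 4 statements merged into one kernel-verified Lean document; each statement's English description precedes it below -/
import Mathlib

section
/- Let k ≥ 3 and let H be a k-uniform hypergraph with ν^(k−1)(H) = 1. Then τ^(k−1)(H) ≤ ⌈(k+1)/2⌉. -/
open Finset

/-- `M` is an `m`-matching of the hypergraph `H`: a set of edges of `H`
whose pairwise intersections have size less than `m`. -/
def IsMatching {V : Type*} [DecidableEq V] (m : ℕ) (H M : Finset (Finset V)) : Prop :=
  M ⊆ H ∧ ∀ e ∈ M, ∀ f ∈ M, e ≠ f → (e ∩ f).card < m

/-- `C` is an `m`-cover of the hypergraph `H`: a set of `m`-sets such that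
every edge of `H` contains some member of `C`. -/
def IsCover {V : Type*} (m : ℕ) (H C : Finset (Finset V)) : Prop :=
  (∀ c ∈ C, c.card = m) ∧ ∀ e ∈ H, ∃ c ∈ C, c ⊆ e

/-- A subset `X` of a finset `Y` with at least two elements is covered by at most
`⌈#X / 2⌉` two-element subsets of `Y`. -/
theorem exists_pairs_cover {V : Type*} [DecidableEq V] {Y : Finset V} (hY : 2 ≤ #Y)
    (X : Finset V) (hXY : X ⊆ Y) :
    ∃ P : Finset (Finset V), (∀ p ∈ P, p ⊆ Y ∧ #p = 2) ∧ (∀ x ∈ X, ∃ p ∈ P, x ∈ p) ∧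
      #P ≤ (#X + 1) / 2 := by
  induction X using Finset.strongInduction with
  | H X ih =>
  rcases X.eq_empty_or_nonempty with rfl | ⟨a, ha⟩
  · exact ⟨∅, by simp⟩
  by_cases hX : ∃ b ∈ X, b ≠ a
  · obtain ⟨b, hb, hba⟩ := hX
    have hab : {a, b} ⊆ X := by
      intro x hx
      simp only [mem_insert, mem_singleton] at hx
      rcases hx with rfl | rfl <;> assumption
    have hcard : #(X \ {a, b}) + 2 = #X := by
      rw [← card_pair hba.symm, card_sdiff_add_card_eq_card hab]
    have hss : X \ {a, b} ⊂ X :=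
      ⟨sdiff_subset, fun h => by simpa using h ha⟩
    obtain ⟨P, hP, hcov, hle⟩ := ih _ hss (sdiff_subset.trans hXY)
    refine ⟨insert {a, b} P, ?_, ?_, (card_insert_le _ _).trans (by omega)⟩
    · intro p hp
      rcases mem_insert.1 hp with rfl | hp
      · exact ⟨hab.trans hXY, card_pair hba.symm⟩
      · exact hP p hp
    · intro x hx
      by_cases hx' : x ∈ ({a, b} : Finset V)
      · exact ⟨_, mem_insert_self _ _, hx'⟩
      · obtain ⟨p, hp, hxp⟩ := hcov x (mem_sdiff.2 ⟨hx, hx'⟩)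
        exact ⟨p, mem_insert_of_mem hp, hxp⟩
  · push Not at hX
    obtain ⟨b, hb, hba⟩ := exists_mem_ne (by omega : 1 < #Y) a
    have hpos : 0 < #X := card_pos.2 ⟨a, ha⟩
    refine ⟨{{a, b}}, ?_, ?_, by rw [card_singleton]; omega⟩
    · simp only [mem_singleton, forall_eq]
      refine ⟨?_, card_pair hba.symm⟩
      intro x hx
      simp only [mem_insert, mem_singleton] at hx
      rcases hx with rfl | rfl
      · exact hXY ha
      · exact hb
    · intro x hx
      exact ⟨_, mem_singleton_self _, by simp [hX x hx]⟩

/-- The `k`-subsets of a `(k + 1)`-set have a `(k - 1)`-cover of size at most `⌈(k + 1) / 2⌉`. -/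
theorem exists_isCover_of_subset {V : Type*} [DecidableEq V] {k : ℕ} (hk : 1 ≤ k)
    {H : Finset (Finset V)} (hH : ∀ e ∈ H, #e = k) {X : Finset V} (hX : #X = k + 1)
    (hHX : ∀ e ∈ H, e ⊆ X) : ∃ C, IsCover (k - 1) H C ∧ #C ≤ (k + 2) / 2 := by
  obtain ⟨P, hP, hcov, hle⟩ := exists_pairs_cover (by omega : 2 ≤ #X) X Subset.rfl
  refine ⟨P.image (X \ ·), ⟨?_, ?_⟩, card_image_le.trans (by omega)⟩
  · intro c hc
    obtain ⟨p, hp, rfl⟩ := mem_image.1 hc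
    obtain ⟨hpX, hp2⟩ := hP p hp
    rw [card_sdiff_of_subset hpX]
    omega
  · intro e he
    have hc := card_sdiff_add_card_eq_card (hHX e he)
    obtain ⟨x, hx⟩ := card_eq_one.1 (by have := hH e he; omega : #(X \ e) = 1)
    have hxX : x ∈ X \ e := by simp [hx]
    obtain ⟨p, hp, hxp⟩ := hcov x (mem_sdiff.1 hxX).1
    refine ⟨X \ p, mem_image_of_mem _ hp, fun y hy => ?_⟩
    obtain ⟨hyX, hyp⟩ := mem_sdiff.1 hy
    by_contra hye
    have hyx : y ∈ X \ e := mem_sdiff.2 ⟨hyX, hye⟩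
    rw [hx, mem_singleton] at hyx
    exact hyp (hyx ▸ hxp)

/-- If `ν^(m)(H) ≤ 1`, any two distinct edges share at least `m` vertices. -/
theorem le_card_inter_of_matching_le_one {V : Type*} [DecidableEq V] {m : ℕ}
    {H : Finset (Finset V)} (hmax : ∀ M, IsMatching m H M → #M ≤ 1) {e f : Finset V}
    (he : e ∈ H) (hf : f ∈ H) (hef : e ≠ f) : m ≤ #(e ∩ f) := by
  by_contra! h
  have := hmax {e, f} ⟨by simp [insert_subset_iff, he, hf], by
    simp only [mem_insert, mem_singleton]
    rintro a (rfl | rfl) b (rfl | rfl) hab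
    · exact absurd rfl hab
    · exact h
    · rwa [inter_comm]
    · exact absurd rfl hab⟩
  rw [card_pair hef] at this
  omega

/-- If `H` is a `k`-uniform hypergraph with `ν^(k-1)(H) = 1`, then
`τ^(k-1)(H) ≤ ⌈(k+1)/2⌉`. -/
theorem stmt0 {V : Type*} [DecidableEq V] (k : ℕ) (hk : 3 ≤ k)
    (H : Finset (Finset V)) (hH : ∀ e ∈ H, e.card = k)
    (hex : ∃ M, IsMatching (k - 1) H M ∧ M.card = 1)
    (hmax : ∀ M, IsMatching (k - 1) H M → M.card ≤ 1) :
    ∃ C, IsCover (k - 1) H C ∧ C.card ≤ (k + 2) / 2 := by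
  obtain ⟨M, ⟨hMH, -⟩, hM⟩ := hex
  obtain ⟨e, rfl⟩ := card_eq_one.1 hM
  have he : e ∈ H := hMH (mem_singleton_self e)
  have hinter : ∀ a ∈ H, ∀ b ∈ H, k - 1 ≤ #(a ∩ b) := by
    intro a ha b hb
    by_cases hab : a = b
    · rw [hab, inter_self, hH b hb]
      omega
    · exact le_card_inter_of_matching_le_one hmax ha hb hab
  have hcommon : ∀ S : Finset V, #S = k - 1 → (∀ g ∈ H, S ⊆ g) →
      ∃ C, IsCover (k - 1) H C ∧ #C ≤ (k + 2) / 2 := fun S hS hSH =>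
    ⟨{S}, ⟨by simpa using hS, fun g hg => ⟨S, mem_singleton_self S, hSH g hg⟩⟩,
      by rw [card_singleton]; omega⟩
  by_cases hsingle : ∀ f ∈ H, f = e
  · obtain ⟨S, hSe, hS⟩ := exists_subset_card_eq (by rw [hH e he]; omega : k - 1 ≤ #e)
    exact hcommon S hS fun g hg => hsingle g hg ▸ hSe
  push Not at hsingle
  obtain ⟨f, hf, hfe⟩ := hsingle
  have hke := hH e he
  have hkf := hH f hf
  have hS : #(e ∩ f) = k - 1 := by
    have hlt : #(e ∩ f) < #e := card_lt_card ⟨inter_subset_left, fun h =>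
      hfe (eq_of_subset_of_card_le (h.trans inter_subset_right) (by omega)).symm⟩
    have := hinter e he f hf
    omega
  by_cases hstar : ∀ g ∈ H, e ∩ f ⊆ g
  · exact hcommon _ hS hstar
  push Not at hstar
  obtain ⟨g, hg, hSg⟩ := hstar
  have hX : #(e ∪ f) = k + 1 := by
    have := card_union_add_card_inter e f
    omega
  have hlt : ∀ h : Finset V, ¬ e ∩ f ⊆ h → #(h ∩ (e ∩ f)) < k - 1 := fun h hh =>
    hS ▸ card_lt_card ⟨inter_subset_right, fun h' => hh (h'.trans inter_subset_left)⟩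
  refine exists_isCover_of_subset (by omega) hH hX fun h hh => ?_
  have hkh := hH h hh
  by_contra hhX
  have hhX' : #(h ∩ (e ∪ f)) < k :=
    hkh ▸ card_lt_card ⟨inter_subset_left, fun h' => hhX (h'.trans inter_subset_right)⟩
  by_cases hSh : e ∩ f ⊆ h
  · have hSeq : e ∩ f = h ∩ (e ∪ f) := eq_of_subset_of_card_le
      (subset_inter hSh (inter_subset_left.trans subset_union_left)) (by omega)
    have hgX : g ⊆ e ∪ f := by
      have h1 := card_union_add_card_inter (g ∩ e) (g ∩ f)
      rw [← inter_union_distrib_left, ← inter_inter_distrib_left] at h1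
      have h2 := hinter g hg e he
      have h3 := hinter g hg f hf
      have h4 := hlt g hSg
      have h5 := hH g hg
      have h6 : g ∩ (e ∪ f) = g := eq_of_subset_of_card_le inter_subset_left (by omega)
      exact inter_eq_left.1 h6
    have h1 := hinter g hg h hh
    have h2 : g ∩ h ⊆ g ∩ (e ∩ f) := by
      rw [hSeq]
      exact subset_inter inter_subset_left
        (subset_inter inter_subset_right (inter_subset_left.trans hgX))
    have h3 := card_le_card h2
    have h4 := hlt g hSg
    omega
  · have h1 := card_union_add_card_inter (h ∩ e) (h ∩ f)
    rw [← inter_union_distrib_left, ← inter_inter_distrib_left] at h1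
    have h2 := hinter h hh e he
    have h3 := hinter h hh f hf
    have h4 := hlt h hSh
    omega
end

section
/- Let k ≥ 3 and let H be a k-uniform hypergraph with ν^(k−1)(H) = 2. Then τ^(k−1)(H) ≤ 2⌈(k+1)/2⌉. -/
open Finset

section Auxiliary

variable {V : Type*}

/-- `e` has at most one element outside `f`; for two `k`-sets this says that they share at least
`k - 1` elements. -/
def Near (e f : Finset V) : Prop := ∀ u ∈ e, ∀ v ∈ e, u ∉ f → v ∉ f → u = v

theorem exists_pair_of_not_near {e f : Finset V} (h : ¬ Near e f) :
    ∃ u ∈ e, ∃ v ∈ e, u ∉ f ∧ v ∉ f ∧ u ≠ v := by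
  simp only [Near] at h
  push Not at h
  exact h

/-- The edges of `H` that are near `A` but not near `B`. -/
noncomputable def privateEdges (H : Finset (Finset V)) (A B : Finset V) : Finset (Finset V) := by
  classical exact H.filter fun e => Near e A ∧ ¬ Near e B

theorem mem_privateEdges {H : Finset (Finset V)} {A B e : Finset V} :
    e ∈ privateEdges H A B ↔ e ∈ H ∧ Near e A ∧ ¬ Near e B := by
  simp [privateEdges]

theorem self_mem_privateEdges {H : Finset (Finset V)} {A B : Finset V} (hA : A ∈ H)
    (hAB : ¬ Near A B) : A ∈ privateEdges H A B :=
  mem_privateEdges.2 ⟨hA, fun _ hu _ _ hu' => absurd hu hu', hAB⟩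

theorem near_of_mem_privateEdges {H : Finset (Finset V)} {A B : Finset V} (hB : B ∈ H)
    (htri : ∀ e ∈ H, ∀ f ∈ H, ∀ g ∈ H, Near e f ∨ Near e g ∨ Near f g) :
    ∀ e ∈ privateEdges H A B, ∀ f ∈ privateEdges H A B, Near e f := by
  intro e he f hf
  rw [mem_privateEdges] at he hf
  rcases htri e he.1 f hf.1 B hB with h | h | h
  · exact h
  · exact absurd h he.2.2
  · exact absurd h hf.2.2

variable [DecidableEq V]

theorem near_iff_card_sdiff_le_one {e f : Finset V} : Near e f ↔ (e \ f).card ≤ 1 := by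
  rw [Finset.card_le_one]
  simp only [Near, mem_sdiff]
  exact ⟨fun h a ha b hb => h a ha.1 b hb.1 ha.2 hb.2,
    fun h a ha b hb ha' hb' => h a ⟨ha, ha'⟩ b ⟨hb, hb'⟩⟩

theorem Near.symm {e f : Finset V} (h : Near e f) (hc : e.card = f.card) : Near f e := by
  rw [near_iff_card_sdiff_le_one] at *
  have h1 := card_sdiff_add_card_inter e f
  have h2 := card_sdiff_add_card_inter f e
  rw [inter_comm] at h2
  omega

theorem card_inter_lt_of_not_near {k : ℕ} {e f : Finset V} (he : e.card = k)
    (h : ¬ Near e f) : (e ∩ f).card < k - 1 := by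
  rw [near_iff_card_sdiff_le_one] at h
  have h1 := card_sdiff_add_card_inter e f
  omega

theorem erase_subset_of_near {e A : Finset V} (h : Near A e) {a : V} (ha : a ∈ A)
    (hae : a ∉ e) : A.erase a ⊆ e := by
  intro b hb
  rw [mem_erase] at hb
  by_contra hbe
  exact hb.1 (h b hb.2 a ha hbe hae)

/-- A family of `k`-sets that are pairwise near either has a common `(k - 1)`-subset or lives on
`k + 1` points. -/
theorem exists_common_subset_or_subset_insert {k : ℕ} (hk : 1 ≤ k) {F : Finset (Finset V)}
    (hF : ∀ e ∈ F, e.card = k) (hn : ∀ e ∈ F, ∀ f ∈ F, Near e f) {A : Finset V} (hA : A ∈ F) :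
    (∃ D : Finset V, D.card = k - 1 ∧ ∀ f ∈ F, D ⊆ f) ∨
      ∃ x, x ∉ A ∧ ∀ f ∈ F, f ⊆ insert x A := by
  have hAk := hF A hA
  by_cases hall : ∀ f ∈ F, f = A
  · left
    obtain ⟨a, ha⟩ : A.Nonempty := card_pos.1 (by omega)
    refine ⟨A.erase a, by rw [card_erase_of_mem ha, hAk], fun f hf => ?_⟩
    rw [hall f hf]
    exact erase_subset a A
  push Not at hall
  obtain ⟨f, hf, hfA⟩ := hall
  have hfk := hF f hf
  obtain ⟨a, ha, haf⟩ : ∃ a ∈ A, a ∉ f := by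
    by_contra! hc
    exact hfA (eq_of_subset_of_card_le hc (by omega)).symm
  obtain ⟨x, hx, hxA⟩ : ∃ x ∈ f, x ∉ A := by
    by_contra! hc
    exact hfA (eq_of_subset_of_card_le hc (by omega))
  by_cases hD : ∀ g ∈ F, A.erase a ⊆ g
  · exact Or.inl ⟨A.erase a, by rw [card_erase_of_mem ha, hAk], hD⟩
  right
  push Not at hD
  obtain ⟨g, hg, hgD⟩ := hD
  obtain ⟨d, hd, hdg⟩ := not_subset.1 hgD
  rw [mem_erase] at hd
  have hdf : d ∈ f := erase_subset_of_near (hn A hA f hf) ha haf (mem_erase.2 hd)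
  have hxg : x ∈ g := by
    by_contra hxg
    exact hxA (hn f hf g hg x hx d hdf hxg hdg ▸ hd.2)
  have hgs : ∀ z ∈ g, z ∉ A → z = x := fun z hz hzA => hn g hg A hA z hz x hxg hzA hxA
  refine ⟨x, hxA, fun h hh z hz => ?_⟩
  rw [mem_insert]
  by_contra! hc
  have hxh : x ∉ h := fun hxh => hc.1 (hn h hh A hA z hz x hxh hc.2 hxA)
  have hdh : d ∈ h := by
    by_contra hdh
    exact hxA (hn f hf h hh x hx d hdf hxh hdh ▸ hd.2)
  exact hc.2 (hn h hh g hg z hz d hdh (fun hzg => hc.1 (hgs z hzg hc.2)) hdg ▸ hd.2)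

theorem exists_cover_erase {k : ℕ} (hk : 1 ≤ k) {P : Finset V} (hP : P.card = k + 1) (n : ℕ) :
    ∀ T ⊆ P, T.card = n → ∃ C : Finset (Finset V), (∀ c ∈ C, c.card = k - 1) ∧
      C.card ≤ (n + 1) / 2 ∧ ∀ t ∈ T, ∃ c ∈ C, c ⊆ P.erase t := by
  have hpair : ∀ u ∈ P, ∀ v ∈ P, u ≠ v → ((P.erase u).erase v).card = k - 1 := by
    intro u hu v hv huv
    rw [card_erase_of_mem (mem_erase.2 ⟨huv.symm, hv⟩), card_erase_of_mem hu, hP]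
    omega
  induction n using Nat.strong_induction_on with
  | _ n ih =>
    intro T hT hTn
    rcases T.eq_empty_or_nonempty with rfl | ⟨u, hu⟩
    · exact ⟨∅, by simp, by simp, by simp⟩
    rcases (T.erase u).eq_empty_or_nonempty with he | ⟨v, hv⟩
    · obtain ⟨v, hv⟩ : (P.erase u).Nonempty :=
        card_pos.1 (by rw [card_erase_of_mem (hT hu)]; omega)
      rw [mem_erase] at hv
      have hTn1 : 1 ≤ n := by rw [← hTn]; exact card_pos.2 ⟨u, hu⟩
      refine ⟨{(P.erase u).erase v}, ?_, ?_, ?_⟩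
      · simpa using hpair u (hT hu) v hv.2 hv.1.symm
      · rw [card_singleton]; omega
      · intro t ht
        have htu : t = u := by
          by_contra htu
          have := mem_erase.2 ⟨htu, ht⟩
          simp [he] at this
        exact ⟨_, mem_singleton_self _, htu ▸ erase_subset _ _⟩
    · have hc : ((T.erase u).erase v).card + 2 = n := by
        have h1 := card_erase_add_one hv
        have h2 := card_erase_add_one hu
        omega
      obtain ⟨C, h1, h2, h3⟩ := ih _ (by omega) ((T.erase u).erase v)
        (((erase_subset _ _).trans (erase_subset _ _)).trans hT) rfl
      rw [mem_erase] at hv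
      refine ⟨insert ((P.erase u).erase v) C, ?_, ?_, ?_⟩
      · intro c hc
        rcases mem_insert.1 hc with rfl | hc
        · exact hpair u (hT hu) v (hT hv.2) hv.1.symm
        · exact h1 c hc
      · have := card_insert_le ((P.erase u).erase v) C
        omega
      · intro t ht
        by_cases htu : t = u
        · exact ⟨_, mem_insert_self _ _, htu ▸ erase_subset _ _⟩
        by_cases htv : t = v
        · exact ⟨_, mem_insert_self _ _, htv ▸ erase_subset_erase _ (erase_subset _ _)⟩
        obtain ⟨c, hc, hct⟩ := h3 t (mem_erase.2 ⟨htv, mem_erase.2 ⟨htu, ht⟩⟩)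
        exact ⟨c, mem_insert_of_mem hc, hct⟩

/-- The `k`-subsets of a `(k + 1)`-set `insert x A` have a `(k - 1)`-cover of size
`⌈(k + 1) / 2⌉` that uses a prescribed `(k - 1)`-subset of `A`. -/
theorem exists_cover_subset_insert {k : ℕ} (hk : 1 ≤ k) {A : Finset V} (hA : A.card = k) {x a : V}
    (hx : x ∉ A) (ha : a ∈ A) :
    ∃ C : Finset (Finset V), (∀ c ∈ C, c.card = k - 1) ∧ C.card ≤ (k + 2) / 2 ∧ A.erase a ∈ C ∧
      ∀ e ⊆ insert x A, e.card = k → ∃ c ∈ C, c ⊆ e := by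
  have hP : (insert x A).card = k + 1 := by rw [card_insert_of_notMem hx, hA]
  have hAa : (A.erase a).card = k - 1 := by rw [card_erase_of_mem ha, hA]
  obtain ⟨C, h1, h2, h3⟩ := exists_cover_erase hk hP (k - 1) (A.erase a)
    ((erase_subset _ _).trans (subset_insert _ _)) hAa
  refine ⟨insert (A.erase a) C, ?_, ?_, mem_insert_self _ _, ?_⟩
  · intro c hc
    rcases mem_insert.1 hc with rfl | hc
    · exact hAa
    · exact h1 c hc
  · have := card_insert_le (A.erase a) C
    omega
  · intro e he hek
    obtain ⟨t, ht, hte⟩ : ∃ t ∈ insert x A, t ∉ e := by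
      by_contra! hc
      have := card_le_card (show insert x A ⊆ e from hc)
      omega
    have hee : e = (insert x A).erase t := by
      refine eq_of_subset_of_card_le (subset_erase.2 ⟨he, hte⟩) ?_
      rw [card_erase_of_mem ht]
      omega
    by_cases htA : t ∈ A.erase a
    · obtain ⟨c, hc, hct⟩ := h3 t htA
      exact ⟨c, mem_insert_of_mem hc, hee ▸ hct⟩
    · exact ⟨_, mem_insert_self _ _,
        hee ▸ subset_erase.2 ⟨(erase_subset _ _).trans (subset_insert _ _), htA⟩⟩

theorem exists_cover_of_near {k : ℕ} (hk : 2 ≤ k) {F : Finset (Finset V)}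
    (hF : ∀ e ∈ F, e.card = k) (hn : ∀ e ∈ F, ∀ f ∈ F, Near e f) {A : Finset V} (hA : A ∈ F)
    {a : V} (ha : a ∈ A) :
    ∃ C : Finset (Finset V), (∀ c ∈ C, c.card = k - 1) ∧ C.card ≤ (k + 2) / 2 ∧ A.erase a ∈ C ∧
      ∀ e ∈ F, ∃ c ∈ C, c ⊆ e := by
  have hAk := hF A hA
  rcases exists_common_subset_or_subset_insert (by omega) hF hn hA with
    ⟨D, hD, hDF⟩ | ⟨x, hx, hxF⟩
  · refine ⟨{A.erase a, D}, ?_, ?_, by simp, fun e he => ⟨D, by simp, hDF e he⟩⟩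
    · intro c hc
      rcases mem_insert.1 hc with rfl | hc
      · rw [card_erase_of_mem ha, hAk]
      · rw [mem_singleton.1 hc, hD]
    · have := card_le_two (a := A.erase a) (b := D)
      omega
  · obtain ⟨C, h1, h2, h3, h4⟩ := exists_cover_subset_insert (by omega) hAk hx ha
    exact ⟨C, h1, h2, h3, fun e he => h4 e (hxF e he) (hF e he)⟩

section Cover

variable {k : ℕ} {H : Finset (Finset V)} {A B : Finset V}

theorem exists_cover_of_common_subset (hk : 2 ≤ k) (hH : ∀ e ∈ H, e.card = k)
    (hB : B ∈ H) (hBA : ¬ Near B A)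
    (hnB : ∀ e ∈ privateEdges H B A, ∀ f ∈ privateEdges H B A, Near e f)
    (hcov : ∀ e ∈ H, e ∈ privateEdges H A B ∨ e ∈ privateEdges H B A ∨ (Near e A ∧ Near e B))
    {D : Finset V} (hD : D.card = k - 1) (hDF : ∀ e ∈ privateEdges H A B, D ⊆ e) :
    ∃ C, IsCover (k - 1) H C ∧ C.card ≤ 2 * ((k + 2) / 2) := by
  have hBk := hH B hB
  obtain ⟨b, hb, b', hb', hbA, hbA', hbb⟩ := exists_pair_of_not_near hBA
  obtain ⟨C, h1, h2, h3, h4⟩ := exists_cover_of_near hk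
    (fun e he => hH e (mem_privateEdges.1 he).1) hnB (self_mem_privateEdges hB hBA) hb
  refine ⟨insert D (insert (B.erase b') C), ⟨?_, ?_⟩, ?_⟩
  · intro c hc
    rcases mem_insert.1 hc with rfl | hc
    · exact hD
    rcases mem_insert.1 hc with rfl | hc
    · rw [card_erase_of_mem hb', hBk]
    · exact h1 c hc
  · intro e he
    rcases hcov e he with h | h | ⟨hA', hB'⟩
    · exact ⟨D, by simp, hDF e h⟩
    · obtain ⟨c, hc, hce⟩ := h4 e h
      exact ⟨c, by simp [hc], hce⟩
    · have hBe := hB'.symm ((hH e he).trans hBk.symm)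
      by_cases hbe : b ∈ e
      · have hbe' : b' ∉ e := fun h => hbb (hA' b hbe b' h hbA hbA')
        exact ⟨_, by simp, erase_subset_of_near hBe hb' hbe'⟩
      · exact ⟨B.erase b, by simp [h3], erase_subset_of_near hBe hb hbe⟩
  · have h5 := card_insert_le D (insert (B.erase b') C)
    have h6 := card_insert_le (B.erase b') C
    omega

theorem exists_cover_of_private_subset_insert_mem (hk : 1 ≤ k) (hH : ∀ e ∈ H, e.card = k)
    (hA : A ∈ H) (hB : B ∈ H)
    (hcov : ∀ e ∈ H, e ∈ privateEdges H A B ∨ e ∈ privateEdges H B A ∨ (Near e A ∧ Near e B))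
    {x y : V} (hxA : x ∉ A) (hyB : y ∉ B) (hx : ∀ e ∈ privateEdges H A B, e ⊆ insert x A)
    (hy : ∀ e ∈ privateEdges H B A, e ⊆ insert y B) (hyA : y ∈ A) :
    ∃ C, IsCover (k - 1) H C ∧ C.card ≤ 2 * ((k + 2) / 2) := by
  obtain ⟨b, hb⟩ : B.Nonempty := card_pos.1 (by rw [hH B hB]; omega)
  obtain ⟨C, h1, h2, h3, h4⟩ := exists_cover_subset_insert hk (hH A hA) hxA hyA
  obtain ⟨C', h1', h2', -, h4'⟩ := exists_cover_subset_insert hk (hH B hB) hyB hb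
  refine ⟨C ∪ C', ⟨?_, ?_⟩, ?_⟩
  · intro c hc
    rcases mem_union.1 hc with hc | hc
    exacts [h1 c hc, h1' c hc]
  · intro e he
    have hl : e ⊆ insert x A → ∃ c ∈ C ∪ C', c ⊆ e := fun h => by
      obtain ⟨c, hc, hce⟩ := h4 e h (hH e he)
      exact ⟨c, mem_union_left _ hc, hce⟩
    have hr : e ⊆ insert y B → ∃ c ∈ C ∪ C', c ⊆ e := fun h => by
      obtain ⟨c, hc, hce⟩ := h4' e h (hH e he)
      exact ⟨c, mem_union_right _ hc, hce⟩
    rcases hcov e he with h | h | ⟨hA', hB'⟩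
    · exact hl (hx e h)
    · exact hr (hy e h)
    · by_cases hye : y ∈ e
      · refine hr fun z hz => ?_
        rw [mem_insert]
        by_contra! hc
        exact hc.1 (hB' z hz y hye hc.2 hyB)
      · exact ⟨_, mem_union_left _ h3,
          erase_subset_of_near (hA'.symm ((hH e he).trans (hH A hA).symm)) hyA hye⟩
  · have := card_union_le C C'
    omega

theorem exists_cover_of_private_subset_insert_notMem (hk : 2 ≤ k) (hH : ∀ e ∈ H, e.card = k)
    (hA : A ∈ H) (hB : B ∈ H) (hAB : ¬ Near A B) (hBA : ¬ Near B A)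
    (htri : ∀ e ∈ H, ∀ f ∈ H, ∀ g ∈ H, Near e f ∨ Near e g ∨ Near f g)
    (hcov : ∀ e ∈ H, e ∈ privateEdges H A B ∨ e ∈ privateEdges H B A ∨ (Near e A ∧ Near e B))
    {x : V} (hxA : x ∉ A) (hxB : x ∉ B) (hx : ∀ e ∈ privateEdges H A B, e ⊆ insert x A) :
    ∃ C, IsCover (k - 1) H C ∧ C.card ≤ 2 * ((k + 2) / 2) := by
  have hnA := near_of_mem_privateEdges (A := A) hB htri
  have hnB := near_of_mem_privateEdges (A := B) hA htri
  have hAk := hH A hA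
  have hBk := hH B hB
  have hnear : ∀ e ∈ H, Near e A → Near A e :=
    fun e he h => h.symm ((hH e he).trans hAk.symm)
  have hnear' : ∀ e ∈ H, Near e B → Near B e :=
    fun e he h => h.symm ((hH e he).trans hBk.symm)
  obtain ⟨a, ha, a', ha', haB, haB', haa⟩ := exists_pair_of_not_near hAB
  obtain ⟨b, hb, b', hb', hbA, hbA', hbb⟩ := exists_pair_of_not_near hBA
  have hF : ∀ e ∈ privateEdges H A B, e.card = k := fun e he => hH e (mem_privateEdges.1 he).1
  have hF' : ∀ e ∈ privateEdges H B A, e.card = k := fun e he => hH e (mem_privateEdges.1 he).1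
  by_cases hmiss : ∃ u ∈ A, ∃ v ∈ B, ∀ e ∈ H, Near e A → Near e B → ¬ (u ∈ e ∧ v ∈ e)
  · obtain ⟨u, hu, v, hv, huv⟩ := hmiss
    obtain ⟨C, h1, h2, h3, h4⟩ :=
      exists_cover_of_near hk hF hnA (self_mem_privateEdges hA hAB) hu
    obtain ⟨C', h1', h2', h3', h4'⟩ :=
      exists_cover_of_near hk hF' hnB (self_mem_privateEdges hB hBA) hv
    refine ⟨C ∪ C', ⟨?_, ?_⟩, ?_⟩
    · intro c hc
      rcases mem_union.1 hc with hc | hc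
      exacts [h1 c hc, h1' c hc]
    · intro e he
      rcases hcov e he with h | h | ⟨hA', hB'⟩
      · obtain ⟨c, hc, hce⟩ := h4 e h
        exact ⟨c, mem_union_left _ hc, hce⟩
      · obtain ⟨c, hc, hce⟩ := h4' e h
        exact ⟨c, mem_union_right _ hc, hce⟩
      · by_cases hue : u ∈ e
        · have hve : v ∉ e := fun h => huv e he hA' hB' ⟨hue, h⟩
          exact ⟨_, mem_union_right _ h3', erase_subset_of_near (hnear' e he hB') hv hve⟩
        · exact ⟨_, mem_union_left _ h3, erase_subset_of_near (hnear e he hA') hu hue⟩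
    · have := card_union_le C C'
      omega
  push Not at hmiss
  obtain ⟨e, he, heA, heB, hae, hbe⟩ := hmiss a ha b hb
  obtain ⟨f, hf, hfA, hfB, haf, hbf⟩ := hmiss a' ha' b' hb'
  have key : ∀ g ∈ privateEdges H A B, ¬ (a ∈ g ∧ a' ∈ g ∧ x ∈ g) := by
    rintro g hg ⟨hag, hag', hxg⟩
    have hae' : a' ∉ e := fun h => haa (heB a hae a' h haB haB')
    have haf' : a ∉ f := fun h => haa (hfB a h a' haf haB haB')
    have hbf' : b ∉ f := fun h => hbb (hfA b h b' hbf hbA hbA')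
    have hxe : x ∉ e := fun h => hxA (heB a hae x h haB hxB ▸ ha)
    have hxf : x ∉ f := fun h => hxA (hfB a' haf x h haB' hxB ▸ ha')
    rcases htri g (mem_privateEdges.1 hg).1 e he f hf with h | h | h
    · exact hxA (h a' hag' x hxg hae' hxe ▸ ha')
    · exact hxA (h a hag x hxg haf' hxf ▸ ha)
    · exact hbA (h a hae b hbe haf' hbf' ▸ ha)
  obtain ⟨C, h1, h2, h3, h4⟩ :=
    exists_cover_of_near hk hF' hnB (self_mem_privateEdges hB hBA) hb
  refine ⟨insert (A.erase a) (insert (A.erase a') C), ⟨?_, ?_⟩, ?_⟩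
  · intro c hc
    rcases mem_insert.1 hc with rfl | hc
    · rw [card_erase_of_mem ha, hAk]
    rcases mem_insert.1 hc with rfl | hc
    · rw [card_erase_of_mem ha', hAk]
    · exact h1 c hc
  · intro g hg
    have hmissing : Near g A → ¬ (a ∈ g ∧ a' ∈ g) →
        ∃ c ∈ insert (A.erase a) (insert (A.erase a') C), c ⊆ g := by
      intro hgA hag
      by_cases h : a ∈ g
      · exact ⟨A.erase a', by simp,
          erase_subset_of_near (hnear g hg hgA) ha' fun h' => hag ⟨h, h'⟩⟩
      · exact ⟨A.erase a, by simp, erase_subset_of_near (hnear g hg hgA) ha h⟩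
    rcases hcov g hg with h | h | ⟨hA', hB'⟩
    · by_cases hxg : x ∈ g
      · exact hmissing (mem_privateEdges.1 h).2.1 fun h' => key g h ⟨h'.1, h'.2, hxg⟩
      · have hgA : g ⊆ A := (subset_insert_iff_of_notMem hxg).1 (hx g h)
        have : g = A := eq_of_subset_of_card_le hgA (by rw [hAk, hH g hg])
        exact ⟨A.erase a, by simp, this ▸ erase_subset _ _⟩
    · obtain ⟨c, hc, hce⟩ := h4 g h
      exact ⟨c, by simp [hc], hce⟩
    · exact hmissing hA' fun h => haa (hB' a h.1 a' h.2 haB haB')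
  · have h5 := card_insert_le (A.erase a) (insert (A.erase a') C)
    have h6 := card_insert_le (A.erase a') C
    omega

end Cover

end Auxiliary

/-- If `H` is a `k`-uniform hypergraph with `ν^(k-1)(H) = 2`, then
`τ^(k-1)(H) ≤ 2⌈(k+1)/2⌉`. -/
theorem stmt1 {V : Type*} [DecidableEq V] (k : ℕ) (hk : 3 ≤ k)
    (H : Finset (Finset V)) (hH : ∀ e ∈ H, e.card = k)
    (hex : ∃ M, IsMatching (k - 1) H M ∧ M.card = 2)
    (hmax : ∀ M, IsMatching (k - 1) H M → M.card ≤ 2) :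
    ∃ C, IsCover (k - 1) H C ∧ C.card ≤ 2 * ((k + 2) / 2) := by
  have htri : ∀ e ∈ H, ∀ f ∈ H, ∀ g ∈ H, Near e f ∨ Near e g ∨ Near f g := by
    intro e he f hf g hg
    by_contra! hc
    obtain ⟨hef, heg, hfg⟩ := hc
    have hrefl : ∀ s : Finset V, Near s s := fun _ _ hu _ _ hu' => absurd hu hu'
    have hef' : e ≠ f := fun h => hef (h ▸ hrefl e)
    have heg' : e ≠ g := fun h => heg (h ▸ hrefl e)
    have hfg' : f ≠ g := fun h => hfg (h ▸ hrefl f)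
    have h1 := card_inter_lt_of_not_near (hH e he) hef
    have h2 := card_inter_lt_of_not_near (hH e he) heg
    have h3 := card_inter_lt_of_not_near (hH f hf) hfg
    have h := hmax {e, f, g} ⟨by simp [insert_subset_iff, he, hf, hg], by
      intro s hs t ht hst
      simp only [mem_insert, mem_singleton] at hs ht
      rcases hs with rfl | rfl | rfl <;> rcases ht with rfl | rfl | rfl <;>
        first
          | exact absurd rfl hst
          | assumption
          | (rw [inter_comm]; assumption)⟩
    rw [card_eq_three.2 ⟨e, f, g, hef', heg', hfg', rfl⟩] at h
    omega
  obtain ⟨M, ⟨hMH, hM⟩, hM2⟩ := hex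
  obtain ⟨A, B, hne, rfl⟩ := card_eq_two.1 hM2
  have hA : A ∈ H := hMH (by simp)
  have hB : B ∈ H := hMH (by simp)
  have hAB : ¬ Near A B := by
    rw [near_iff_card_sdiff_le_one]
    have h1 := card_sdiff_add_card_inter A B
    have h2 := hM A (by simp) B (by simp) hne
    have h3 := hH A hA
    omega
  have hBA : ¬ Near B A := fun h => hAB (h.symm ((hH B hB).trans (hH A hA).symm))
  have hcov : ∀ e ∈ H,
      e ∈ privateEdges H A B ∨ e ∈ privateEdges H B A ∨ (Near e A ∧ Near e B) := by
    intro e he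
    simp only [mem_privateEdges]
    have := htri e he A hA B hB
    tauto
  have hcov' : ∀ e ∈ H,
      e ∈ privateEdges H B A ∨ e ∈ privateEdges H A B ∨ (Near e B ∧ Near e A) := by
    intro e he
    have := hcov e he
    tauto
  have hnA := near_of_mem_privateEdges (A := A) hB htri
  have hnB := near_of_mem_privateEdges (A := B) hA htri
  rcases exists_common_subset_or_subset_insert (by omega)
    (fun e he => hH e (mem_privateEdges.1 he).1) hnA (self_mem_privateEdges hA hAB) with
    ⟨D, hD, hDF⟩ | ⟨x, hxA, hx⟩
  · exact exists_cover_of_common_subset (by omega) hH hB hBA hnB hcov hD hDF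
  rcases exists_common_subset_or_subset_insert (by omega)
    (fun e he => hH e (mem_privateEdges.1 he).1) hnB (self_mem_privateEdges hB hBA) with
    ⟨D, hD, hDF⟩ | ⟨y, hyB, hy⟩
  · exact exists_cover_of_common_subset (by omega) hH hA hAB hnA hcov' hD hDF
  by_cases hxB : x ∈ B
  · exact exists_cover_of_private_subset_insert_mem (by omega) hH hB hA hcov' hyB hxA hy hx hxB
  · exact exists_cover_of_private_subset_insert_notMem (by omega) hH hA hB hAB hBA htri hcov
      hxA hxB hx
end

section
/- Let k ≥ 3 and let H be a k-uniform hypergraph with ν^(k−1)(H) = 3. Then τ^(k−1)(H) ≤ 3⌈(k+1)/2⌉. -/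
open Finset

namespace TuzaHypergraph

variable {V : Type*} {k n m : ℕ} {A B H K : Set (Finset V)} {e f g h X : Finset V}

/-- All members of `A` can be hit by at most `n` sets of size `k - 1`. -/
def Coverable (k n : ℕ) (A : Set (Finset V)) : Prop :=
  ∃ C : Finset (Finset V), (∀ c ∈ C, c.card = k - 1) ∧ (∀ e ∈ A, ∃ c ∈ C, c ⊆ e) ∧ C.card ≤ n

theorem Coverable.mono (hA : Coverable k n A) (hBA : B ⊆ A) (hnm : n ≤ m) : Coverable k m B := by
  obtain ⟨C, h1, h2, h3⟩ := hA
  exact ⟨C, h1, fun e he => h2 e (hBA he), h3.trans hnm⟩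

theorem coverable_of_subset_empty (h : A ⊆ ∅) : Coverable k n A :=
  ⟨∅, by simp, fun e he => (h he).elim, by simp⟩

theorem coverable_of_star {c : Finset V} (hc : c.card = k - 1) (h : ∀ e ∈ A, c ⊆ e) :
    Coverable k 1 A :=
  ⟨{c}, by simpa using hc, fun e he => ⟨c, by simp, h e he⟩, by simp⟩

variable [DecidableEq V]

theorem Coverable.union (hA : Coverable k n A) (hB : Coverable k m B) :
    Coverable k (n + m) (A ∪ B) := by
  obtain ⟨C, h1, h2, h3⟩ := hA
  obtain ⟨D, k1, k2, k3⟩ := hB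
  refine ⟨C ∪ D, ?_, ?_, (card_union_le _ _).trans (by omega)⟩
  · intro c hc
    rcases mem_union.1 hc with hc | hc
    exacts [h1 c hc, k1 c hc]
  · rintro e (he | he)
    · obtain ⟨c, hc, hce⟩ := h2 e he
      exact ⟨c, mem_union_left _ hc, hce⟩
    · obtain ⟨c, hc, hce⟩ := k2 e he
      exact ⟨c, mem_union_right _ hc, hce⟩

theorem coverable_of_erase {T : Finset V} (he : e.card = k) (hT : T ⊆ e)
    (h : ∀ f ∈ A, ∃ s ∈ T, e.erase s ⊆ f) : Coverable k T.card A := by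
  refine ⟨T.image e.erase, ?_, ?_, card_image_le⟩
  · intro c hc
    obtain ⟨s, hs, rfl⟩ := mem_image.1 hc
    rw [card_erase_of_mem (hT hs), he]
  · intro f hf
    obtain ⟨s, hs, hsf⟩ := h f hf
    exact ⟨_, mem_image_of_mem _ hs, hsf⟩

theorem coverable_erase_pairs (hk : 1 ≤ k) (hX : X.card = k + 1) (r : ℕ) :
    ∀ D : Finset V, D ⊆ X → D.card ≤ 2 * r → Coverable k r {f | ∃ d ∈ D, f = X.erase d} := by
  induction r with
  | zero =>
    intro D _ hD
    have : D = ∅ := by simpa using hD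
    subst this
    exact coverable_of_subset_empty (by simp)
  | succ r ih =>
    intro D hDX hD
    obtain rfl | ⟨d, hd⟩ := D.eq_empty_or_nonempty
    · exact coverable_of_subset_empty (by simp)
    obtain ⟨d', hd', hne, hcard⟩ : ∃ d' ∈ X, d' ≠ d ∧ ((D.erase d).erase d').card ≤ 2 * r := by
      have h1 := card_erase_of_mem hd
      obtain h0 | ⟨d', hd'⟩ := (D.erase d).eq_empty_or_nonempty
      · obtain ⟨d', hd'⟩ : (X.erase d).Nonempty := by
          rw [← card_pos, card_erase_of_mem (hDX hd)]
          omega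
        exact ⟨d', mem_of_mem_erase hd', ne_of_mem_erase hd', by simp [h0]⟩
      · refine ⟨d', hDX (mem_of_mem_erase hd'), ne_of_mem_erase hd', ?_⟩
        rw [card_erase_of_mem hd']
        omega
    have hc : ((X.erase d).erase d').card = k - 1 := by
      rw [card_erase_of_mem (mem_erase.2 ⟨hne, hd'⟩), card_erase_of_mem (hDX hd), hX]
      omega
    have h1 : Coverable k 1 {f | f = X.erase d ∨ f = X.erase d'} := by
      refine coverable_of_star hc ?_
      rintro f (rfl | rfl)
      · exact erase_subset _ _
      · rw [erase_right_comm]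
        exact erase_subset _ _
    refine ((ih _ (((erase_subset _ _).trans (erase_subset _ _)).trans hDX) hcard).union h1).mono
      ?_ le_rfl
    rintro f ⟨x, hx, rfl⟩
    by_cases h1 : x = d
    · right; left; rw [h1]
    by_cases h2 : x = d'
    · right; right; rw [h2]
    · left
      exact ⟨x, by simp [h1, h2, hx], rfl⟩

theorem eq_erase_of_subset (hX : X.card = k + 1) (hf : f.card = k) (hfX : f ⊆ X) :
    ∃ d ∈ X, f = X.erase d := by
  have h1 : (X \ f).card = 1 := by
    rw [card_sdiff_of_subset hfX]
    omega
  obtain ⟨d, hd⟩ := card_eq_one.1 h1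
  refine ⟨d, (mem_sdiff.1 (hd ▸ mem_singleton_self d)).1, ?_⟩
  rw [← sdiff_singleton_eq_erase, ← hd, Finset.sdiff_sdiff_eq_self hfX]

theorem coverable_of_subset (hk : 1 ≤ k) (hX : X.card = k + 1)
    (hA : ∀ f ∈ A, f.card = k ∧ f ⊆ X) : Coverable k ((k + 2) / 2) A :=
  (coverable_erase_pairs hk hX _ X subset_rfl (by omega)).mono
    (fun f hf => eq_erase_of_subset hX (hA f hf).1 (hA f hf).2) le_rfl

/-- Two `k`-sets sharing at least `k - 1` elements (in particular, two equal ones). -/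
def Adj (k : ℕ) (e f : Finset V) : Prop := k ≤ (e ∩ f).card + 1

theorem Adj.symm (h : Adj k e f) : Adj k f e := by
  rwa [Adj, inter_comm]

theorem adj_comm : Adj k e f ↔ Adj k f e := ⟨Adj.symm, Adj.symm⟩

theorem adj_self (he : e.card = k) : Adj k e e := by
  simp [Adj, he]

/-- Replace the element `s` of `e` by `u`. -/
def swap (e : Finset V) (s u : V) : Finset V := insert u (e.erase s)

theorem erase_subset_swap {s u : V} : e.erase s ⊆ swap e s u := subset_insert _ _

theorem swap_eq_erase {s u : V} (hs : s ∈ e) (hu : u ∉ e) :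
    swap e s u = (insert u e).erase s := by
  have : u ≠ s := fun h => hu (h ▸ hs)
  rw [swap, erase_insert_of_ne this]

theorem mem_swap {s u x : V} : x ∈ swap e s u ↔ x = u ∨ x ≠ s ∧ x ∈ e := by
  simp [swap]

theorem card_swap_inter {s u : V} (hs : s ∈ e) (hu : u ∉ e) (g : Finset V) :
    (swap e s u ∩ g).card + (if s ∈ g then 1 else 0)
      = (e ∩ g).card + (if u ∈ g then 1 else 0) := by
  have h1 : ((e ∩ g).erase s).card + (if s ∈ g then 1 else 0) = (e ∩ g).card := by
    split_ifs with h
    · exact card_erase_add_one (mem_inter.2 ⟨hs, h⟩)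
    · rw [erase_eq_of_notMem (fun h' => h (mem_inter.1 h').2), add_zero]
  have h2 : (swap e s u ∩ g).card = ((e ∩ g).erase s).card + (if u ∈ g then 1 else 0) := by
    split_ifs with h
    · rw [swap, insert_inter_of_mem h, erase_inter, card_insert_of_notMem]
      simp [hu]
    · rw [swap, insert_inter_of_notMem h, erase_inter, add_zero]
  omega

theorem exists_eq_swap (he : e.card = k) (hf : f.card = k) (h : Adj k e f) (hne : f ≠ e) :
    ∃ s ∈ e, ∃ u ∉ e, f = swap e s u := by
  have h1 := card_sdiff_add_card_inter e f
  have h2 := card_sdiff_add_card_inter f e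
  rw [inter_comm f e] at h2
  have h3 : (e \ f).card ≠ 0 := by
    intro h0
    rw [card_eq_zero, sdiff_eq_empty_iff_subset] at h0
    exact hne (eq_of_subset_of_card_le h0 (by omega)).symm
  unfold Adj at h
  obtain ⟨s, hs⟩ := card_eq_one.1 (show (e \ f).card = 1 by omega)
  obtain ⟨u, hu⟩ := card_eq_one.1 (show (f \ e).card = 1 by omega)
  have key1 : ∀ x, (x ∈ e ∧ x ∉ f) ↔ x = s := fun x => by
    rw [← mem_sdiff, hs, mem_singleton]
  have key2 : ∀ x, (x ∈ f ∧ x ∉ e) ↔ x = u := fun x => by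
    rw [← mem_sdiff, hu, mem_singleton]
  refine ⟨s, ((key1 s).2 rfl).1, u, ((key2 u).2 rfl).2, ?_⟩
  ext x
  rw [mem_swap]
  have := key1 x
  have := key2 x
  tauto

theorem eq_or_eq_of_adj_swap {s s' u u' : V} (he : e.card = k) (hs : s ∈ e) (hs' : s' ∈ e)
    (hu : u ∉ e) (hu' : u' ∉ e) (h : Adj k (swap e s u) (swap e s' u')) : s = s' ∨ u = u' := by
  by_contra! hcon
  have h1 := card_swap_inter hs hu (swap e s' u')
  have h2 := card_swap_inter hs' hu' e
  rw [inter_comm] at h2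
  have h3 : s ∈ swap e s' u' := mem_swap.2 (Or.inr ⟨hcon.1, hs⟩)
  have h4 : u ∉ swap e s' u' := by
    rw [mem_swap]
    tauto
  simp only [h3, h4, if_true, if_false, hs', hu', inter_self] at h1 h2
  unfold Adj at h
  omega

/-- A family of pairwise adjacent swaps of `e` removes a fixed element or adds a fixed one. -/
theorem swap_clique (he : e.card = k) (hk : 1 ≤ k)
    (hK : ∀ f ∈ K, ∃ s ∈ e, ∃ u ∉ e, f = swap e s u) (hadj : ∀ f ∈ K, ∀ g ∈ K, Adj k f g) :
    (∃ s ∈ e, ∀ f ∈ K, ∃ u ∉ e, f = swap e s u) ∨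
      (∃ u ∉ e, ∀ f ∈ K, ∃ s ∈ e, f = swap e s u) := by
  obtain rfl | ⟨f₀, hf₀⟩ := K.eq_empty_or_nonempty
  · obtain ⟨s, hs⟩ : e.Nonempty := by
      rw [← card_pos]
      omega
    exact Or.inl ⟨s, hs, by simp⟩
  obtain ⟨s₀, hs₀, u₀, hu₀, rfl⟩ := hK f₀ hf₀
  by_cases hall : ∀ f ∈ K, ∃ u ∉ e, f = swap e s₀ u
  · exact Or.inl ⟨s₀, hs₀, hall⟩
  right
  push Not at hall
  obtain ⟨f₁, hf₁, hne⟩ := hall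
  obtain ⟨s₁, hs₁, u₁, hu₁, rfl⟩ := hK f₁ hf₁
  have hs : s₀ ≠ s₁ := by
    rintro rfl
    exact hne u₁ hu₁ rfl
  have hu : u₀ = u₁ :=
    (eq_or_eq_of_adj_swap he hs₀ hs₁ hu₀ hu₁ (hadj _ hf₀ _ hf₁)).resolve_left hs
  subst hu
  refine ⟨u₀, hu₀, fun f hf => ?_⟩
  obtain ⟨s, hs', u, hu', rfl⟩ := hK f hf
  have h1 := eq_or_eq_of_adj_swap he hs₀ hs' hu₀ hu' (hadj _ hf₀ _ hf)
  have h2 := eq_or_eq_of_adj_swap he hs₁ hs' hu₁ hu' (hadj _ hf₁ _ hf)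
  have : u₀ = u := by
    rcases h1 with h1 | h1
    · rcases h2 with h2 | h2
      · exact absurd (h1.trans h2.symm) hs
      · exact h2
    · exact h1
  exact ⟨s, hs', by rw [this]⟩

theorem coverable_swap_clique (he : e.card = k) (hk : 1 ≤ k) {r : ℕ} (hr : 1 ≤ r)
    (hK : ∀ f ∈ K, ∃ s ∈ e, ∃ u ∉ e, f = swap e s u) (hadj : ∀ f ∈ K, ∀ g ∈ K, Adj k f g) :
    Coverable k r K ∨ ∃ u ∉ e, ∃ D ⊆ e, 2 * r < D.card ∧ ∀ s ∈ D, swap e s u ∈ K := by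
  classical
  rcases swap_clique he hk hK hadj with ⟨s, hs, h⟩ | ⟨u, hu, h⟩
  · left
    refine (coverable_of_star (c := e.erase s) (by rw [card_erase_of_mem hs, he]) ?_).mono
      subset_rfl hr
    intro f hf
    obtain ⟨u, -, rfl⟩ := h f hf
    exact erase_subset_swap
  · by_cases hD : 2 * r < (e.filter fun s => swap e s u ∈ K).card
    · right
      exact ⟨u, hu, _, filter_subset _ _, hD, fun s hs => (mem_filter.1 hs).2⟩
    · left
      refine (coverable_erase_pairs hk (X := insert u e) (by rw [card_insert_of_notMem hu, he]) r
        (e.filter fun s => swap e s u ∈ K) ((filter_subset _ _).trans (subset_insert _ _))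
        (by omega)).mono ?_ le_rfl
      intro f hf
      obtain ⟨s, hs, rfl⟩ := h f hf
      exact ⟨s, mem_filter.2 ⟨hs, hf⟩, swap_eq_erase hs hu⟩

theorem swap_subset_insert {s u : V} : swap e s u ⊆ insert u e :=
  insert_subset_insert _ (erase_subset _ _)

/-- A clique through `e` has a common `(k - 1)`-subset of `e`, or lies in `e` plus one point. -/
theorem clique_through (he : e.card = k) (hk : 1 ≤ k) (hcard : ∀ f ∈ K, f.card = k)
    (hKe : ∀ f ∈ K, Adj k e f) (hadj : ∀ f ∈ K, ∀ g ∈ K, Adj k f g) :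
    (∃ s ∈ e, ∀ f ∈ K, e.erase s ⊆ f) ∨
      (∃ u ∉ e, ∀ f ∈ K, f = e ∨ ∃ s ∈ e, f = swap e s u) := by
  rcases swap_clique (K := {f | f ∈ K ∧ f ≠ e}) he hk
    (fun f hf => exists_eq_swap he (hcard f hf.1) (hKe f hf.1) hf.2)
    (fun f hf g hg => hadj f hf.1 g hg.1) with ⟨s, hs, h⟩ | ⟨u, hu, h⟩
  · refine Or.inl ⟨s, hs, fun f hf => ?_⟩
    by_cases hfe : f = e
    · rw [hfe]
      exact erase_subset _ _
    · obtain ⟨u, -, rfl⟩ := h f ⟨hf, hfe⟩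
      exact erase_subset_swap
  · refine Or.inr ⟨u, hu, fun f hf => ?_⟩
    by_cases hfe : f = e
    · exact Or.inl hfe
    · exact Or.inr (h f ⟨hf, hfe⟩)

theorem coverable_one_of_erase {s : V} (he : e.card = k) (hs : s ∈ e)
    (h : ∀ f ∈ A, e.erase s ⊆ f) : Coverable k 1 A :=
  coverable_of_star (by rw [card_erase_of_mem hs, he]) h

theorem coverable_of_clique (hk : 1 ≤ k) (hcard : ∀ f ∈ K, f.card = k)
    (hadj : ∀ f ∈ K, ∀ g ∈ K, Adj k f g) : Coverable k ((k + 2) / 2) K := by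
  obtain rfl | ⟨e, he⟩ := K.eq_empty_or_nonempty
  · exact coverable_of_subset_empty subset_rfl
  rcases clique_through (hcard e he) hk hcard (fun f hf => hadj e he f hf) hadj with
    ⟨s, hs, h⟩ | ⟨u, hu, h⟩
  · exact (coverable_one_of_erase (hcard e he) hs h).mono subset_rfl (by omega)
  · refine coverable_of_subset hk (X := insert u e)
      (by rw [card_insert_of_notMem hu, hcard e he]) fun f hf => ⟨hcard f hf, ?_⟩
    rcases h f hf with rfl | ⟨s, -, rfl⟩
    · exact subset_insert _ _
    · exact swap_subset_insert

theorem Coverable.cover {l : ℕ} (hA : Coverable k n A) (hB : Coverable k m B)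
    (h : ∀ f ∈ H, f ∈ A ∨ f ∈ B) (hl : n + m ≤ l) : Coverable k l H :=
  (hA.union hB).mono h hl

theorem not_adj_of_adj (he : e.card = k) (hf : f.card = k) (hef : (e ∩ g).card + 3 ≤ k)
    (h : Adj k e f) : ¬Adj k g f := by
  intro hg
  by_cases hne : f = e
  · subst hne
    rw [adj_comm, Adj] at hg
    omega
  obtain ⟨s, hs, u, hu, rfl⟩ := exists_eq_swap he hf h hne
  have := card_swap_inter hs hu g
  rw [adj_comm, Adj] at hg
  split_ifs at this <;> omega

theorem exists_erase_subset_of_adj (he : e.card = k) (hf : f.card = k)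
    (heg : (e ∩ g).card + 2 = k) (h : Adj k e f) (hg : Adj k g f) :
    ∃ s ∈ e \ g, e.erase s ⊆ f := by
  have hne : f ≠ e := by
    rintro rfl
    rw [adj_comm, Adj] at hg
    omega
  obtain ⟨s, hs, u, hu, rfl⟩ := exists_eq_swap he hf h hne
  refine ⟨s, mem_sdiff.2 ⟨hs, fun hsg => ?_⟩, erase_subset_swap⟩
  have := card_swap_inter hs hu g
  rw [adj_comm, Adj] at hg
  rw [if_pos hsg] at this
  split_ifs at this <;> omega

theorem mem_of_not_adj_swap {s u : V} (hs : s ∈ e) (hu : u ∉ e) (heg : (e ∩ g).card + 2 = k)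
    (h : ¬Adj k g (swap e s u)) (hug : u ∈ g) : s ∈ g := by
  by_contra hsg
  have := card_swap_inter hs hu g
  rw [adj_comm, Adj] at h
  rw [if_pos hug, if_neg hsg] at this
  omega

theorem swap_left_injective {s s' u u' : V} (hs : s ∈ e) (hu : u ∉ e)
    (h : swap e s u = swap e s' u') : s = s' := by
  by_contra hne
  have h1 : s ∈ swap e s' u' := mem_swap.2 (Or.inr ⟨hne, hs⟩)
  rw [← h, mem_swap] at h1
  rcases h1 with rfl | h1
  · exact hu hs
  · exact h1.1 rfl

theorem card_sdiff_eq_two (he : e.card = k) (heg : (e ∩ g).card + 2 = k) : (e \ g).card = 2 := by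
  have := card_sdiff_add_card_inter e g
  omega

theorem coverable_neighbors_or (hk : 1 ≤ k) (hH : ∀ e ∈ H, e.card = k) (he : e ∈ H)
    (heg : (e ∩ g).card + 2 = k) {r : ℕ} (hr : 1 ≤ r)
    (hP : ∀ f ∈ H, ∀ f' ∈ H, Adj k e f → Adj k e f' → ¬Adj k g f → ¬Adj k g f' → Adj k f f') :
    Coverable k (2 + r) {f | f ∈ H ∧ Adj k e f} ∨
      ∃ u ∉ e, ∃ D ⊆ e ∩ g, 2 * r < D.card ∧
        ∀ s ∈ D, swap e s u ∈ H ∧ Adj k e (swap e s u) ∧ ¬Adj k g (swap e s u) := by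
  have hek := hH e he
  have h2 := card_sdiff_eq_two hek heg
  rcases coverable_swap_clique (e := e)
    (K := {f | f ∈ H ∧ Adj k e f ∧ ¬Adj k g f ∧ ∃ s ∈ e ∩ g, ∃ u ∉ e, f = swap e s u}) hek hk hr
    (fun f hf => by
      obtain ⟨-, -, -, s, hs, u, hu, rfl⟩ := hf
      exact ⟨s, (mem_inter.1 hs).1, u, hu, rfl⟩)
    (fun f hf f' hf' => hP f hf.1 f' hf'.1 hf.2.1 hf'.2.1 hf.2.2.1 hf'.2.2.1) with
    h | ⟨u, hu, D, hD, hcard, h⟩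
  · left
    refine Coverable.cover (coverable_of_erase (T := e \ g) hek sdiff_subset
      (A := {f | ∃ s ∈ e \ g, e.erase s ⊆ f}) fun f hf => hf) h ?_ (by omega)
    rintro f ⟨hf, hef⟩
    by_cases hgf : Adj k g f
    · exact Or.inl (exists_erase_subset_of_adj hek (hH f hf) heg hef hgf)
    by_cases hfe : f = e
    · left
      obtain ⟨s, hs⟩ := card_pos.1 (by omega : 0 < (e \ g).card)
      exact ⟨s, hs, hfe ▸ erase_subset _ _⟩
    obtain ⟨s, hs, u, hu, rfl⟩ := exists_eq_swap hek (hH f hf) hef hfe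
    by_cases hsg : s ∈ g
    · exact Or.inr ⟨hf, hef, hgf, s, mem_inter.2 ⟨hs, hsg⟩, u, hu, rfl⟩
    · exact Or.inl ⟨s, mem_sdiff.2 ⟨hs, hsg⟩, erase_subset_swap⟩
  · right
    refine ⟨u, hu, D, fun s hs => ?_, hcard, fun s hs => ?_⟩
    · obtain ⟨-, -, -, s', hs', u', hu', heq⟩ := h s hs
      rwa [swap_left_injective (hD hs) hu heq]
    · obtain ⟨h1, h2, h3, -⟩ := h s hs
      exact ⟨h1, h2, h3⟩

/-- If the neighbourhood of `e` needs many covering sets, then `e` extends to a `(k + 1)`-set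
most of whose `k`-subsets are edges. -/
theorem exists_extension (hk : 4 ≤ k) (hH : ∀ e ∈ H, e.card = k) (he : e ∈ H)
    (heg : (e ∩ g).card + 2 = k) (hg : g.card = k)
    (hP : ∀ f ∈ H, ∀ f' ∈ H, Adj k e f → Adj k e f' → ¬Adj k g f → ¬Adj k g f' → Adj k f f')
    (hiso : 5 ≤ k → ∀ u, u ∉ e → u ∉ g → ∃ s ∈ e ∩ g, swap e s u ∉ H)
    (hnot : ¬Coverable k ((k + 2) / 2) {f | f ∈ H ∧ Adj k e f}) :
    5 ≤ k ∧ ∃ X : Finset V, X.card = k + 1 ∧ e ⊆ X ∧ k ≤ (g ∩ X).card + 1 ∧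
      (∀ x ∈ g ∩ X, X.erase x ∈ H) ∧ ∀ f ∈ H, Adj k e f → ¬Adj k g f → f ⊆ X := by
  have hek := hH e he
  obtain h | ⟨u, hu, D, hD, hcard, h⟩ :=
    coverable_neighbors_or (by omega) hH he heg (r := (k + 2) / 2 - 2) (by omega) hP
  · exact absurd (h.mono subset_rfl (by omega)) hnot
  have hDS : D = e ∩ g := eq_of_subset_of_card_le hD (by omega)
  subst hDS
  have hug : u ∈ g := by
    by_contra hug
    obtain ⟨s, hs, hsH⟩ := hiso (by omega) u hu hug
    exact hsH (h s hs).1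
  refine ⟨by omega, insert u e, by rw [card_insert_of_notMem hu, hek], subset_insert _ _, ?_, ?_,
    ?_⟩
  · rw [inter_comm, insert_inter_of_mem hug, card_insert_of_notMem (by simp [hu])]
    omega
  · intro x hx
    obtain ⟨hxg, hx⟩ := mem_inter.1 hx
    rcases mem_insert.1 hx with rfl | hx
    · rwa [erase_insert hu]
    · rw [← swap_eq_erase hx hu]
      exact (h x (mem_inter.2 ⟨hx, hxg⟩)).1
  · intro f hf hef hgf
    by_cases hfe : f = e
    · rw [hfe]
      exact subset_insert _ _
    obtain ⟨s, hs, v, hv, rfl⟩ := exists_eq_swap hek (hH f hf) hef hfe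
    obtain ⟨s', hs', hne⟩ := exists_mem_ne (s := e ∩ g) (by omega) s
    obtain ⟨h1, h2, h3⟩ := h s' hs'
    have := (eq_or_eq_of_adj_swap hek (mem_inter.1 hs').1 hs hu hv
      (hP _ h1 _ hf h2 hef h3 hgf)).resolve_left hne
    rw [this]
    exact swap_subset_insert

theorem not_adj_erase {x : V} (hf : f.card = k) (hfX : ¬f ⊆ X)
    (hxX : x ∈ X) (hxf : x ∈ f) : ¬Adj k (X.erase x) f := by
  have h1 : (X ∩ f).card < f.card := by
    refine card_lt_card ⟨inter_subset_right, fun h => hfX fun y hy => (mem_inter.1 (h hy)).1⟩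
  have h2 : (X.erase x ∩ f).card + 1 = (X ∩ f).card := by
    rw [erase_inter, card_erase_add_one (mem_inter.2 ⟨hxX, hxf⟩)]
  rw [Adj]
  omega

theorem coverable_neighbors (hk : 1 ≤ k) (hH : ∀ e ∈ H, e.card = k) (he : e ∈ H) :
    Coverable k k {f | f ∈ H ∧ Adj k e f} := by
  have hek := hH e he
  refine (coverable_of_erase hek subset_rfl ?_).mono subset_rfl hek.le
  rintro f ⟨hf, hef⟩
  by_cases hfe : f = e
  · obtain ⟨s, hs⟩ := card_pos.1 (by omega : 0 < e.card)
    exact ⟨s, hs, hfe ▸ erase_subset _ _⟩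
  · obtain ⟨s, hs, u, -, rfl⟩ := exists_eq_swap hek (hH f hf) hef hfe
    exact ⟨s, hs, erase_subset_swap⟩

/-- For triples meeting in one point: if neither two covering sets suffice for the neighbourhood
of `e` nor a single one for its part not adjacent to `g`, then this part lies in `e` plus a point
outside `g`. -/
theorem exists_private_swap (hH : ∀ e ∈ H, e.card = 3) (he : e ∈ H) (heg : (e ∩ g).card = 1)
    (hP : ∀ f ∈ H, ∀ f' ∈ H, Adj 3 e f → Adj 3 e f' → ¬Adj 3 g f → ¬Adj 3 g f' → Adj 3 f f')
    (hnot : ¬Coverable 3 2 {f | f ∈ H ∧ Adj 3 e f})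
    (hstar : ¬Coverable 3 1 {f | f ∈ H ∧ Adj 3 e f ∧ ¬Adj 3 g f}) :
    ∃ u, u ∉ e ∧ u ∉ g ∧ (∃ s ∈ e ∩ g, swap e s u ∈ H ∧ Adj 3 e (swap e s u)) ∧
      ∀ f ∈ H, Adj 3 e f → ¬Adj 3 g f → f = e ∨ ∃ s ∈ e, f = swap e s u := by
  have hek := hH e he
  have hd : (e ∩ g).card + 2 = 3 := by omega
  have h2 := card_sdiff_eq_two hek hd
  rcases clique_through (K := {f | f ∈ H ∧ Adj 3 e f ∧ ¬Adj 3 g f}) hek (by omega)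
    (fun f hf => hH f hf.1) (fun f hf => hf.2.1)
    (fun f hf f' hf' => hP f hf.1 f' hf'.1 hf.2.1 hf'.2.1 hf.2.2 hf'.2.2) with
    ⟨s, hs, h⟩ | ⟨u, hu, h⟩
  · exact absurd (coverable_one_of_erase hek hs h) hstar
  obtain ⟨f, hf, hef, hfs⟩ : ∃ f ∈ H, Adj 3 e f ∧ ∀ s ∈ e \ g, ¬e.erase s ⊆ f := by
    by_contra! hall
    exact hnot ((coverable_of_erase (T := e \ g) hek sdiff_subset
      (fun f hf => hall f hf.1 hf.2)).mono subset_rfl h2.le)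
  have hgf : ¬Adj 3 g f := by
    intro hgf
    obtain ⟨s, hs, hsf⟩ := exists_erase_subset_of_adj hek (hH f hf) hd hef hgf
    exact hfs s hs hsf
  obtain ⟨s, hs, rfl⟩ : ∃ s ∈ e, f = swap e s u := by
    refine (h f ⟨hf, hef, hgf⟩).resolve_left ?_
    rintro rfl
    obtain ⟨s, hs⟩ := card_pos.1 (by omega : 0 < (f \ g).card)
    exact hfs s hs (erase_subset _ _)
  have hsg : s ∈ g := by
    by_contra hsg
    exact hfs s (mem_sdiff.2 ⟨hs, hsg⟩) erase_subset_swap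
  refine ⟨u, hu, fun hug => hstar (coverable_one_of_erase hek hs ?_),
    ⟨s, mem_inter.2 ⟨hs, hsg⟩, hf, hef⟩, fun f hf hef hgf => h f ⟨hf, hef, hgf⟩⟩
  intro f hf
  rcases h f hf with rfl | ⟨s', hs', rfl⟩
  · exact erase_subset _ _
  · have hs'g := mem_of_not_adj_swap hs' hu hd hf.2.2 hug
    rw [card_le_one.1 heg.le s (mem_inter.2 ⟨hs, hsg⟩) s' (mem_inter.2 ⟨hs', hs'g⟩)]
    exact erase_subset_swap

theorem coverable_two (hk : 3 ≤ k) (hH : ∀ e ∈ H, e.card = k)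
    (hind : ∀ e ∈ H, ∀ f ∈ H, ∀ g ∈ H, Adj k e f ∨ Adj k e g ∨ Adj k f g) :
    Coverable k (2 * ((k + 2) / 2)) H := by
  by_contra hcon
  have hnot : ∀ e ∈ H, ¬Coverable k ((k + 2) / 2) {f | f ∈ H ∧ Adj k e f} := by
    intro e he hc
    refine hcon (hc.cover (coverable_of_clique (K := {f | f ∈ H ∧ ¬Adj k e f}) (by omega)
      (fun f hf => hH f hf.1) fun f hf g hg => ?_) (fun f hf => ?_) (by omega))
    · have := hind e he f hf.1 g hg.1
      have := hf.2
      have := hg.2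
      tauto
    · by_cases hef : Adj k e f
      · exact Or.inl ⟨hf, hef⟩
      · exact Or.inr ⟨hf, hef⟩
  have hP : ∀ e ∈ H, ∀ g ∈ H, ∀ f ∈ H, ∀ f' ∈ H, Adj k e f → Adj k e f' → ¬Adj k g f →
      ¬Adj k g f' → Adj k f f' := by
    intro e he g hg f hf f' hf' _ _ h1 h2
    have := hind g hg f hf f' hf'
    tauto
  have hdist : ∀ e ∈ H, ∀ g ∈ H, ¬Adj k e g → (e ∩ g).card + 2 = k := by
    intro e he g hg h
    by_contra hne
    have h3 : (e ∩ g).card + 3 ≤ k := by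
      rw [Adj] at h
      omega
    refine hnot e he (coverable_of_clique (by omega) (fun f hf => hH f hf.1) ?_)
    intro f hf f' hf'
    exact hP e he g hg f hf.1 f' hf'.1 hf.2 hf'.2
      (not_adj_of_adj (hH e he) (hH f hf.1) h3 hf.2)
      (not_adj_of_adj (hH e he) (hH f' hf'.1) h3 hf'.2)
  obtain ⟨e, he, g, hg, heg⟩ : ∃ e ∈ H, ∃ g ∈ H, ¬Adj k e g := by
    by_contra! hall
    exact hcon ((coverable_of_clique (by omega) hH hall).mono subset_rfl (by omega))
  have hek := hH e he
  have hgk := hH g hg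
  have hd := hdist e he g hg heg
  have hiso : ∀ u, u ∉ e → u ∉ g → ∀ s ∈ e ∩ g, swap e s u ∉ H := by
    intro u hu hug s hs hsH
    obtain ⟨hse, hsg⟩ := mem_inter.1 hs
    have h1 := card_swap_inter hse hu g
    rw [if_pos hsg, if_neg hug] at h1
    have := hdist _ hsH g hg (by rw [Adj]; omega)
    omega
  obtain hk4 | rfl : 4 ≤ k ∨ k = 3 := by omega
  · obtain ⟨s₀, hs₀⟩ : (e ∩ g).Nonempty := by
      rw [← card_pos]
      omega
    obtain ⟨-, X, hX, -, hgX, hXH, hsub⟩ := exists_extension hk4 hH he hd hgk (hP e he g hg)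
      (fun _ u hu hug => ⟨s₀, hs₀, hiso u hu hug s₀ hs₀⟩) (hnot e he)
    refine hcon (Coverable.cover (A := {f | f ∈ H ∧ f ⊆ X}) (B := {f | f ∈ H ∧ ¬f ⊆ X})
      (coverable_of_subset (by omega) hX fun f hf => ⟨hH f hf.1, hf.2⟩)
      (coverable_of_clique (by omega) (fun f hf => hH f hf.1) ?_) (fun f hf => ?_)
      (Nat.two_mul _).ge)
    · rintro f ⟨hf, hfX⟩ f' ⟨hf', hfX'⟩
      have hadj : ∀ f ∈ H, ¬f ⊆ X → Adj k g f := by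
        intro f hf hfX
        by_contra hgf
        have := hind e he g hg f hf
        exact hfX (hsub f hf (by tauto) hgf)
      obtain ⟨x, hx⟩ : (g ∩ X ∩ f ∩ f').Nonempty := by
        have h1 := hadj f hf hfX
        have h2 := hadj f' hf' hfX'
        rw [Adj] at h1 h2
        have h3 := card_sdiff_add_card_inter g f
        have h4 := card_sdiff_add_card_inter g f'
        have h5 : g ∩ X ⊆ (g ∩ X ∩ f ∩ f') ∪ ((g \ f) ∪ (g \ f')) := by
          intro x
          simp only [mem_inter, mem_union, mem_sdiff]
          tauto
        have h6 := card_le_card h5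
        have h7 := card_union_le (g ∩ X ∩ f ∩ f') ((g \ f) ∪ (g \ f'))
        have h8 := card_union_le (g \ f) (g \ f')
        rw [← card_pos]
        omega
      simp only [mem_inter] at hx
      obtain ⟨⟨⟨hxg, hxX⟩, hxf⟩, hxf'⟩ := hx
      have h1 := not_adj_erase (hH f hf) hfX hxX hxf
      have h2 := not_adj_erase (hH f' hf') hfX' hxX hxf'
      have := hind _ (hXH x (mem_inter.2 ⟨hxg, hxX⟩)) f hf f' hf'
      tauto
    · by_cases hfX : f ⊆ X
      · exact Or.inl ⟨hf, hfX⟩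
      · exact Or.inr ⟨hf, hfX⟩
  · have hstar : ¬Coverable 3 1 {f | f ∈ H ∧ Adj 3 e f ∧ ¬Adj 3 g f} := by
      refine fun hc => hcon (hc.cover (coverable_neighbors (by omega) hH hg) (fun f hf => ?_)
        (by norm_num))
      by_cases hgf : Adj 3 g f
      · exact Or.inr ⟨hf, hgf⟩
      · have := hind e he g hg f hf
        exact Or.inl ⟨hf, by tauto, hgf⟩
    obtain ⟨u, hu, hug, ⟨s, hs, hsH, -⟩, -⟩ := exists_private_swap hH he (by omega)
      (hP e he g hg) (hnot e he) hstar
    exact hiso u hu hug s hs hsH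

/-- Any four edges of `H` contain two adjacent ones. -/
def NoFourIndep (k : ℕ) (H : Set (Finset V)) : Prop :=
  ∀ e ∈ H, ∀ f ∈ H, ∀ g ∈ H, ∀ h ∈ H,
    Adj k e f ∨ Adj k e g ∨ Adj k e h ∨ Adj k f g ∨ Adj k f h ∨ Adj k g h

/-- Three pairwise nonadjacent edges of `H`. -/
structure Indep (k : ℕ) (H : Set (Finset V)) (e f g : Finset V) : Prop where
  left_mem : e ∈ H
  mid_mem : f ∈ H
  right_mem : g ∈ H
  left_mid : ¬Adj k e f
  left_right : ¬Adj k e g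
  mid_right : ¬Adj k f g

theorem Indep.swap_left (h : Indep k H e f g) : Indep k H f e g :=
  ⟨h.2, h.1, h.3, mt Adj.symm h.4, h.6, h.5⟩

theorem Indep.swap_right (h : Indep k H e f g) : Indep k H e g f :=
  ⟨h.1, h.3, h.2, h.5, h.4, mt Adj.symm h.6⟩

theorem Indep.reverse (h : Indep k H e f g) : Indep k H g f e :=
  h.swap_left.swap_right.swap_left

theorem NoFourIndep.adj_or (hind : NoFourIndep k H) (hi : Indep k H e f g) (hh : h ∈ H) :
    Adj k e h ∨ Adj k f h ∨ Adj k g h := by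
  have := hind e hi.1 f hi.2 g hi.3 h hh
  have := hi.4
  have := hi.5
  have := hi.6
  tauto

theorem NoFourIndep.adj (hind : NoFourIndep k H) (hi : Indep k H e f g) {x y : Finset V}
    (hx : x ∈ H) (hy : y ∈ H) (hfx : ¬Adj k f x) (hgx : ¬Adj k g x) (hfy : ¬Adj k f y)
    (hgy : ¬Adj k g y) : Adj k x y := by
  have := hind f hi.2 g hi.3 x hx y hy
  have := hi.6
  tauto

theorem path_end_extension (hk : 4 ≤ k) (hH : ∀ e ∈ H, e.card = k) (hind : NoFourIndep k H)
    (hnot : ∀ e ∈ H, ¬Coverable k ((k + 2) / 2) {f | f ∈ H ∧ Adj k e f})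
    (hdist : ∀ e f g, Indep k H e f g → (e ∩ f).card + 2 = k ∨ (e ∩ g).card + 2 = k)
    (hi : Indep k H e f g) (hef : (e ∩ f).card + 2 = k) (hfg : (f ∩ g).card + 2 = k)
    (heg : (e ∩ g).card + 3 ≤ k) :
    5 ≤ k ∧ ∃ X : Finset V, X.card = k + 1 ∧ e ⊆ X ∧ k ≤ (f ∩ X).card + 1 ∧
      (∀ x ∈ f ∩ X, X.erase x ∈ H) ∧ ∀ x ∈ H, Adj k e x → ¬Adj k f x → x ⊆ X := by
  have hek := hH e hi.1
  have hfk := hH f hi.2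
  refine exists_extension hk hH hi.1 hef hfk ?_ ?_ (hnot e hi.1)
  · intro x hx y hy hex hey hfx hfy
    exact hind.adj hi hx hy hfx (not_adj_of_adj hek (hH x hx) heg hex) hfy
      (not_adj_of_adj hek (hH y hy) heg hey)
  · intro hk5 u hu huf
    obtain ⟨s, hs⟩ : (e ∩ f ∩ g).Nonempty := by
      have h1 := card_sdiff_add_card_inter f g
      have h2 := card_sdiff_add_card_inter (e ∩ f) g
      have h3 : (e ∩ f) \ g ⊆ f \ g := sdiff_subset_sdiff inter_subset_right subset_rfl
      have h4 := card_le_card h3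
      rw [← card_pos]
      omega
    simp only [mem_inter] at hs
    obtain ⟨⟨hse, hsf⟩, hsg⟩ := hs
    refine ⟨s, mem_inter.2 ⟨hse, hsf⟩, fun hsH => ?_⟩
    have h1 := card_swap_inter hse hu f
    have h2 := card_swap_inter hse hu g
    rw [if_pos hsf, if_neg huf] at h1
    rw [if_pos hsg] at h2
    have h3 : (swap e s u ∩ g).card + 3 ≤ k := by
      split_ifs at h2 <;> omega
    have := hdist _ _ _ ⟨hsH, hi.2, hi.3, by rw [Adj]; omega, by rw [Adj]; omega, hi.6⟩
    omega

theorem coverable_path (hk : 4 ≤ k) (hH : ∀ e ∈ H, e.card = k) (hind : NoFourIndep k H)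
    (hnot : ∀ e ∈ H, ¬Coverable k ((k + 2) / 2) {f | f ∈ H ∧ Adj k e f})
    (hdist : ∀ e f g, Indep k H e f g → (e ∩ f).card + 2 = k ∨ (e ∩ g).card + 2 = k)
    (hi : Indep k H e f g) (hef : (e ∩ f).card + 2 = k) (hfg : (f ∩ g).card + 2 = k)
    (heg : (e ∩ g).card + 3 ≤ k) : Coverable k (3 * ((k + 2) / 2)) H := by
  have hek := hH e hi.1
  have hfk := hH f hi.2
  have hgk := hH g hi.3
  obtain ⟨hk5, X, hX, heX, hfX, hXH, hXsub⟩ :=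
    path_end_extension hk hH hind hnot hdist hi hef hfg heg
  obtain ⟨-, Y, hY, hgY, hfY, hYH, hYsub⟩ :=
    path_end_extension hk hH hind hnot hdist hi.reverse (by rwa [inter_comm])
      (by rwa [inter_comm]) (by rwa [inter_comm])
  have hXY : (X ∩ Y).card + 1 ≤ k := by
    have h1 : X ∩ Y ⊆ (e ∩ g) ∪ ((X \ e) ∪ (Y \ g)) := by
      intro x
      simp only [mem_inter, mem_union, mem_sdiff]
      tauto
    have h2 := card_le_card h1
    have h3 := card_union_le (e ∩ g) ((X \ e) ∪ (Y \ g))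
    have h4 := card_union_le (X \ e) (Y \ g)
    have h5 := card_sdiff_of_subset heX
    have h6 := card_sdiff_of_subset hgY
    omega
  refine Coverable.cover (A := {x | x ∈ H ∧ x ⊆ X}) (B := {x | x ∈ H ∧ ¬x ⊆ X})
    (coverable_of_subset (by omega) hX fun x hx => ⟨hH x hx.1, hx.2⟩)
    (Coverable.cover (A := {x | x ∈ H ∧ x ⊆ Y}) (B := {x | x ∈ H ∧ ¬x ⊆ X ∧ ¬x ⊆ Y})
      (coverable_of_subset (by omega) hY fun x hx => ⟨hH x hx.1, hx.2⟩)
      (coverable_of_clique (by omega) (fun x hx => hH x hx.1) ?_) (fun x hx => ?_) le_rfl)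
    (fun x hx => ?_) (by omega)
  · have hadj : ∀ x ∈ H, ¬x ⊆ X → ¬x ⊆ Y → Adj k f x := by
      intro x hx hxX hxY
      by_contra hfx
      rcases hind.adj_or hi hx with h | h | h
      · exact hxX (hXsub x hx h hfx)
      · exact hfx h
      · exact hxY (hYsub x hx h hfx)
    rintro x ⟨hx, hxX, hxY⟩ y ⟨hy, hyX, hyY⟩
    obtain ⟨p, hp⟩ : (f ∩ X ∩ Y ∩ x ∩ y).Nonempty := by
      have h1 := hadj x hx hxX hxY
      have h2 := hadj y hy hyX hyY
      rw [Adj] at h1 h2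
      have h3 := card_sdiff_add_card_inter f x
      have h4 := card_sdiff_add_card_inter f y
      have h5 := card_sdiff_add_card_inter f Y
      have h6 : f ∩ X ⊆ (f ∩ X ∩ Y ∩ x ∩ y) ∪ ((f \ x) ∪ ((f \ y) ∪ (f \ Y))) := by
        intro p
        simp only [mem_inter, mem_union, mem_sdiff]
        tauto
      have h7 := card_le_card h6
      have h8 := card_union_le (f ∩ X ∩ Y ∩ x ∩ y) ((f \ x) ∪ ((f \ y) ∪ (f \ Y)))
      have h9 := card_union_le (f \ x) ((f \ y) ∪ (f \ Y))
      have h10 := card_union_le (f \ y) (f \ Y)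
      rw [← card_pos]
      omega
    simp only [mem_inter] at hp
    obtain ⟨⟨⟨⟨hpf, hpX⟩, hpY⟩, hpx⟩, hpy⟩ := hp
    have h1 := not_adj_erase (hH x hx) hxX hpX hpx
    have h2 := not_adj_erase (hH y hy) hyX hpX hpy
    have h3 := not_adj_erase (hH x hx) hxY hpY hpx
    have h4 := not_adj_erase (hH y hy) hyY hpY hpy
    have h5 : ¬Adj k (X.erase p) (Y.erase p) := by
      have h6 : X.erase p ∩ Y.erase p ⊆ (X ∩ Y).erase p := by
        intro q
        simp only [mem_inter, mem_erase]
        tauto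
      have h7 := card_le_card h6
      have h8 := card_erase_add_one (mem_inter.2 ⟨hpX, hpY⟩)
      rw [Adj]
      omega
    have := hind _ (hXH p (mem_inter.2 ⟨hpf, hpX⟩)) _ (hYH p (mem_inter.2 ⟨hpf, hpY⟩)) x hx y hy
    tauto
  · by_cases hxY : x ⊆ Y
    · exact Or.inl ⟨hx.1, hxY⟩
    · exact Or.inr ⟨hx.1, hx.2, hxY⟩
  · by_cases hxX : x ⊆ X
    · exact Or.inl ⟨hx, hxX⟩
    · exact Or.inr ⟨hx, hxX⟩

theorem coverable_common_neighbors (hH : ∀ e ∈ H, e.card = k) (he : e ∈ H)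
    (heg : (e ∩ g).card + 2 = k) :
    Coverable k 2 {f | f ∈ H ∧ (f = e ∨ Adj k e f ∧ Adj k g f)} := by
  have hek := hH e he
  have h2 := card_sdiff_eq_two hek heg
  refine (coverable_of_erase (T := e \ g) hek sdiff_subset ?_).mono subset_rfl h2.le
  rintro f ⟨hf, rfl | ⟨hef, hgf⟩⟩
  · obtain ⟨s, hs⟩ := card_pos.1 (by omega : 0 < (f \ g).card)
    exact ⟨s, hs, erase_subset _ _⟩
  · exact exists_erase_subset_of_adj hek (hH f hf) heg hef hgf

theorem mem_iff_mem_of_card {s u : V} (hs : s ∈ e) (hu : u ∉ e)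
    (h : (swap e s u ∩ g).card = (e ∩ g).card) : s ∈ g ↔ u ∈ g := by
  have := card_swap_inter hs hu g
  by_cases h1 : s ∈ g <;> by_cases h2 : u ∈ g <;> simp [h1, h2] at this ⊢ <;> omega

theorem mem_iff_mem_of_indep {s u : V} (hdist : ∀ e f g, Indep k H e f g → (e ∩ f).card + 2 = k)
    (hi : Indep k H e f g) (hs : s ∈ e) (hu : u ∉ e) (hsH : swap e s u ∈ H)
    (hf : ¬Adj k f (swap e s u)) (hg : ¬Adj k g (swap e s u)) :
    (s ∈ f ↔ u ∈ f) ∧ (s ∈ g ↔ u ∈ g) := by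
  have hi' : Indep k H (swap e s u) f g :=
    ⟨hsH, hi.2, hi.3, mt Adj.symm hf, mt Adj.symm hg, hi.6⟩
  have h1 := hdist _ _ _ hi
  have h2 := hdist _ _ _ hi.swap_right
  have h3 := hdist _ _ _ hi'
  have h4 := hdist _ _ _ hi'.swap_right
  exact ⟨mem_iff_mem_of_card hs hu (by omega), mem_iff_mem_of_card hs hu (by omega)⟩

theorem coverable_triangle_private (hk : 4 ≤ k) (hH : ∀ e ∈ H, e.card = k)
    (hind : NoFourIndep k H) (hdist : ∀ e f g, Indep k H e f g → (e ∩ f).card + 2 = k)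
    (hi : Indep k H e f g) :
    Coverable k ((k + 2) / 2 - 2)
      {x | x ∈ H ∧ x ≠ e ∧ Adj k e x ∧ ¬Adj k f x ∧ ¬Adj k g x} := by
  have hek := hH e hi.1
  have hef := hdist _ _ _ hi
  have heg := hdist _ _ _ hi.swap_right
  have hfg := hdist _ _ _ hi.swap_left.swap_right
  rcases coverable_swap_clique (r := (k + 2) / 2 - 2)
    (K := {x | x ∈ H ∧ x ≠ e ∧ Adj k e x ∧ ¬Adj k f x ∧ ¬Adj k g x}) hek (by omega) (by omega)
    (fun x hx => exists_eq_swap hek (hH x hx.1) hx.2.2.1 hx.2.1)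
    (fun x hx y hy => hind.adj hi hx.1 hy.1 hx.2.2.2.1 hx.2.2.2.2 hy.2.2.2.1 hy.2.2.2.2) with
    h | ⟨u, hu, D, hD, hcard, h⟩
  · exact h
  exfalso
  have hiff : ∀ s ∈ D, (s ∈ f ↔ u ∈ f) ∧ (s ∈ g ↔ u ∈ g) := fun s hs =>
    mem_iff_mem_of_indep hdist hi (hD hs) hu (h s hs).1 (h s hs).2.2.2.1 (h s hs).2.2.2.2
  by_cases huf : u ∈ f
  · by_cases hug : u ∈ g
    · have h1 : insert u D ⊆ f ∩ g := by
        refine insert_subset (mem_inter.2 ⟨huf, hug⟩) fun s hs => ?_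
        exact mem_inter.2 ⟨(hiff s hs).1.2 huf, (hiff s hs).2.2 hug⟩
      have h2 := card_le_card h1
      rw [card_insert_of_notMem fun h => hu (hD h)] at h2
      omega
    · have h1 : D ⊆ e \ g := fun s hs => mem_sdiff.2 ⟨hD hs, fun h => hug ((hiff s hs).2.1 h)⟩
      have := card_le_card h1
      have := card_sdiff_eq_two hek heg
      omega
  · have h1 : D ⊆ e \ f := fun s hs => mem_sdiff.2 ⟨hD hs, fun h => huf ((hiff s hs).1.1 h)⟩
    have := card_le_card h1
    have := card_sdiff_eq_two hek hef
    omega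

theorem coverable_triangle (hk : 4 ≤ k) (hH : ∀ e ∈ H, e.card = k)
    (hind : NoFourIndep k H) (hdist : ∀ e f g, Indep k H e f g → (e ∩ f).card + 2 = k)
    (hi : Indep k H e f g) : Coverable k (3 * ((k + 2) / 2)) H := by
  have h1 := coverable_triangle_private hk hH hind hdist hi
  have h2 := coverable_triangle_private hk hH hind hdist hi.swap_left
  have h3 := coverable_triangle_private hk hH hind hdist hi.reverse
  have h4 := coverable_common_neighbors hH hi.1 (hdist _ _ _ hi)
  have h5 := coverable_common_neighbors hH hi.2 (hdist _ _ _ hi.swap_left.swap_right)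
  have h6 := coverable_common_neighbors hH hi.3 (hdist _ _ _ hi.reverse.swap_right)
  refine (((h1.union h2).union (h3.union h4)).union (h5.union h6)).mono ?_ (by omega)
  intro x hx
  have := hind.adj_or hi hx
  simp only [Set.mem_union, Set.mem_ofPred_eq]
  tauto

theorem coverable_one_common_neighbors (hk : 1 ≤ k) (hH : ∀ e ∈ H, e.card = k) (he : e ∈ H)
    (heg : (e ∩ g).card + 2 = k)
    (hadj : ∀ x ∈ H, ∀ y ∈ H, Adj k e x → Adj k g x → Adj k e y → Adj k g y → Adj k x y) :
    Coverable k 1 {f | f ∈ H ∧ Adj k e f ∧ Adj k g f} := by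
  have hek := hH e he
  have h2 := card_sdiff_eq_two hek heg
  have hne : ∀ f, Adj k g f → f ≠ e := by
    rintro f hf rfl
    rw [adj_comm, Adj] at hf
    omega
  rcases coverable_swap_clique (r := 1) (K := {f | f ∈ H ∧ Adj k e f ∧ Adj k g f}) hek hk le_rfl
    (fun f hf => exists_eq_swap hek (hH f hf.1) hf.2.1 (hne f hf.2.2))
    (fun x hx y hy => hadj x hx.1 y hy.1 hx.2.1 hx.2.2 hy.2.1 hy.2.2) with
    h | ⟨u, hu, D, hD, hcard, h⟩
  · exact h
  · exfalso
    have h1 : D ⊆ e \ g := by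
      refine fun s hs => mem_sdiff.2 ⟨hD hs, fun hsg => ?_⟩
      have h3 := card_swap_inter (hD hs) hu g
      have h4 := (h s hs).2.2
      rw [adj_comm, Adj] at h4
      rw [if_pos hsg] at h3
      split_ifs at h3 <;> omega
    have := card_le_card h1
    omega

theorem coverable_pair_or_subset {s v : V} (hX : X.card = 4) (hs : s ∈ X) (hv : v ∈ X)
    (hsv : s ≠ v) : Coverable 3 2 {f | ({s, v} : Finset V) ⊆ f ∨ f.card = 3 ∧ f ⊆ X} := by
  have h2 : ({s, v} : Finset V).card = 2 := card_pair hsv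
  have hsub : ({s, v} : Finset V) ⊆ X := insert_subset hs (singleton_subset_iff.2 hv)
  refine Coverable.cover
    (coverable_of_star (c := {s, v}) (A := {f | ({s, v} : Finset V) ⊆ f}) h2 fun f hf => hf)
    (coverable_of_star (c := X \ {s, v}) (A := {f | X \ {s, v} ⊆ f})
      (by rw [card_sdiff_of_subset hsub]; omega) fun f hf => hf) ?_ le_rfl
  rintro f (hf | ⟨hf, hfX⟩)
  · exact Or.inl hf
  · obtain ⟨d, hd, rfl⟩ := eq_erase_of_subset (k := 3) hX hf hfX
    by_cases hdm : d ∈ ({s, v} : Finset V)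
    · right
      intro x hx
      obtain ⟨hxX, hx⟩ := mem_sdiff.1 hx
      exact mem_erase.2 ⟨fun h => hx (h ▸ hdm), hxX⟩
    · left
      intro x hx
      exact mem_erase.2 ⟨fun h => hdm (h ▸ hx), hsub hx⟩

theorem coverable_path_three_of_star (hH : ∀ e ∈ H, e.card = 3) (hind : NoFourIndep 3 H)
    (hi : Indep 3 H e f g) (heg : (e ∩ g).card + 3 ≤ 3)
    (hstar : Coverable 3 1 {x | x ∈ H ∧ Adj 3 e x ∧ ¬Adj 3 f x}) : Coverable 3 6 H := by
  have h3 : Coverable 3 2 {x | x ∈ H ∧ Adj 3 g x ∧ ¬Adj 3 f x} := by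
    refine coverable_of_clique (by omega) (fun x hx => hH x hx.1) fun x hx y hy => ?_
    rw [inter_comm] at heg
    exact hind.adj hi.reverse hx.1 hy.1 hx.2.2
      (not_adj_of_adj (hH g hi.3) (hH x hx.1) heg hx.2.1) hy.2.2
      (not_adj_of_adj (hH g hi.3) (hH y hy.1) heg hy.2.1)
  refine ((hstar.union h3).union (coverable_neighbors (by omega) hH hi.2)).mono ?_ (by omega)
  intro x hx
  have := hind.adj_or hi hx
  simp only [Set.mem_union, Set.mem_ofPred_eq]
  tauto

theorem adj_of_private_swap {s u : V} (hH : ∀ e ∈ H, e.card = 3) (hind : NoFourIndep 3 H)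
    (hi : Indep 3 H e f g) (hef : (e ∩ f).card = 1) (heg : (e ∩ g).card + 3 ≤ 3)
    (hs : s ∈ e ∩ f) (hue : u ∉ e) (huf : u ∉ f) (hsH : swap e s u ∈ H)
    (hadj : Adj 3 e (swap e s u)) {x y : Finset V} (hx : x ∈ H) (hy : y ∈ H) (hfx : Adj 3 f x)
    (hfy : Adj 3 f y) (hgx : ¬Adj 3 g x) (hgy : ¬Adj 3 g y) : Adj 3 x y := by
  obtain ⟨hse, hsf⟩ := mem_inter.1 hs
  have h1 := card_swap_inter hse hue f
  rw [if_pos hsf, if_neg huf, inter_comm] at h1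
  have h2 : (f ∩ swap e s u).card + 3 ≤ 3 := by omega
  have h3 := not_adj_of_adj (hH f hi.2) (hH x hx) h2 hfx
  have h4 := not_adj_of_adj (hH f hi.2) (hH y hy) h2 hfy
  have h5 := not_adj_of_adj (hH e hi.1) (hH _ hsH) heg hadj
  have := hind _ hsH g hi.3 x hx y hy
  have := @adj_comm V 3 g (swap e s u) _
  tauto

theorem coverable_path_three (hH : ∀ e ∈ H, e.card = 3) (hind : NoFourIndep 3 H)
    (hnot : ∀ e ∈ H, ¬Coverable 3 2 {f | f ∈ H ∧ Adj 3 e f})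
    (hi : Indep 3 H e f g) (hef : (e ∩ f).card = 1) (hfg : (f ∩ g).card = 1)
    (heg : (e ∩ g).card + 3 ≤ 3) : Coverable 3 6 H := by
  have hge : (g ∩ e).card + 3 ≤ 3 := by rwa [inter_comm]
  have hfe : (f ∩ e).card = 1 := by rwa [inter_comm]
  have hgf : (g ∩ f).card = 1 := by rwa [inter_comm]
  have hek := hH e hi.1
  have hfk := hH f hi.2
  have hgk := hH g hi.3
  by_cases hstar : Coverable 3 1 {x | x ∈ H ∧ Adj 3 e x ∧ ¬Adj 3 f x}
  · exact coverable_path_three_of_star hH hind hi heg hstar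
  by_cases hstar' : Coverable 3 1 {x | x ∈ H ∧ Adj 3 g x ∧ ¬Adj 3 f x}
  · exact coverable_path_three_of_star hH hind hi.reverse hge hstar'
  have hfar : ∀ x ∈ H, Adj 3 e x → ¬Adj 3 g x := fun x hx h =>
    not_adj_of_adj hek (hH x hx) heg h
  have hfar' : ∀ x ∈ H, Adj 3 g x → ¬Adj 3 e x := fun x hx h h' => hfar x hx h' h
  have hP : ∀ x ∈ H, ∀ y ∈ H, Adj 3 e x → Adj 3 e y → ¬Adj 3 f x → ¬Adj 3 f y → Adj 3 x y :=
    fun x hx y hy h1 h2 h3 h4 => hind.adj hi hx hy h3 (hfar x hx h1) h4 (hfar y hy h2)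
  have hP' : ∀ x ∈ H, ∀ y ∈ H, Adj 3 g x → Adj 3 g y → ¬Adj 3 f x → ¬Adj 3 f y → Adj 3 x y :=
    fun x hx y hy h1 h2 h3 h4 =>
      hind.adj hi.reverse hx hy h3 (hfar' x hx h1) h4 (hfar' y hy h2)
  have cP : Coverable 3 2 {x | x ∈ H ∧ Adj 3 e x ∧ ¬Adj 3 f x} :=
    coverable_of_clique (by omega) (fun x hx => hH x hx.1) fun x hx y hy =>
      hP x hx.1 y hy.1 hx.2.1 hy.2.1 hx.2.2 hy.2.2
  have cP' : Coverable 3 2 {x | x ∈ H ∧ Adj 3 g x ∧ ¬Adj 3 f x} :=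
    coverable_of_clique (by omega) (fun x hx => hH x hx.1) fun x hx y hy =>
      hP' x hx.1 y hy.1 hx.2.1 hy.2.1 hx.2.2 hy.2.2
  obtain ⟨u, hue, huf, ⟨s, hs, hsH, hsadj⟩, hPu⟩ :=
    exists_private_swap hH hi.1 hef hP (hnot e hi.1) hstar
  obtain ⟨u', hug', huf', ⟨s', hs', hsH', hsadj'⟩, -⟩ :=
    exists_private_swap hH hi.3 hgf hP' (hnot g hi.3) hstar'
  have hG : ∀ x ∈ H, ∀ y ∈ H, Adj 3 f x → Adj 3 f y → ¬Adj 3 g x → ¬Adj 3 g y → Adj 3 x y :=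
    fun x hx y hy => adj_of_private_swap hH hind hi hef heg hs hue huf hsH hsadj hx hy
  have hG' : ∀ x ∈ H, ∀ y ∈ H, Adj 3 f x → Adj 3 f y → ¬Adj 3 e x → ¬Adj 3 e y → Adj 3 x y :=
    fun x hx y hy =>
      adj_of_private_swap hH hind hi.reverse hgf hge hs' hug' huf' hsH' hsadj' hx hy
  have cQ : Coverable 3 1 {x | x ∈ H ∧ Adj 3 f x ∧ Adj 3 e x} :=
    coverable_one_common_neighbors (by omega) hH hi.2 (by omega)
      fun x hx y hy h1 h2 h3 h4 => hG x hx y hy h1 h3 (hfar x hx h2) (hfar y hy h4)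
  have cQ' : Coverable 3 1 {x | x ∈ H ∧ Adj 3 f x ∧ Adj 3 g x} :=
    coverable_one_common_neighbors (by omega) hH hi.2 (by omega)
      fun x hx y hy h1 h2 h3 h4 => hG' x hx y hy h1 h3 (hfar' x hx h2) (hfar' y hy h4)
  have hcov : Coverable 3 2 {x | x ∈ H ∧ Adj 3 f x} → Coverable 3 6 H := by
    refine fun h => ((cP.union cP').union h).mono (fun x hx => ?_) (by omega)
    by_cases h1 : Adj 3 f x
    · exact Or.inr ⟨hx, h1⟩
    rcases hind.adj_or hi hx with h2 | h2 | h2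
    · exact Or.inl (Or.inl ⟨hx, h2, h1⟩)
    · exact absurd h2 h1
    · exact Or.inl (Or.inr ⟨hx, h2, h1⟩)
  rcases clique_through (K := {x | x ∈ H ∧ Adj 3 f x ∧ ¬Adj 3 g x}) hfk (by omega)
    (fun x hx => hH x hx.1) (fun x hx => hx.2.1)
    (fun x hx y hy => hG x hx.1 y hy.1 hx.2.1 hy.2.1 hx.2.2 hy.2.2) with
    ⟨r, hr, h⟩ | ⟨v, hv, hGv⟩
  · refine hcov (Coverable.cover (coverable_one_of_erase hfk hr h) cQ' (fun x hx => ?_) le_rfl)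
    by_cases h' : Adj 3 g x
    · exact Or.inr ⟨hx.1, hx.2, h'⟩
    · exact Or.inl ⟨hx.1, hx.2, h'⟩
  rcases clique_through (K := {x | x ∈ H ∧ Adj 3 f x ∧ ¬Adj 3 e x}) hfk (by omega)
    (fun x hx => hH x hx.1) (fun x hx => hx.2.1)
    (fun x hx y hy => hG' x hx.1 y hy.1 hx.2.1 hy.2.1 hx.2.2 hy.2.2) with
    ⟨r, hr, h⟩ | ⟨v', hv', hGv'⟩
  · refine hcov (Coverable.cover (coverable_one_of_erase hfk hr h) cQ (fun x hx => ?_) le_rfl)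
    by_cases h' : Adj 3 e x
    · exact Or.inr ⟨hx.1, hx.2, h'⟩
    · exact Or.inl ⟨hx.1, hx.2, h'⟩
  by_cases hvv : v = v'
  · subst hvv
    refine hcov (coverable_of_subset (k := 3) (by omega) (X := insert v f)
      (by rw [card_insert_of_notMem hv, hfk]) fun x hx => ⟨hH x hx.1, ?_⟩)
    have : x = f ∨ ∃ s ∈ f, x = swap f s v := by
      by_cases hgx : Adj 3 g x
      · exact hGv' x ⟨hx.1, hx.2, hfar' x hx.1 hgx⟩
      · exact hGv x ⟨hx.1, hx.2, hgx⟩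
    rcases this with rfl | ⟨r, -, rfl⟩
    · exact subset_insert _ _
    · exact swap_subset_insert
  have hmid : ∀ x ∈ H, Adj 3 f x → ¬Adj 3 e x → ¬Adj 3 g x → x = f := by
    intro x hx h1 h2 h3
    rcases hGv x ⟨hx, h1, h3⟩ with h | ⟨r, -, rfl⟩
    · exact h
    rcases hGv' _ ⟨hx, h1, h2⟩ with h | ⟨r', -, h⟩
    · exact h
    have : v ∈ swap f r' v' := h ▸ mem_swap.2 (Or.inl rfl)
    rcases mem_swap.1 this with h | h
    · exact absurd h hvv
    · exact absurd h.2 hv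
  obtain ⟨r₀, hr₀⟩ : f.Nonempty := by
    rw [← card_pos]
    omega
  have cf : Coverable 3 1 {f} := by
    refine coverable_one_of_erase hfk hr₀ ?_
    rintro x rfl
    exact erase_subset _ _
  have hQ : ∀ x ∈ H, Adj 3 f x → Adj 3 e x → ∃ r ∈ f, r ∉ e ∧ v ∈ e ∧ x = swap f r v := by
    intro x hx h1 h2
    rcases hGv x ⟨hx, h1, hfar x hx h2⟩ with rfl | ⟨r, hr, rfl⟩
    · exact absurd h2 hi.4
    refine ⟨r, hr, ?_⟩
    have h3 := card_swap_inter hr hv e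
    rw [adj_comm, Adj] at h2
    by_cases hre : r ∈ e <;> by_cases hve : v ∈ e <;> simp [hre, hve] at h3 ⊢ <;> omega
  by_cases hve : v ∈ e
  · obtain ⟨hse, hsf⟩ := mem_inter.1 hs
    have hc := coverable_pair_or_subset (X := insert u e) (by rw [card_insert_of_notMem hue, hek])
      (mem_insert_of_mem hse) (mem_insert_of_mem hve) (fun h => hv (h ▸ hsf))
    refine ((hc.union cP').union (cQ'.union cf)).mono (fun x hx => ?_) (by omega)
    simp only [Set.mem_union, Set.mem_ofPred_eq, Set.mem_singleton_iff]
    by_cases h1 : Adj 3 f x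
    · by_cases h2 : Adj 3 e x
      · obtain ⟨r, hr, hre, -, rfl⟩ := hQ x hx h1 h2
        refine Or.inl (Or.inl (Or.inl ?_))
        refine insert_subset (mem_swap.2 (Or.inr ⟨fun h => hre (h ▸ hse), hsf⟩)) ?_
        exact singleton_subset_iff.2 (mem_swap.2 (Or.inl rfl))
      · by_cases h3 : Adj 3 g x
        · exact Or.inr (Or.inl ⟨hx, h1, h3⟩)
        · exact Or.inr (Or.inr (hmid x hx h1 h2 h3))
    · by_cases h2 : Adj 3 e x
      · refine Or.inl (Or.inl (Or.inr ⟨hH x hx, ?_⟩))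
        rcases hPu x hx h2 h1 with rfl | ⟨r, -, rfl⟩
        · exact subset_insert _ _
        · exact swap_subset_insert
      · rcases hind.adj_or hi hx with h | h | h
        · exact absurd h h2
        · exact absurd h h1
        · exact Or.inl (Or.inr ⟨hx, h, h1⟩)
  · refine hcov (Coverable.cover cQ' cf (fun x hx => ?_) le_rfl)
    by_cases h2 : Adj 3 e x
    · obtain ⟨r, hr, -, h, -⟩ := hQ x hx.1 hx.2 h2
      exact absurd h hve
    · by_cases h3 : Adj 3 g x
      · exact Or.inl ⟨hx.1, hx.2, h3⟩
      · exact Or.inr (hmid x hx.1 hx.2 h2 h3)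

theorem coverable_neighbors_of_common_mem {p : V} (hH : ∀ e ∈ H, e.card = 3)
    (hdist : ∀ e f g, Indep 3 H e f g → (e ∩ f).card + 2 = 3) (hi : Indep 3 H e f g)
    (hpe : p ∈ e) (hpf : p ∈ f) (hpg : p ∈ g) : Coverable 3 2 {x | x ∈ H ∧ Adj 3 e x} := by
  have hek := hH e hi.1
  have hef := hdist _ _ _ hi
  have heg := hdist _ _ _ hi.swap_right
  have hfg := hdist _ _ _ hi.swap_left.swap_right
  have h2 := card_sdiff_eq_two hek hef
  refine (coverable_of_erase (T := e \ f) hek sdiff_subset ?_).mono subset_rfl h2.le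
  rintro x ⟨hx, hex⟩
  by_cases hxe : x = e
  · obtain ⟨s, hs⟩ := card_pos.1 (by omega : 0 < (e \ f).card)
    exact ⟨s, hs, hxe ▸ erase_subset _ _⟩
  obtain ⟨s, hs, u, hu, rfl⟩ := exists_eq_swap hek (hH x hx) hex hxe
  refine ⟨s, mem_sdiff.2 ⟨hs, fun hsf => ?_⟩, erase_subset_swap⟩
  have hsp : s = p :=
    card_le_one.1 (by omega : (e ∩ f).card ≤ 1) s (mem_inter.2 ⟨hs, hsf⟩) p
      (mem_inter.2 ⟨hpe, hpf⟩)
  subst hsp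
  have hnot : ∀ y : Finset V, s ∈ y → (e ∩ y).card + 2 = 3 → ¬Adj 3 y (swap e s u) := by
    intro y hsy hey h
    have h3 := card_swap_inter hs hu y
    rw [adj_comm, Adj] at h
    rw [if_pos hsy] at h3
    split_ifs at h3 <;> omega
  obtain ⟨h3, h4⟩ := mem_iff_mem_of_indep hdist hi hs hu hx (hnot f hpf hef) (hnot g hpg heg)
  have hus : u = s :=
    card_le_one.1 (by omega : (f ∩ g).card ≤ 1) u (mem_inter.2 ⟨h3.1 hpf, h4.1 hpg⟩) s
      (mem_inter.2 ⟨hpf, hpg⟩)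
  exact hu (hus ▸ hs)

theorem exists_private_star (hH : ∀ e ∈ H, e.card = 3) (hind : NoFourIndep 3 H)
    (hdist : ∀ e f g, Indep 3 H e f g → (e ∩ f).card + 2 = 3) (hi : Indep 3 H e f g)
    (hempty : ∀ x ∈ e, x ∈ f → x ∉ g) :
    ∃ w ∈ e, ∀ x ∈ H, Adj 3 e x → ¬Adj 3 f x → ¬Adj 3 g x → e.erase w ⊆ x := by
  have hek := hH e hi.1
  have hef := hdist _ _ _ hi
  have heg := hdist _ _ _ hi.swap_right
  have h2 := card_sdiff_eq_two hek hef
  rcases clique_through (K := {x | x ∈ H ∧ Adj 3 e x ∧ ¬Adj 3 f x ∧ ¬Adj 3 g x}) hek (by omega)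
    (fun x hx => hH x hx.1) (fun x hx => hx.2.1)
    (fun x hx y hy => hind.adj hi hx.1 hy.1 hx.2.2.1 hx.2.2.2 hy.2.2.1 hy.2.2.2) with
    ⟨w, hw, h⟩ | ⟨u, hu, h⟩
  · exact ⟨w, hw, fun x hx h1 h2 h3 => h x ⟨hx, h1, h2, h3⟩⟩
  by_cases hex : ∃ s ∈ e, swap e s u ∈ H ∧ ¬Adj 3 f (swap e s u) ∧ ¬Adj 3 g (swap e s u)
  · obtain ⟨s, hs, hsH, hsf, hsg⟩ := hex
    refine ⟨s, hs, fun x hx h1 h2' h3 => ?_⟩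
    rcases h x ⟨hx, h1, h2', h3⟩ with rfl | ⟨s', hs', rfl⟩
    · exact erase_subset _ _
    obtain ⟨k1, k2⟩ := mem_iff_mem_of_indep hdist hi hs hu hsH hsf hsg
    obtain ⟨k3, k4⟩ := mem_iff_mem_of_indep hdist hi hs' hu hx h2' h3
    suffices s = s' by
      subst this
      exact erase_subset_swap
    by_cases huf : u ∈ f
    · exact card_le_one.1 (by omega : (e ∩ f).card ≤ 1) s (mem_inter.2 ⟨hs, k1.2 huf⟩) s'
        (mem_inter.2 ⟨hs', k3.2 huf⟩)
    by_cases hug : u ∈ g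
    · exact card_le_one.1 (by omega : (e ∩ g).card ≤ 1) s (mem_inter.2 ⟨hs, k2.2 hug⟩) s'
        (mem_inter.2 ⟨hs', k4.2 hug⟩)
    by_contra hne
    obtain ⟨p, hp⟩ := card_pos.1 (by omega : 0 < (e ∩ g).card)
    obtain ⟨hpe, hpg⟩ := mem_inter.1 hp
    have hsub : ({p, s, s'} : Finset V) ⊆ e \ f := by
      intro x hx
      simp only [mem_insert, mem_singleton] at hx
      rcases hx with rfl | rfl | rfl
      · exact mem_sdiff.2 ⟨hpe, fun h => hempty _ hpe h hpg⟩
      · exact mem_sdiff.2 ⟨hs, fun h => huf (k1.1 h)⟩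
      · exact mem_sdiff.2 ⟨hs', fun h => huf (k3.1 h)⟩
    have hcard := card_le_card hsub
    rw [card_eq_three.2 ⟨p, s, s', fun h => hug (k2.1 (h ▸ hpg)), fun h => hug (k4.1 (h ▸ hpg)),
      hne, rfl⟩] at hcard
    omega
  · obtain ⟨w, hw⟩ := card_pos.1 (by omega : 0 < e.card)
    refine ⟨w, hw, fun x hx h1 h2 h3 => ?_⟩
    rcases h x ⟨hx, h1, h2, h3⟩ with rfl | ⟨s, hs, rfl⟩
    · exact erase_subset _ _
    · exact absurd ⟨s, hs, hx, h2, h3⟩ hex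

theorem coverable_triangle_three_of_star {w : V} (hH : ∀ e ∈ H, e.card = 3)
    (hind : NoFourIndep 3 H) (hdist : ∀ e f g, Indep 3 H e f g → (e ∩ f).card + 2 = 3)
    (hi : Indep 3 H e f g) (hempty : ∀ x ∈ e, x ∈ f → x ∉ g) (hwe : w ∈ e) (hwf : w ∉ f)
    (hw : ∀ x ∈ H, Adj 3 e x → ¬Adj 3 f x → ¬Adj 3 g x → e.erase w ⊆ x) : Coverable 3 6 H := by
  have hek := hH e hi.1
  have hef := hdist _ _ _ hi
  obtain ⟨z, hz, hzs⟩ := exists_private_star hH hind hdist hi.swap_left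
    (fun x hxf hxe => hempty x hxe hxf)
  have h1 := coverable_of_erase (A := {x | ∃ s ∈ e \ f, e.erase s ⊆ x}) (T := e \ f) hek
    sdiff_subset fun x hx => hx
  have h2 := coverable_one_of_erase (A := {x | f.erase z ⊆ x}) (hH f hi.2) hz fun x hx => hx
  refine ((h1.union h2).union (coverable_neighbors (by omega) hH hi.3)).mono (fun x hx => ?_)
    (by rw [card_sdiff_eq_two hek hef])
  by_cases hgx : Adj 3 g x
  · exact Or.inr ⟨hx, hgx⟩
  left
  by_cases hex : Adj 3 e x
  · left
    by_cases hfx : Adj 3 f x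
    · exact exists_erase_subset_of_adj hek (hH x hx) hef hex hfx
    · exact ⟨w, mem_sdiff.2 ⟨hwe, hwf⟩, hw x hx hex hfx hgx⟩
  · right
    have hfx := ((hind.adj_or hi hx).resolve_left hex).resolve_right hgx
    exact hzs x hx hfx hex hgx

theorem coverable_triangle_three (hH : ∀ e ∈ H, e.card = 3) (hind : NoFourIndep 3 H)
    (hnot : ∀ e ∈ H, ¬Coverable 3 2 {f | f ∈ H ∧ Adj 3 e f})
    (hdist : ∀ e f g, Indep 3 H e f g → (e ∩ f).card + 2 = 3) (hi : Indep 3 H e f g) :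
    Coverable 3 6 H := by
  have hempty : ∀ x ∈ e, x ∈ f → x ∉ g := fun x he hf hg =>
    hnot e hi.1 (coverable_neighbors_of_common_mem hH hdist hi he hf hg)
  obtain ⟨w, hwe, hw⟩ := exists_private_star hH hind hdist hi hempty
  by_cases hwf : w ∈ f
  · exact coverable_triangle_three_of_star hH hind hdist hi.swap_right
      (fun x he hg hf => hempty x he hf hg) hwe (hempty w hwe hwf)
      fun x hx h1 h2 h3 => hw x hx h1 h3 h2
  · exact coverable_triangle_three_of_star hH hind hdist hi hempty hwe hwf hw

theorem coverable_three (hk : 3 ≤ k) (hH : ∀ e ∈ H, e.card = k) (hind : NoFourIndep k H) :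
    Coverable k (3 * ((k + 2) / 2)) H := by
  by_contra hcon
  have hnot : ∀ e ∈ H, ¬Coverable k ((k + 2) / 2) {f | f ∈ H ∧ Adj k e f} := by
    intro e he hc
    refine hcon (hc.cover (coverable_two (H := {f | f ∈ H ∧ ¬Adj k e f}) hk
      (fun f hf => hH f hf.1) ?_) (fun f hf => ?_) (by omega))
    · intro f hf g hg h hh
      have := hind e he f hf.1 g hg.1 h hh.1
      have := hf.2
      have := hg.2
      have := hh.2
      tauto
    · by_cases hef : Adj k e f
      · exact Or.inl ⟨hf, hef⟩
      · exact Or.inr ⟨hf, hef⟩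
  obtain ⟨e, f, g, hi⟩ : ∃ e f g, Indep k H e f g := by
    by_contra! hall
    refine hcon ((coverable_two hk hH ?_).mono subset_rfl (by omega))
    intro e he f hf g hg
    by_contra! h
    exact hall e f g ⟨he, hf, hg, h.1, h.2.1, h.2.2⟩
  have hle : ∀ e f : Finset V, ¬Adj k e f → (e ∩ f).card + 2 ≤ k := by
    intro e f h
    rw [Adj] at h
    omega
  have hdist : ∀ e f g, Indep k H e f g → (e ∩ f).card + 2 = k ∨ (e ∩ g).card + 2 = k := by
    intro e f g hi
    by_contra! hne
    have hef := hle _ _ hi.4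
    have heg := hle _ _ hi.5
    refine hnot e hi.1 (coverable_of_clique (by omega) (fun x hx => hH x hx.1) ?_)
    intro x hx y hy
    exact hind.adj hi hx.1 hy.1
      (not_adj_of_adj (hH e hi.1) (hH x hx.1) (by omega) hx.2)
      (not_adj_of_adj (hH e hi.1) (hH x hx.1) (by omega) hx.2)
      (not_adj_of_adj (hH e hi.1) (hH y hy.1) (by omega) hy.2)
      (not_adj_of_adj (hH e hi.1) (hH y hy.1) (by omega) hy.2)
  by_cases htri : ∀ e f g, Indep k H e f g → (e ∩ f).card + 2 = k
  · obtain hk4 | rfl : 4 ≤ k ∨ k = 3 := by omega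
    · exact hcon (coverable_triangle hk4 hH hind htri hi)
    · exact hcon (coverable_triangle_three hH hind hnot htri hi)
  · push Not at htri
    obtain ⟨e, g, f, hi, hne⟩ := htri
    have heg : (e ∩ g).card + 3 ≤ k := by
      have := hle _ _ hi.4
      omega
    have hef := (hdist _ _ _ hi).resolve_left hne
    have hgf := (hdist _ _ _ hi.swap_left).resolve_left (by rwa [inter_comm])
    rw [inter_comm] at hgf
    obtain hk4 | rfl : 4 ≤ k ∨ k = 3 := by omega
    · exact hcon (coverable_path hk4 hH hind hnot hdist hi.swap_right hef hgf heg)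
    · exact hcon (coverable_path_three hH hind hnot hi.swap_right (by omega) (by omega) heg)

theorem noFourIndep_of_isMatching {E : Finset (Finset V)} (hH : ∀ e ∈ E, e.card = k)
    (hmax : ∀ M, IsMatching (k - 1) E M → M.card ≤ 3) :
    NoFourIndep k (E : Set (Finset V)) := by
  intro e he f hf g hg h hh
  by_contra! hcon
  obtain ⟨h1, h2, h3, h4, h5, h6⟩ := hcon
  have hne : ∀ x ∈ E, ∀ y, ¬Adj k x y → x ≠ y := by
    rintro x hx y hxy rfl
    exact hxy (adj_self (hH x hx))
  have hlt : ∀ x y : Finset V, ¬Adj k x y → (x ∩ y).card < k - 1 ∧ (y ∩ x).card < k - 1 := by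
    intro x y hxy
    rw [inter_comm y x]
    rw [Adj] at hxy
    omega
  have hcard : ({e, f, g, h} : Finset (Finset V)).card = 4 := by
    rw [card_insert_of_notMem, card_insert_of_notMem, card_pair (hne g hg h h6)]
    · simp [hne f hf g h4, hne f hf h h5]
    · simp [hne e he f h1, hne e he g h2, hne e he h h3]
  have := hmax {e, f, g, h} ⟨?_, ?_⟩
  · omega
  · intro x hx
    simp only [mem_insert, mem_singleton] at hx
    rcases hx with rfl | rfl | rfl | rfl <;> assumption
  · intro x hx y hy hxy
    simp only [mem_insert, mem_singleton] at hx hy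
    rcases hx with rfl | rfl | rfl | rfl <;> rcases hy with rfl | rfl | rfl | rfl <;>
      first
      | exact absurd rfl hxy
      | exact (hlt _ _ ‹_›).1
      | exact (hlt _ _ ‹_›).2

end TuzaHypergraph

/-- If `H` is a `k`-uniform hypergraph with `ν^(k-1)(H) = 3`, then
`τ^(k-1)(H) ≤ 3⌈(k+1)/2⌉`. -/
theorem stmt2 {V : Type*} [DecidableEq V] (k : ℕ) (hk : 3 ≤ k)
    (H : Finset (Finset V)) (hH : ∀ e ∈ H, e.card = k)
    (hex : ∃ M, IsMatching (k - 1) H M ∧ M.card = 3)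
    (hmax : ∀ M, IsMatching (k - 1) H M → M.card ≤ 3) :
    ∃ C, IsCover (k - 1) H C ∧ C.card ≤ 3 * ((k + 2) / 2) := by
  obtain ⟨C, h1, h2, h3⟩ := TuzaHypergraph.coverable_three (H := (H : Set (Finset V))) hk hH
    (TuzaHypergraph.noFourIndep_of_isMatching hH hmax)
  exact ⟨C, ⟨h1, h2⟩, h3⟩
end

section
/- Let G be a finite simple graph that does not contain 4 pairwise edge-disjoint triangles. Then τ_t(G) ≤ 2·ν_t(G), i.e., Tuza's conjecture holds for G. -/
open Finset

/-- `t` is (the vertex set of) a triangle of the graph `G`. -/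
def IsTriangle {V : Type*} (G : SimpleGraph V) (t : Finset V) : Prop :=
  t.card = 3 ∧ ∀ u ∈ t, ∀ v ∈ t, u ≠ v → G.Adj u v

/-- `M` is a set of pairwise edge-disjoint triangles of `G`
(two triangles share an edge iff they share at least two vertices). -/
def TriMatching {V : Type*} [DecidableEq V] (G : SimpleGraph V) (M : Finset (Finset V)) : Prop :=
  (∀ t ∈ M, IsTriangle G t) ∧ ∀ t ∈ M, ∀ s ∈ M, t ≠ s → (t ∩ s).card < 2

/-- `C` is a set of edges of `G` meeting every triangle of `G`. -/
def TriCover {V : Type*} [DecidableEq V] (G : SimpleGraph V) (C : Finset (Finset V)) : Prop :=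
  (∀ c ∈ C, ∃ u v, G.Adj u v ∧ c = {u, v}) ∧ ∀ t, IsTriangle G t → ∃ c ∈ C, c ⊆ t

/-! ### A decision procedure for configurations of triangles

Configurations are described on vertices `0, …, k - 1` with `k ≤ 7`. A triangle is a number with
decimal digits `i < j < l`; a last digit `7 + e` stands for a vertex outside the configuration
that forms a triangle with the edge `ij` of the `e`-th triangle of the configuration. -/

/-- The atom `10 * i + j` says that `ij` is an edge, the atom `100 + 10 * i + j` says that the edge
`ij` lies in a triangle whose third vertex is outside. This is the bit mask of the atoms that make
`t` a triangle. -/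
def atomMask (t : ℕ) : ℕ :=
  bif (t % 10).blt 7 then
    2 ^ (t / 10) ||| (2 ^ (t / 100 * 10 + t % 10) ||| 2 ^ (t % 100))
  else 2 ^ (100 + t / 10)

/-- The bit mask of the pairs of vertices of `t`, together with the atoms needed for `t`. -/
def hitMask (t : ℕ) : ℕ :=
  2 ^ (t / 10) ||| (2 ^ (t / 100 * 10 + t % 10) ||| 2 ^ (t % 100)) ||| atomMask t

/-- The vertices of `t`, all outside vertices being identified. -/
def digitSet (t : ℕ) : Finset ℕ := {t / 100, t / 10 % 10, min (t % 10) 7}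

/-- `ts` consists of `n` triangles on `k` vertices that are pairwise edge-disjoint. -/
def validPacking (k n : ℕ) (ts : List ℕ) : Bool :=
  ts.length == n &&
    ts.all (fun t => (t / 100).blt (t / 10 % 10) && (t / 10 % 10).blt k &&
      ((t / 10 % 10).blt (t % 10) && (t % 10).blt k || Nat.ble 7 (t % 10))) &&
    decide (ts.Pairwise fun s t => (digitSet s ∩ digitSet t).card < 2)

/-- The possible triangles of a configuration with triangles `es` on `k` vertices. -/
def allTriangles (k : ℕ) (es : List (ℕ × ℕ × ℕ)) : List ℕ :=
  ((List.range k).flatMap fun z => (List.range z).flatMap fun y =>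
    (List.range y).map fun x => 100 * x + 10 * y + z) ++
  es.zipIdx.flatMap fun e => [100 * e.1.1 + 10 * e.1.2.1 + (7 + e.2),
    100 * e.1.1 + 10 * e.1.2.2 + (7 + e.2), 100 * e.1.2.1 + 10 * e.1.2.2 + (7 + e.2)]

/-- Run the decision tree `l`, in preorder, on the sets `T` and `F` of atoms known to be true and
false. An entry below `1000` is an atom to split on; other entries are leaves. -/
def runTree (P C : ℕ → ℕ → Bool) : ℕ → List ℕ → ℕ → ℕ → Option (List ℕ)
  | 0, _, _, _ => none
  | _ + 1, [], _, _ => none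
  | n + 1, b :: l, T, F =>
    bif b.blt 1000 then
      (runTree P C n l (T ||| 2 ^ b) F).bind fun l' => runTree P C n l' T (F ||| 2 ^ b)
    else bif b.blt 2000 then bif P (b - 1000) T then some l else none
    else bif C (b - 2000) F then some l else none

/-- All atoms needed for the packing number `i` are in `T`. -/
def packingLeaf (packs : List (List ℕ)) (i T : ℕ) : Bool :=
  match packs[i]? with
  | some ts => ts.all fun t => (atomMask t &&& T) == atomMask t
  | none => false

/-- Every triangle is hit by the cover number `i` or needs an atom in `F`. -/
def coverLeaf (tris : List ℕ) (covers : List (List ℕ)) (i F : ℕ) : Bool :=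
  match covers[i]? with
  | some cs => tris.all fun t => (hitMask t &&& (cs.foldr (fun c m => 2 ^ c ||| m) F)) != 0
  | none => false

/-- The decision tree shows that in each configuration with triangles `es` on `k` vertices there
are `n + 1` edge-disjoint triangles or `2 * n` edges hitting all triangles. -/
def checkTree (k n : ℕ) (es : List (ℕ × ℕ × ℕ)) (packs covers : List (List ℕ)) (l : List ℕ) :
    Bool :=
  packs.all (validPacking k (n + 1)) &&
    covers.all (fun cs => cs.length.ble (2 * n) && cs.all (·.blt 100)) &&
    es.all (fun e => e.1.blt e.2.1 && e.2.1.blt e.2.2 && e.2.2.blt k) && k.ble 7 && es.length.ble 3 &&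
    (runTree (packingLeaf packs) (coverLeaf (allTriangles k es) covers) 25 l
      (es.foldr (fun e m => atomMask (100 * e.1 + 10 * e.2.1 + e.2.2) ||| m) 0) 0).isSome

theorem runTree_sound {P C : ℕ → ℕ → Bool} {val : ℕ → Prop}
    (hP : ∀ i T, P i T = true → ¬ ∀ b, T.testBit b = true → val b)
    (hC : ∀ i F, C i F = true → ¬ ∀ b, F.testBit b = true → ¬ val b) :
    ∀ n l T F l', runTree P C n l T F = some l' → (∀ b, T.testBit b = true → val b) →
      ¬ ∀ b, F.testBit b = true → ¬ val b := by
  intro n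
  induction n with
  | zero => intro l T F l' h; simp [runTree] at h
  | succ n ih =>
    intro l T F l' h hT hF
    cases l with
    | nil => simp [runTree] at h
    | cons b l =>
      rw [runTree] at h
      cases h1 : b.blt 1000 with
      | true =>
        simp only [h1, cond_true, Option.bind_eq_some_iff] at h
        obtain ⟨l₁, h₁, h₂⟩ := h
        by_cases hb : val b
        · refine ih _ _ _ _ h₁ (fun c hc => ?_) hF
          rw [Nat.testBit_or, Bool.or_eq_true, Nat.testBit_two_pow, decide_eq_true_eq] at hc
          rcases hc with hc | rfl
          exacts [hT c hc, hb]
        · refine ih _ _ _ _ h₂ hT (fun c hc => ?_)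
          rw [Nat.testBit_or, Bool.or_eq_true, Nat.testBit_two_pow, decide_eq_true_eq] at hc
          rcases hc with hc | rfl
          exacts [hF c hc, hb]
      | false =>
        cases h2 : b.blt 2000 with
        | true =>
          cases h3 : P (b - 1000) T with
          | true => exact hP _ _ h3 hT
          | false => simp [h1, h2, h3] at h
        | false =>
          cases h3 : C (b - 2000) F with
          | true => exact hC _ _ h3 hF
          | false => simp [h1, h2, h3] at h

section Triangles

theorem isTriangle_iff {V : Type*} {G : SimpleGraph V} {t : Finset V} : IsTriangle G t ↔ G.IsNClique 3 t := by
  rw [SimpleGraph.isNClique_iff, and_comm]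
  rfl

/-- Some `n` edges hit all triangles of `G`. -/
def HitBy {V : Type*} (G : SimpleGraph V) (n : ℕ) : Prop :=
  ∃ C : Finset (Finset V), C.card ≤ n ∧ ∀ t, IsTriangle G t → ∃ c ∈ C, c ⊆ t ∧ c.card = 2

variable {V : Type*} [DecidableEq V] {G : SimpleGraph V}

theorem isTriangle_insert_iff {x y z : V} :
    IsTriangle G {x, y, z} ↔ G.Adj x y ∧ G.Adj x z ∧ G.Adj y z := by
  rw [isTriangle_iff, SimpleGraph.is3Clique_triple_iff]

theorem exists_eq_insert_of_mem {t : Finset V} (h : t.card = 3) {a : V} (ha : a ∈ t) :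
    ∃ b c, a ≠ b ∧ a ≠ c ∧ b ≠ c ∧ t = {a, b, c} := by
  have h2 : (t.erase a).card = 2 := by rw [Finset.card_erase_of_mem ha, h]
  obtain ⟨b, c, hbc, he⟩ := Finset.card_eq_two.1 h2
  have hb : b ∈ t.erase a := by simp [he]
  have hc : c ∈ t.erase a := by simp [he]
  exact ⟨b, c, (Finset.ne_of_mem_erase hb).symm, (Finset.ne_of_mem_erase hc).symm, hbc, by
    rw [← he, Finset.insert_erase ha]⟩

theorem exists_eq_insert_of_mem_of_mem {t : Finset V} (h : t.card = 3) {a b : V} (ha : a ∈ t)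
    (hb : b ∈ t) (hab : a ≠ b) : ∃ c, a ≠ c ∧ b ≠ c ∧ t = {a, b, c} := by
  obtain ⟨x, y, hx, hy, hxy, rfl⟩ := exists_eq_insert_of_mem h ha
  simp only [Finset.mem_insert, Finset.mem_singleton] at hb
  rcases hb with rfl | rfl | rfl
  · exact absurd rfl hab
  · exact ⟨y, hy, hxy, rfl⟩
  · exact ⟨x, hx, hxy.symm, by rw [Finset.pair_comm]⟩

theorem two_le_card_inter {s t : Finset V} {a b : V} (hab : a ≠ b) (ha : a ∈ s) (ha' : a ∈ t)
    (hb : b ∈ s) (hb' : b ∈ t) : 2 ≤ (s ∩ t).card := by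
  rw [← Finset.card_pair hab]
  exact Finset.card_le_card (by grind)

theorem exists_of_two_le_card_inter {s t : Finset V} (h : 2 ≤ (s ∩ t).card) :
    ∃ a b, a ≠ b ∧ a ∈ s ∧ a ∈ t ∧ b ∈ s ∧ b ∈ t := by
  obtain ⟨a, ha, b, hb, hab⟩ := Finset.one_lt_card.1 h
  simp only [Finset.mem_inter] at ha hb
  exact ⟨a, b, hab, ha.1, ha.2, hb.1, hb.2⟩

theorem eq_of_mem_inter {s t : Finset V} (h : (s ∩ t).card < 2) {a b : V} (ha : a ∈ s)
    (ha' : a ∈ t) (hb : b ∈ s) (hb' : b ∈ t) : a = b := by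
  by_contra hab
  exact absurd (two_le_card_inter hab ha ha' hb hb') (by omega)

theorem triMatching_toFinset {l : List (Finset V)} (ht : ∀ t ∈ l, IsTriangle G t)
    (hl : l.Pairwise fun s t => (s ∩ t).card < 2) :
    TriMatching G l.toFinset ∧ l.toFinset.card = l.length := by
  refine ⟨⟨by simpa using ht, fun t h s h' hne => ?_⟩, ?_⟩
  · rw [List.mem_toFinset] at h h'
    have : Std.Symm fun s t : Finset V => (s ∩ t).card < 2 := ⟨fun a b hab => by
      simpa only [Finset.inter_comm] using hab⟩
    exact hl.forall h h' hne
  · refine List.toFinset_card_of_nodup (List.Pairwise.imp_of_mem ?_ hl)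
    rintro a b ha - hab rfl
    rw [Finset.inter_self, (ht a ha).1] at hab
    omega

theorem HitBy.mono {V : Type*} {G : SimpleGraph V} {m n : ℕ} (h : HitBy G n) (hnm : n ≤ m) :
    HitBy G m :=
  let ⟨C, hC, h⟩ := h
  ⟨C, hC.trans hnm, h⟩

theorem HitBy.exists_triCover {n : ℕ} (h : HitBy G n) : ∃ C, TriCover G C ∧ C.card ≤ n := by
  classical
  obtain ⟨C, hC, h⟩ := h
  refine ⟨{c ∈ C | ∃ u v, G.Adj u v ∧ c = {u, v}}, ⟨fun c hc => (Finset.mem_filter.1 hc).2, ?_⟩,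
    (Finset.card_filter_le _ _).trans hC⟩
  intro t ht
  obtain ⟨c, hc, hct, hc2⟩ := h t ht
  obtain ⟨u, v, huv, rfl⟩ := Finset.card_eq_two.1 hc2
  exact ⟨_, Finset.mem_filter.2 ⟨hc, u, v, ht.2 u (hct (by simp)) v (hct (by simp)) huv, rfl⟩, hct⟩

variable {M : Finset (Finset V)} {n : ℕ}

/-- Triangles meeting the packing only in edges of `e` pairwise share an edge. -/
theorem two_le_card_inter_of_private (hM : TriMatching G M)
    (hmax : ∀ M', TriMatching G M' → M'.card ≤ M.card) {e s t : Finset V} (he : e ∈ M)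
    (hs : IsTriangle G s) (ht : IsTriangle G t)
    (hs' : ∀ f ∈ M, f ≠ e → (s ∩ f).card < 2) (ht' : ∀ f ∈ M, f ≠ e → (t ∩ f).card < 2) :
    2 ≤ (s ∩ t).card := by
  by_contra! hst
  have h3 : ∀ r, IsTriangle G r → (∀ f ∈ M, f ≠ e → (r ∩ f).card < 2) → r ∉ M.erase e := by
    intro r hr hr' hmem
    have := hr' r (Finset.mem_of_mem_erase hmem) (Finset.ne_of_mem_erase hmem)
    rw [Finset.inter_self, hr.1] at this
    omega
  have hne : s ≠ t := by
    rintro rfl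
    rw [Finset.inter_self, hs.1] at hst
    omega
  have hcard : (insert s (insert t (M.erase e))).card = M.card + 1 := by
    rw [Finset.card_insert_of_notMem, Finset.card_insert_of_notMem (h3 t ht ht'),
      Finset.card_erase_add_one he]
    simp [hne, h3 s hs hs']
  have := hmax (insert s (insert t (M.erase e))) ⟨?_, ?_⟩
  · omega
  · have := hM.1
    grind
  · have := hM.2
    grind [Finset.inter_comm]

theorem exists_third_vertex {t : Finset V} {a x y : V} (ht : t.card = 3) (ha : a ∈ t)
    (hne : t ≠ {a, x, y}) (h : 2 ≤ (t ∩ {a, x, y}).card) :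
    ∃ z, z ∉ ({a, x, y} : Finset V) ∧ (t = {a, x, z} ∨ t = {a, y, z}) := by
  obtain ⟨u, v, hu, hv, huv, rfl⟩ := exists_eq_insert_of_mem ht ha
  obtain ⟨p, q, hpq, hp, hp', hq, hq'⟩ := exists_of_two_le_card_inter h
  simp only [Finset.mem_insert, Finset.mem_singleton] at hp hp' hq hq'
  obtain rfl | rfl | rfl | rfl : u = x ∨ u = y ∨ v = x ∨ v = y := by grind
  · exact ⟨v, by grind, .inl rfl⟩
  · exact ⟨v, by grind, .inr rfl⟩
  · exact ⟨u, by grind, .inl (by rw [Finset.pair_comm])⟩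
  · exact ⟨u, by grind, .inr (by rw [Finset.pair_comm])⟩

theorem eq_of_two_le_card_inter {a x y z w : V} (hxy : x ≠ y) (hz : z ∉ ({a, x, y} : Finset V))
    (hw : w ∉ ({a, x, y} : Finset V)) (h : 2 ≤ (({a, x, z} : Finset V) ∩ {a, y, w}).card) :
    z = w := by
  obtain ⟨p, q, hpq, hp, hp', hq, hq'⟩ := exists_of_two_le_card_inter h
  simp only [Finset.mem_insert, Finset.mem_singleton, not_or] at *
  grind

/-- The triangles through `a` that meet the packing only in edges of `e` share a second vertex. -/
theorem exists_edge_of_private (hM : TriMatching G M)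
    (hmax : ∀ M', TriMatching G M' → M'.card ≤ M.card) {e : Finset V} (he : e ∈ M) (a : V) :
    ∃ c : Finset V, ∀ t, IsTriangle G t → t ≠ e → 2 ≤ (t ∩ e).card →
      (∀ f ∈ M, f ≠ e → (t ∩ f).card < 2) → a ∈ t → a ∈ e → c ⊆ t ∧ c.card = 2 := by
  by_cases ha : a ∈ e
  swap
  · exact ⟨∅, fun _ _ _ _ _ _ h => absurd h ha⟩
  obtain ⟨x, y, hax, hay, hxy, rfl⟩ := exists_eq_insert_of_mem (hM.1 e he).1 ha
  let S : Set (Finset V) := {t | IsTriangle G t ∧ t ≠ {a, x, y} ∧ 2 ≤ (t ∩ {a, x, y}).card ∧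
    (∀ f ∈ M, f ≠ {a, x, y} → (t ∩ f).card < 2) ∧ a ∈ t}
  suffices h : ∃ z, a ≠ z ∧ ∀ t ∈ S, z ∈ t by
    obtain ⟨z, hz, h⟩ := h
    refine ⟨{a, z}, fun t h₁ h₂ h₃ h₄ h₅ _ => ⟨?_, Finset.card_pair hz⟩⟩
    have := h t ⟨h₁, h₂, h₃, h₄, h₅⟩
    grind
  have hS : ∀ t ∈ S, ∃ z, z ∉ ({a, x, y} : Finset V) ∧ (t = {a, x, z} ∨ t = {a, y, z}) :=
    fun t ht => exists_third_vertex ht.1.1 ht.2.2.2.2 ht.2.1 ht.2.2.1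
  have hI : ∀ s ∈ S, ∀ t ∈ S, 2 ≤ (s ∩ t).card := fun s hs t ht =>
    two_le_card_inter_of_private hM hmax he hs.1 ht.1 hs.2.2.2.1 ht.2.2.2.1
  have hI' : ∀ z w, z ∉ ({a, x, y} : Finset V) → w ∉ ({a, x, y} : Finset V) →
      {a, x, z} ∈ S → {a, y, w} ∈ S → z = w :=
    fun z w hz hw hs ht => eq_of_two_le_card_inter hxy hz hw (hI _ hs _ ht)
  by_cases hx : ∀ t ∈ S, x ∈ t
  · exact ⟨x, hax, hx⟩
  by_cases hy : ∀ t ∈ S, y ∈ t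
  · exact ⟨y, hay, hy⟩
  push Not at hx hy
  obtain ⟨s, hs, hxs⟩ := hx
  obtain ⟨t, ht, hyt⟩ := hy
  obtain ⟨z, hz, rfl | rfl⟩ := hS s hs
  · simp at hxs
  obtain ⟨w, hw, rfl | rfl⟩ := hS t ht
  swap
  · simp at hyt
  have hwz := hI' w z hw hz ht hs
  refine ⟨z, by grind, fun r hr => ?_⟩
  obtain ⟨v, hv, rfl | rfl⟩ := hS r hr
  · have := hI' v z hv hz hr hs
    simp [this]
  · have := hI' w v hw hv ht hr
    simp [← this, hwz]

/-- If `e` meets no other triangle of the packing, two edges hit all triangles sharing an edge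
with `e`. -/
theorem exists_hit_of_isolated (hM : TriMatching G M)
    (hmax : ∀ M', TriMatching G M' → M'.card ≤ M.card) {e : Finset V} (he : e ∈ M)
    (hiso : ∀ f ∈ M, f ≠ e → Disjoint e f) :
    ∃ D : Finset (Finset V), D.card ≤ 2 ∧
      ∀ t, IsTriangle G t → 2 ≤ (t ∩ e).card → ∃ d ∈ D, d ⊆ t ∧ d.card = 2 := by
  obtain ⟨a, ha⟩ : e.Nonempty := Finset.card_pos.1 (by rw [(hM.1 e he).1]; simp)
  obtain ⟨x, y, hax, hay, hxy, hexy⟩ := exists_eq_insert_of_mem (hM.1 e he).1 ha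
  obtain ⟨c, hc⟩ := exists_edge_of_private hM hmax he a
  refine ⟨{c, {x, y}}, Finset.card_le_two, fun t ht h2 => ?_⟩
  by_cases hxyt : {x, y} ⊆ t
  · exact ⟨_, by simp, hxyt, Finset.card_pair hxy⟩
  · obtain ⟨p, q, hpq, hp, hpe, hq, hqe⟩ := exists_of_two_le_card_inter h2
    refine ⟨c, by simp, hc t ht (by grind) h2 (fun f hf hne => ?_) (by grind) ha⟩
    by_contra! h
    obtain ⟨u, v, huv, hut, huf, hvt, hvf⟩ := exists_of_two_le_card_inter h
    have hd := Finset.disjoint_left.1 (hiso f hf hne)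
    have : t = {p, q, u} := by
      obtain ⟨r, -, -, rfl⟩ := exists_eq_insert_of_mem_of_mem ht.1 hp hq hpq
      grind
    grind

end Triangles
section Configurations

variable {V : Type*} [DecidableEq V] {G : SimpleGraph V} {p : ℕ → V} {k n : ℕ}

/-- The meaning of the atom `b` for the configuration with vertices `p 0, …, p (k - 1)`. -/
def Atom (G : SimpleGraph V) (p : ℕ → V) (k b : ℕ) : Prop :=
  if b < 100 then b % 10 < 7 → G.Adj (p (b / 10)) (p (b % 10))
  else ∃ y ∉ (Finset.range k).image p, IsTriangle G {p (b / 10 - 10), p (b % 10), y}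

theorem atom_of_adj {i j : ℕ} (hi : i < 7) (hj : j < 7) (h : G.Adj (p i) (p j)) :
    Atom G p k (10 * i + j) := by
  rw [Atom, if_pos (by omega)]
  intro
  rwa [show (10 * i + j) / 10 = i by omega, show (10 * i + j) % 10 = j by omega]

theorem Atom.adj {b i j : ℕ} (h : Atom G p k b) (hi : i < 7) (hj : j < 7) (hb : b = 10 * i + j) :
    G.Adj (p i) (p j) := by
  subst hb
  rw [Atom, if_pos (by omega)] at h
  rw [show (10 * i + j) / 10 = i by omega, show (10 * i + j) % 10 = j by omega] at h
  exact h hj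

theorem Atom.exists_notMem {b i j : ℕ} (h : Atom G p k b) (hj : j < 7)
    (hb : b = 100 + (10 * i + j)) :
    ∃ y ∉ (Finset.range k).image p, IsTriangle G {p i, p j, y} := by
  subst hb
  rw [Atom, if_neg (by omega)] at h
  rwa [show (100 + (10 * i + j)) / 10 - 10 = i by omega,
    show (100 + (10 * i + j)) % 10 = j by omega] at h

theorem testBit_atomMask_of_lt {x y z b : ℕ} (hy : y < 7) (hz : z < 7) :
    (atomMask (100 * x + 10 * y + z)).testBit b = true ↔
      b = 10 * x + y ∨ b = 10 * x + z ∨ b = 10 * y + z := by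
  have h : ((100 * x + 10 * y + z) % 10).blt 7 = true := by
    rw [Nat.blt_eq]; omega
  rw [atomMask, h, cond_true, Nat.testBit_or, Nat.testBit_or, Nat.testBit_two_pow,
    Nat.testBit_two_pow, Nat.testBit_two_pow, Bool.or_eq_true, Bool.or_eq_true,
    decide_eq_true_eq, decide_eq_true_eq, decide_eq_true_eq]
  omega

theorem testBit_atomMask_of_le {x y z b : ℕ} (hz : 7 ≤ z) (hz' : z < 10) :
    (atomMask (100 * x + 10 * y + z)).testBit b = true ↔ b = 100 + (10 * x + y) := by
  have h : ((100 * x + 10 * y + z) % 10).blt 7 = false := by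
    rw [← Bool.not_eq_true, Nat.blt_eq]; omega
  rw [atomMask, h, cond_false, Nat.testBit_two_pow, decide_eq_true_eq]
  omega

theorem testBit_hitMask {x y z b : ℕ} (hy : y < 7) (hz : z < 10) :
    (hitMask (100 * x + 10 * y + z)).testBit b = true ↔
      (b = 10 * x + y ∨ b = 10 * x + z ∨ b = 10 * y + z) ∨
        (atomMask (100 * x + 10 * y + z)).testBit b = true := by
  rw [hitMask, Nat.testBit_or, Nat.testBit_or, Nat.testBit_or, Nat.testBit_two_pow,
    Nat.testBit_two_pow, Nat.testBit_two_pow]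
  simp only [Bool.or_eq_true, decide_eq_true_eq]
  refine or_congr_left ?_
  omega

theorem testBit_foldr_or {α : Type*} (f : α → ℕ) (l : List α) (m b : ℕ) :
    (l.foldr (fun c m => f c ||| m) m).testBit b = true ↔
      (∃ c ∈ l, (f c).testBit b = true) ∨ m.testBit b = true := by
  induction l with
  | nil => simp
  | cons a l ih => simp only [List.foldr_cons, Nat.testBit_or, Bool.or_eq_true, ih]; simp [or_assoc]

theorem exists_testBit_of_land_ne_zero {a b : ℕ} (h : a &&& b ≠ 0) :
    ∃ i, a.testBit i = true ∧ b.testBit i = true := by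
  by_contra! hn
  refine h (Nat.eq_of_testBit_eq fun i => ?_)
  have := hn i
  rw [Nat.testBit_and, Nat.zero_testBit]
  grind

/-- A triangle with three distinct labels. -/
theorem exists_labelled_triangle {π : V → ℕ} {u v w : V} {D : Finset ℕ}
    (h : IsTriangle G {u, v, w}) (hu : π u ∈ D) (hv : π v ∈ D) (hw : π w ∈ D)
    (huv : π u ≠ π v) (huw : π u ≠ π w) (hvw : π v ≠ π w) :
    ∃ s, IsTriangle G s ∧ (∀ v ∈ s, π v ∈ D) ∧ Set.InjOn π (s : Set V) := by
  refine ⟨_, h, by grind, ?_⟩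
  intro a ha b hb
  simp only [Finset.coe_insert, Finset.coe_singleton, Set.mem_insert_iff,
    Set.mem_singleton_iff] at ha hb
  grind

theorem exists_triangle_of_atoms {π : V → ℕ} (hk : k ≤ 7) (hπ : ∀ i < k, π (p i) = i)
    (hπ' : ∀ v ∉ (Finset.range k).image p, π v = 7) {t : ℕ}
    (ht : (t / 100).blt (t / 10 % 10) && (t / 10 % 10).blt k &&
      ((t / 10 % 10).blt (t % 10) && (t % 10).blt k || Nat.ble 7 (t % 10)))
    (h : ∀ b, (atomMask t).testBit b = true → Atom G p k b) :
    ∃ s, IsTriangle G s ∧ (∀ v ∈ s, π v ∈ digitSet t) ∧ Set.InjOn π (s : Set V) := by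
  obtain ⟨x, y, z, hx, hy, hz, rfl⟩ : ∃ x y z, x = t / 100 ∧ y = t / 10 % 10 ∧ z = t % 10 ∧
    t = 100 * x + 10 * y + z := ⟨_, _, _, rfl, rfl, rfl, by omega⟩
  rw [digitSet]
  simp only [← hx, ← hy, ← hz, Bool.and_eq_true, Bool.or_eq_true, Nat.blt_eq, Nat.ble_eq] at ht ⊢
  obtain ⟨⟨hxy, hyk⟩, ⟨hyz, hzk⟩ | hz7⟩ := ht
  · have h' := fun b => (testBit_atomMask_of_lt (x := x) (b := b) (hyk.trans_le hk)
      (hzk.trans_le hk)).2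
    have hT : IsTriangle G {p x, p y, p z} := isTriangle_insert_iff.2
      ⟨(h _ (h' _ (.inl rfl))).adj (by omega) (by omega) rfl,
        (h _ (h' _ (.inr (.inl rfl)))).adj (by omega) (by omega) rfl,
        (h _ (h' _ (.inr (.inr rfl)))).adj (by omega) (by omega) rfl⟩
    have h₁ := hπ x (by omega)
    have h₂ := hπ y (by omega)
    have h₃ := hπ z (by omega)
    have h₄ : min z 7 = z := by omega
    refine exists_labelled_triangle hT ?_ ?_ ?_ ?_ ?_ ?_ <;> simp only [h₁, h₂, h₃, h₄] <;>
      first | omega | simp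
  · obtain ⟨u, hu, hT⟩ := (h _ ((testBit_atomMask_of_le hz7 (by omega)).2 rfl)).exists_notMem
      (by omega) rfl
    have h₁ := hπ x (by omega)
    have h₂ := hπ y (by omega)
    have h₃ := hπ' u hu
    have h₄ : min z 7 = 7 := by omega
    refine exists_labelled_triangle hT ?_ ?_ ?_ ?_ ?_ ?_ <;> simp only [h₁, h₂, h₃, h₄] <;>
      first | omega | simp

theorem exists_triMatching_of_packing (hk : k ≤ 7)
    (hp : ∀ i < k, ∀ j < k, p i = p j → i = j) {ts : List ℕ} (hts : validPacking k n ts = true)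
    (h : ∀ t ∈ ts, ∀ b, (atomMask t).testBit b = true → Atom G p k b) :
    ∃ M, TriMatching G M ∧ M.card = n := by
  classical
  let π : V → ℕ := fun v => if h : ∃ i < k, p i = v then h.choose else 7
  have hπ : ∀ i < k, π (p i) = i := by
    intro i hi
    have h : ∃ j < k, p j = p i := ⟨i, hi, rfl⟩
    simp only [π, dif_pos h]
    exact hp _ h.choose_spec.1 _ hi h.choose_spec.2
  have hπ' : ∀ v ∉ (Finset.range k).image p, π v = 7 := by
    intro v hv
    refine dif_neg fun ⟨i, hi, h⟩ => hv ?_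
    exact Finset.mem_image.2 ⟨i, Finset.mem_range.2 hi, h⟩
  rw [validPacking, Bool.and_eq_true, Bool.and_eq_true, List.all_eq_true, decide_eq_true_eq,
    beq_iff_eq] at hts
  obtain ⟨⟨hlen, hval⟩, hpw⟩ := hts
  have hex := fun t (ht : t ∈ ts) => exists_triangle_of_atoms hk hπ hπ' (hval t ht) (h t ht)
  choose! f hf hfπ hinj using hex
  have hpw' : (ts.map f).Pairwise fun s t => (s ∩ t).card < 2 := by
    rw [List.pairwise_map]
    refine hpw.imp_of_mem fun {s t} hs ht hst => lt_of_le_of_lt ?_ hst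
    refine Finset.card_le_card_of_injOn π (fun v hv => ?_) ((hinj s hs).mono (by simp))
    rw [Finset.coe_inter] at hv
    exact Finset.mem_inter.2 ⟨hfπ s hs v hv.1, hfπ t ht v hv.2⟩
  obtain ⟨hM, hcard⟩ := triMatching_toFinset (G := G) (by simpa using hf) hpw'
  exact ⟨_, hM, by rw [hcard, List.length_map, hlen]⟩

/-- The vertex set of the triangle `e` of a configuration. -/
def tripleImage (p : ℕ → V) (e : ℕ × ℕ × ℕ) : Finset V := {p e.1, p e.2.1, p e.2.2}

theorem exists_lt_of_card_eq_three {s : Finset ℕ} (h : s.card = 3) :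
    ∃ x y z, x < y ∧ y < z ∧ s = {x, y, z} := by
  obtain ⟨a, b, c, hab, hac, hbc, rfl⟩ := Finset.card_eq_three.1 h
  rcases hab.lt_or_gt with h₁ | h₁ <;> rcases hac.lt_or_gt with h₂ | h₂ <;>
    rcases hbc.lt_or_gt with h₃ | h₃
  · exact ⟨a, b, c, h₁, h₃, rfl⟩
  · exact ⟨a, c, b, h₂, h₃, by grind⟩
  · omega
  · exact ⟨c, a, b, h₂, h₁, by grind⟩
  · exact ⟨b, a, c, h₁, h₂, by grind⟩
  · omega
  · exact ⟨b, c, a, h₃, h₂, by grind⟩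
  · exact ⟨c, b, a, h₃, h₁, by grind⟩

theorem exists_lt_of_subset_image (hp : ∀ i < k, ∀ j < k, p i = p j → i = j) {t : Finset V}
    (ht : t.card = 3) (htW : t ⊆ (Finset.range k).image p) :
    ∃ x y z, x < y ∧ y < z ∧ z < k ∧ t = {p x, p y, p z} := by
  obtain ⟨s, hs, rfl⟩ := Finset.subset_image_iff.1 htW
  have hinj : Set.InjOn p s := fun i hi j hj => hp i (by simpa using hs hi) j (by simpa using hs hj)
  rw [Finset.card_image_of_injOn hinj] at ht
  obtain ⟨x, y, z, hxy, hyz, rfl⟩ := exists_lt_of_card_eq_three ht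
  exact ⟨x, y, z, hxy, hyz, by simpa using @hs z (by simp), by simp [Finset.image_insert]⟩

/-- The edge with code `x`; the second digit `7 + m` stands for the edge `c` chooses at the first
vertex in the `m`-th triangle. -/
def codedEdge (p : ℕ → V) (es : List (ℕ × ℕ × ℕ)) (c : Finset V → V → Finset V) (x : ℕ) :
    Finset V :=
  if x % 10 < 7 then {p (x / 10), p (x % 10)}
  else c (tripleImage p (es.getD (x % 10 - 7) (0, 0, 0))) (p (x / 10))

theorem codedEdge_of_lt {es : List (ℕ × ℕ × ℕ)} {c : Finset V → V → Finset V} {i j : ℕ}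
    (hj : j < 7) : codedEdge p es c (10 * i + j) = {p i, p j} := by
  rw [codedEdge, if_pos (by omega), show (10 * i + j) / 10 = i by omega,
    show (10 * i + j) % 10 = j by omega]

theorem codedEdge_of_le {es : List (ℕ × ℕ × ℕ)} {c : Finset V → V → Finset V} {i m : ℕ}
    (hm : m < 3) {e : ℕ × ℕ × ℕ} (he : es[m]? = some e) :
    codedEdge p es c (10 * i + (7 + m)) = c (tripleImage p e) (p i) := by
  rw [codedEdge, if_neg (by omega), show (10 * i + (7 + m)) / 10 = i by omega,
    show (10 * i + (7 + m)) % 10 - 7 = m by omega, List.getD_eq_getElem?_getD, he,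
    Option.getD_some]

theorem mem_allTriangles_of_lt {es : List (ℕ × ℕ × ℕ)} {x y z : ℕ} (hxy : x < y) (hyz : y < z)
    (hzk : z < k) : 100 * x + 10 * y + z ∈ allTriangles k es := by
  rw [allTriangles, List.mem_append]
  left
  simp only [List.mem_flatMap, List.mem_range, List.mem_map]
  exact ⟨z, hzk, y, hyz, x, hxy, rfl⟩

theorem mem_allTriangles_of_getElem? {es : List (ℕ × ℕ × ℕ)} {i j m : ℕ} {e : ℕ × ℕ × ℕ}
    (he : es[m]? = some e)
    (hij : (i, j) = (e.1, e.2.1) ∨ (i, j) = (e.1, e.2.2) ∨ (i, j) = (e.2.1, e.2.2)) :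
    100 * i + 10 * j + (7 + m) ∈ allTriangles k es := by
  rw [allTriangles, List.mem_append]
  right
  refine List.mem_flatMap.2 ⟨(e, m), List.mem_zipIdx_iff_getElem?.2 he, ?_⟩
  simp only [Prod.mk.injEq] at hij
  rcases hij with ⟨rfl, rfl⟩ | ⟨rfl, rfl⟩ | ⟨rfl, rfl⟩ <;> simp

/-- A triangle with an outside vertex is an edge of a triangle of the configuration together with
that vertex. -/
theorem exists_pair_of_outside {e : ℕ × ℕ × ℕ} {t : Finset V} {u : V} (ht : t.card = 3)
    (hu : u ∈ t) (hue : u ∉ tripleImage p e) (h : 2 ≤ (t ∩ tripleImage p e).card) :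
    ∃ i j, ((i, j) = (e.1, e.2.1) ∨ (i, j) = (e.1, e.2.2) ∨ (i, j) = (e.2.1, e.2.2)) ∧
      t = {p i, p j, u} := by
  obtain ⟨a, b, hab, hat, hae, hbt, hbe⟩ := exists_of_two_le_card_inter h
  obtain ⟨c, hac, hbc, rfl⟩ := exists_eq_insert_of_mem_of_mem ht hat hbt hab
  obtain rfl : u = c := by grind
  obtain ⟨x, y, z⟩ := e
  simp only [tripleImage, Finset.mem_insert, Finset.mem_singleton] at hae hbe
  rcases hae with rfl | rfl | rfl <;> rcases hbe with rfl | rfl | rfl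
  · exact absurd rfl hab
  · exact ⟨x, y, by simp, rfl⟩
  · exact ⟨x, z, by simp, rfl⟩
  · exact ⟨x, y, by simp, Finset.insert_comm _ _ _⟩
  · exact absurd rfl hab
  · exact ⟨y, z, by simp, rfl⟩
  · exact ⟨x, z, by simp, Finset.insert_comm _ _ _⟩
  · exact ⟨y, z, by simp, Finset.insert_comm _ _ _⟩
  · exact absurd rfl hab

theorem exists_two_le_card_inter {M : Finset (Finset V)} (hM : TriMatching G M)
    (hmax : ∀ M', TriMatching G M' → M'.card ≤ M.card) {t : Finset V} (ht : IsTriangle G t) :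
    ∃ e ∈ M, 2 ≤ (t ∩ e).card := by
  by_contra! h
  have htM : t ∉ M := fun hmem => by
    have := h t hmem
    rw [Finset.inter_self, ht.1] at this
    omega
  have := hmax (insert t M) ⟨?_, ?_⟩
  · rw [Finset.card_insert_of_notMem htM] at this
    omega
  · have := hM.1
    grind
  · have := hM.2
    grind [Finset.inter_comm]

variable {M : Finset (Finset V)} {es : List (ℕ × ℕ × ℕ)}

theorem hitBy_of_cover (hM : TriMatching G M)
    (hmax : ∀ M', TriMatching G M' → M'.card ≤ M.card) (hk : k ≤ 7)
    (hp : ∀ i < k, ∀ j < k, p i = p j → i = j) (hes : es.length ≤ 3)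
    (hlt : ∀ e ∈ es, e.1 < e.2.1 ∧ e.2.1 < e.2.2 ∧ e.2.2 < k)
    (hMes : ∀ t, t ∈ M ↔ ∃ e ∈ es, t = tripleImage p e) {cs : List ℕ} (hcs : ∀ c ∈ cs, c < 100)
    {F : ℕ} (hF : ∀ b, F.testBit b = true → ¬ Atom G p k b)
    (h : ∀ t ∈ allTriangles k es, hitMask t &&& (cs.foldr (fun c m => 2 ^ c ||| m) F) ≠ 0) :
    HitBy G cs.length := by
  classical
  have hbit : ∀ t ∈ allTriangles k es, ∃ b, (hitMask t).testBit b = true ∧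
      (b ∈ cs ∨ ¬ Atom G p k b) := by
    intro t ht
    obtain ⟨b, hb, hb'⟩ := exists_testBit_of_land_ne_zero (h t ht)
    refine ⟨b, hb, ?_⟩
    rw [testBit_foldr_or] at hb'
    refine hb'.imp ?_ (hF b)
    rintro ⟨c, hc, hcb⟩
    rw [Nat.testBit_two_pow, decide_eq_true_eq] at hcb
    rwa [← hcb]
  have hpriv : ∀ e, ∃ c : V → Finset V, e ∈ M → ∀ a t, IsTriangle G t → t ≠ e →
      2 ≤ (t ∩ e).card → (∀ f ∈ M, f ≠ e → (t ∩ f).card < 2) → a ∈ t → a ∈ e →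
      c a ⊆ t ∧ (c a).card = 2 := by
    intro e
    by_cases he : e ∈ M
    · choose c hc using exists_edge_of_private hM hmax he
      exact ⟨c, fun _ => hc⟩
    · exact ⟨fun _ => ∅, fun h => absurd h he⟩
  choose c hc using hpriv
  refine ⟨(cs.map (codedEdge p es c)).toFinset,
    (List.toFinset_card_le _).trans (by rw [List.length_map]), fun t ht => ?_⟩
  suffices hs : ∃ b ∈ cs, codedEdge p es c b ⊆ t ∧ (codedEdge p es c b).card = 2 by
    obtain ⟨b, hb, h⟩ := hs
    exact ⟨_, by simpa using ⟨b, hb, rfl⟩, h⟩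
  have hpair : ∀ i j, i < 7 → j < 7 → (10 * i + j ∈ cs ∨ ¬ Atom G p k (10 * i + j)) →
      G.Adj (p i) (p j) → p i ∈ t → p j ∈ t →
      ∃ b ∈ cs, codedEdge p es c b ⊆ t ∧ (codedEdge p es c b).card = 2 := by
    intro i j hi hj hb hadj hit hjt
    refine ⟨_, hb.resolve_right fun h => h (atom_of_adj hi hj hadj), ?_⟩
    rw [codedEdge_of_lt hj, Finset.card_pair hadj.ne]
    exact ⟨by grind, rfl⟩
  by_cases htW : t ⊆ (Finset.range k).image p
  · obtain ⟨x, y, z, hxy, hyz, hzk, rfl⟩ := exists_lt_of_subset_image hp ht.1 htW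
    obtain ⟨b, hb, hb'⟩ := hbit _ (mem_allTriangles_of_lt hxy hyz hzk)
    rw [testBit_hitMask (by omega) (by omega), testBit_atomMask_of_lt (by omega) (by omega),
      or_self] at hb
    obtain ⟨h₁, h₂, h₃⟩ := isTriangle_insert_iff.1 ht
    rcases hb with rfl | rfl | rfl
    · exact hpair x y (by omega) (by omega) hb' h₁ (by simp) (by simp)
    · exact hpair x z (by omega) (by omega) hb' h₂ (by simp) (by simp)
    · exact hpair y z (by omega) (by omega) hb' h₃ (by simp) (by simp)
  · obtain ⟨u, hut, hu⟩ := Finset.not_subset.1 htW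
    have hW : ∀ e ∈ M, e ⊆ (Finset.range k).image p := by
      intro e he
      obtain ⟨e, he', rfl⟩ := (hMes _).1 he
      obtain ⟨h₁, h₂, h₃⟩ := hlt e he'
      intro v hv
      simp only [tripleImage, Finset.mem_insert, Finset.mem_singleton] at hv
      simp only [Finset.mem_image, Finset.mem_range]
      rcases hv with rfl | rfl | rfl
      exacts [⟨_, by omega, rfl⟩, ⟨_, by omega, rfl⟩, ⟨_, by omega, rfl⟩]
    obtain ⟨e', he, h2⟩ := exists_two_le_card_inter hM hmax ht
    obtain ⟨e, hees, rfl⟩ := (hMes _).1 he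
    obtain ⟨m, hm, hme⟩ := List.mem_iff_getElem.1 hees
    have hme' : es[m]? = some e := by rw [List.getElem?_eq_getElem hm, hme]
    obtain ⟨i, j, hij, rfl⟩ := exists_pair_of_outside ht.1 hut (fun h => hu (hW _ he h)) h2
    obtain ⟨h₁, h₂, h₃⟩ := hlt e hees
    have hijk : i < k ∧ j < k ∧ p i ∈ tripleImage p e ∧ p j ∈ tripleImage p e := by
      simp only [Prod.mk.injEq] at hij
      rcases hij with ⟨rfl, rfl⟩ | ⟨rfl, rfl⟩ | ⟨rfl, rfl⟩ <;>
        exact ⟨by omega, by omega, by simp [tripleImage], by simp [tripleImage]⟩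
    obtain ⟨hi, hj, hie, hje⟩ := hijk
    have hadj := (isTriangle_insert_iff.1 ht).1
    have hother : ∀ f ∈ M, f ≠ tripleImage p e → (({p i, p j, u} : Finset V) ∩ f).card < 2 := by
      intro f hf hne
      by_contra! hcard
      obtain ⟨a, b, hab, ha, haf, hb, hbf⟩ := exists_of_two_le_card_inter hcard
      have hau : a ≠ u := fun h => hu (hW f hf (h ▸ haf))
      have hbu : b ≠ u := fun h => hu (hW f hf (h ▸ hbf))
      refine hab (eq_of_mem_inter (hM.2 f hf _ he hne) haf ?_ hbf ?_) <;> grind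
    have hne : ({p i, p j, u} : Finset V) ≠ tripleImage p e := fun h =>
      hu (hW _ he (h ▸ hut))
    have hapex : ∀ a, a < 7 → (10 * a + (7 + m) ∈ cs ∨ ¬ Atom G p k (10 * a + (7 + m))) →
        p a ∈ ({p i, p j, u} : Finset V) → p a ∈ tripleImage p e →
        ∃ b ∈ cs, codedEdge p es c b ⊆ {p i, p j, u} ∧ (codedEdge p es c b).card = 2 := by
      intro a ha hb hat hae
      refine ⟨_, hb.resolve_right fun h => h ?_, ?_⟩
      · rw [Atom, if_pos (by omega)]
        intro
        omega
      · rw [codedEdge_of_le (by omega) hme']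
        exact hc _ he _ _ ht hne h2 hother hat hae
    obtain ⟨b, hb, hb'⟩ := hbit _ (mem_allTriangles_of_getElem? hme' hij)
    rw [testBit_hitMask (by omega) (by omega),
      testBit_atomMask_of_le (by omega) (by omega)] at hb
    rcases hb with (rfl | rfl | rfl) | rfl
    · exact hpair i j (by omega) (by omega) hb' hadj (by simp) (by simp)
    · exact hapex i (by omega) hb' (by simp) hie
    · exact hapex j (by omega) hb' (by simp) hje
    · rcases hb' with hb' | hb'
      · exact absurd (hcs _ hb') (by omega)
      · refine absurd ?_ hb'
        rw [Atom, if_neg (by omega), show (100 + (10 * i + j)) / 10 - 10 = i by omega,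
          show (100 + (10 * i + j)) % 10 = j by omega]
        exact ⟨u, hu, ht⟩

theorem hitBy_of_checkTree {packs covers : List (List ℕ)} {l : List ℕ}
    (hchk : checkTree k n es packs covers l = true) (hM : TriMatching G M) (hn : M.card = n)
    (hmax : ∀ M', TriMatching G M' → M'.card ≤ n) (hp : ∀ i < k, ∀ j < k, p i = p j → i = j)
    (hMes : ∀ t, t ∈ M ↔ ∃ e ∈ es, t = tripleImage p e) : HitBy G (2 * n) := by
  simp only [checkTree, Bool.and_eq_true, List.all_eq_true, Nat.ble_eq, Nat.blt_eq] at hchk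
  obtain ⟨⟨⟨⟨⟨hpacks, hcovers⟩, hlt⟩, hk⟩, hes⟩, hrun⟩ := hchk
  obtain ⟨l', hl'⟩ := Option.isSome_iff_exists.1 hrun
  by_contra hhit
  refine runTree_sound (val := Atom G p k) ?_ ?_ _ _ _ _ _ hl' ?_ (by simp)
  · intro i T hi hT
    rw [packingLeaf] at hi
    split at hi
    · next ts hts =>
      obtain ⟨M', hM', hcard⟩ := exists_triMatching_of_packing hk hp
        (hpacks ts (List.mem_of_getElem? hts)) (G := G) fun t ht b hb => hT b (by
          have := List.all_eq_true.1 hi t ht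
          rw [beq_iff_eq] at this
          rw [← this, Nat.testBit_and, Bool.and_eq_true] at hb
          exact hb.2)
      have := hmax M' hM'
      omega
    · simp at hi
  · intro i F hi hF
    rw [coverLeaf] at hi
    split at hi
    · next cs hcs =>
      obtain ⟨hlen, h100⟩ := hcovers cs (List.mem_of_getElem? hcs)
      refine hhit ((hitBy_of_cover hM (hn ▸ hmax) hk hp hes (fun e he => ?_) hMes h100 hF
        fun t ht => ?_).mono hlen)
      · have := hlt e he
        tauto
      · exact bne_iff_ne.1 (List.all_eq_true.1 hi t ht)
    · simp at hi
  · intro b hb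
    rw [testBit_foldr_or] at hb
    obtain ⟨e, he, hb⟩ := hb.resolve_right (by simp)
    have h := hlt e he
    obtain ⟨h₁, h₂, h₃⟩ := isTriangle_insert_iff.1 (hM.1 _ ((hMes _).2 ⟨e, he, rfl⟩))
    rw [testBit_atomMask_of_lt (by omega) (by omega)] at hb
    rcases hb with rfl | rfl | rfl
    · exact atom_of_adj (by omega) (by omega) h₁
    · exact atom_of_adj (by omega) (by omega) h₂
    · exact atom_of_adj (by omega) (by omega) h₃

end Configurations
/-- Packings used by the refutation for `bowtie`. -/
def bowtiePackings : List (List ℕ) :=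
  [[12, 134, 38], [12, 134, 48], [14, 23, 127], [34, 124, 17], [13, 24, 127], [34, 123, 17]]

/-- Covers used by the refutation for `bowtie`. -/
def bowtieCovers : List (List ℕ) :=
  [[1, 2, 12, 34], [2, 8, 14, 34], [2, 4, 17, 38], [4, 7, 12, 38], [2, 8, 13, 34], [3, 7, 12, 48],
   [2, 3, 17, 48], [2, 8, 17, 34]]

/-- The decision tree of the refutation for `bowtie`. -/
def bowtieTree : List ℕ :=
  [14, 13, 103, 1000, 104, 1001, 2000, 23, 24, 112, 1002, 101, 1003, 2001, 2002, 2003, 13, 23, 24,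
   112, 1004, 101, 1005, 2004, 2005, 2006, 2007]

/-- Packings used by the refutation for `looseTriangle`. -/
def looseTrianglePackings : List (List ℕ) :=
  [[12, 35, 134, 48], [12, 35, 134, 159], [12, 45, 135, 348], [12, 34, 145, 359], [12, 45, 135,
   234], [15, 24, 134, 38], [14, 25, 135, 38], [15, 34, 123, 27], [15, 34, 123, 359], [25, 34,
   135, 127], [12, 34, 235, 159], [12, 35, 234, 139], [15, 23, 345, 127], [12, 34, 135, 245], [13,
   125, 345, 27], [25, 34, 135, 17], [13, 24, 125, 348], [12, 135, 234, 38], [34, 124, 135, 27],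
   [34, 124, 135, 17], [14, 23, 135, 127], [14, 123, 345, 27], [23, 125, 134, 17]]

/-- Covers used by the refutation for `looseTriangle`. -/
def looseTriangleCovers : List (List ℕ) :=
  [[1, 3, 13, 25, 27, 45], [1, 2, 3, 12, 13, 45], [1, 3, 13, 27, 34, 35], [1, 2, 3, 12, 34, 35],
   [1, 2, 12, 13, 34, 35], [1, 3, 4, 13, 25, 34], [1, 3, 12, 13, 15, 48], [1, 3, 4, 12, 15, 34],
   [3, 4, 12, 15, 34, 39], [1, 3, 4, 12, 13, 34], [1, 3, 4, 13, 15, 34], [5, 8, 12, 13, 34, 59],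
   [2, 3, 15, 17, 39, 48], [1, 4, 19, 27, 35, 38], [4, 7, 12, 13, 23, 59], [4, 7, 12, 13, 38, 59],
   [2, 8, 13, 17, 34, 59], [1, 2, 3, 13, 48, 59], [2, 4, 13, 15, 35, 38], [1, 8, 15, 23, 34, 39],
   [1, 8, 15, 27, 34, 39], [3, 7, 12, 19, 35, 48]]

/-- The decision tree of the refutation for `looseTriangle`. -/
def looseTriangleTree : List ℕ :=
  [5, 14, 104, 1000, 115, 1001, 45, 134, 1002, 135, 1003, 23, 24, 1004, 2000, 2001, 103, 113, 24,
   1005, 25, 1006, 2002, 2003, 2004, 23, 102, 1007, 135, 1008, 25, 112, 1009, 115, 1010, 2005,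
   112, 115, 101, 113, 24, 1011, 45, 1012, 2006, 2007, 2008, 2009, 2010, 25, 45, 24, 1013, 102,
   1014, 101, 1015, 2011, 2012, 2013, 24, 25, 45, 1013, 23, 134, 1016, 103, 1017, 2014, 2015, 14,
   102, 1018, 101, 1019, 2008, 2016, 14, 23, 112, 1020, 102, 101, 45, 1021, 25, 1022, 2017, 2018,
   2019, 2020, 2021]

/-- Packings used by the refutation for `sunflower`. -/
def sunflowerPackings : List (List ℕ) :=
  [[13, 56, 127, 348], [14, 56, 127, 348], [23, 56, 127, 348], [24, 56, 127, 348], [15, 34, 127,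
   569], [25, 34, 127, 569], [12, 35, 348, 569], [12, 45, 348, 569], [15, 36, 127, 348], [15, 46,
   127, 348], [15, 26, 34, 127], [15, 34, 127, 69], [25, 36, 127, 348], [25, 46, 127, 348], [25,
   34, 127, 69], [16, 34, 127, 59], [26, 34, 127, 59], [12, 36, 348, 59], [12, 46, 348, 59], [12,
   35, 46, 348], [16, 34, 127, 569], [26, 34, 127, 569], [13, 45, 127, 569], [13, 46, 127, 569],
   [13, 24, 56, 127], [13, 56, 127, 48], [23, 45, 127, 569], [23, 46, 127, 569], [23, 56, 127,
   48], [14, 56, 127, 38], [24, 56, 127, 38], [12, 45, 38, 569], [12, 46, 38, 569], [12, 35, 46,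
   569], [13, 56, 345, 127], [13, 26, 45, 127], [13, 45, 127, 69], [16, 45, 134, 127], [13, 56,
   346, 127], [13, 25, 46, 127], [13, 46, 127, 59], [16, 25, 34, 127], [14, 26, 35, 127], [25, 34,
   356, 127], [14, 25, 36, 127], [25, 36, 127, 48], [25, 36, 234, 127], [25, 46, 127, 38], [23,
   45, 256, 127], [12, 34, 56, 145], [14, 23, 56, 127], [12, 34, 156, 59], [15, 23, 46, 127], [12,
   34, 356, 59], [23, 56, 345, 127], [16, 23, 45, 127], [23, 45, 127, 69], [12, 36, 234, 59], [16,
   45, 127, 38], [26, 45, 127, 38], [12, 56, 345, 38], [12, 56, 346, 38], [12, 34, 456, 59], [12,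
   36, 348, 569], [12, 46, 348, 569], [13, 25, 348, 569], [13, 26, 348, 569], [13, 24, 56, 348],
   [13, 56, 27, 348], [14, 25, 348, 569], [14, 26, 348, 569], [14, 56, 27, 348], [23, 56, 17,
   348], [24, 56, 17, 348], [25, 34, 17, 569], [26, 34, 17, 569], [15, 26, 34, 569], [13, 56, 125,
   348], [13, 25, 46, 348], [13, 25, 348, 69], [25, 36, 123, 348], [13, 56, 126, 348], [13, 26,
   45, 348], [13, 26, 348, 59], [12, 36, 45, 348], [12, 45, 348, 69], [15, 23, 46, 348], [12, 45,
   156, 348], [16, 23, 45, 348], [16, 45, 27, 348], [16, 45, 124, 348], [26, 45, 17, 348], [14,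
   25, 456, 348], [14, 23, 56, 348], [12, 34, 56, 146], [12, 35, 256, 348], [34, 56, 125, 17],
   [12, 35, 348, 69], [12, 35, 156, 348], [16, 24, 35, 348], [16, 35, 27, 348], [25, 34, 356, 17],
   [25, 36, 17, 348], [25, 46, 17, 348], [34, 56, 126, 17], [12, 34, 256, 59], [15, 34, 27, 569],
   [15, 34, 123, 569], [15, 23, 46, 569], [15, 23, 48, 569], [12, 45, 234, 569], [15, 34, 124,
   569], [15, 24, 36, 569], [15, 24, 38, 569], [12, 36, 45, 569], [12, 36, 48, 569], [13, 25, 46,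
   569], [12, 36, 134, 569], [14, 25, 36, 569], [14, 36, 27, 569], [14, 36, 126, 569], [24, 36,
   17, 569], [16, 23, 346, 569], [16, 25, 34, 569], [16, 34, 27, 569], [12, 35, 234, 569], [34,
   56, 123, 17], [12, 35, 48, 569], [12, 35, 134, 569], [14, 26, 35, 569], [14, 35, 27, 569], [23,
   45, 17, 569], [23, 46, 17, 569], [34, 56, 124, 17], [12, 56, 134, 38], [12, 56, 234, 38], [12,
   56, 134, 48], [12, 35, 46, 134], [12, 34, 56, 135], [12, 35, 134, 69], [12, 35, 134, 256], [12,
   34, 56, 235], [12, 36, 45, 134], [12, 34, 56, 136], [12, 36, 134, 59], [12, 45, 134, 69], [12,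
   45, 134, 256], [25, 34, 123, 456], [12, 46, 134, 59], [34, 56, 123, 27], [16, 25, 34, 123],
   [25, 34, 123, 69], [12, 34, 56, 245], [15, 26, 34, 123], [12, 34, 56, 236], [26, 34, 123, 59],
   [15, 46, 123, 38], [13, 24, 56, 125], [34, 56, 125, 27], [13, 56, 125, 48], [34, 56, 126, 27],
   [12, 34, 56, 246], [13, 24, 56, 346], [13, 56, 346, 27], [12, 56, 345, 48], [13, 45, 256, 27],
   [12, 34, 456, 69], [12, 34, 256, 69], [34, 56, 124, 27], [16, 25, 34, 124], [25, 34, 124, 69],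
   [15, 26, 34, 124], [26, 34, 124, 59], [12, 56, 234, 48], [15, 36, 124, 48], [16, 35, 124, 48],
   [26, 35, 234, 17], [24, 56, 125, 346], [24, 56, 346, 17], [24, 56, 125, 38], [24, 56, 126, 38],
   [26, 34, 356, 17], [24, 56, 345, 17], [12, 34, 156, 69], [12, 36, 45, 156], [12, 45, 156, 38],
   [12, 36, 156, 48], [12, 46, 156, 38], [23, 56, 125, 48], [15, 26, 34, 456], [15, 34, 456, 27],
   [12, 34, 356, 69], [12, 35, 256, 48], [12, 35, 46, 256], [12, 36, 256, 48], [14, 23, 56, 126],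
   [26, 34, 456, 17]]

/-- Covers used by the refutation for `sunflower`. -/
def sunflowerCovers : List (List ℕ) :=
  [[6, 7, 8, 12, 34, 59], [1, 5, 8, 15, 27, 34], [1, 5, 8, 26, 27, 34], [1, 5, 6, 8, 27, 34], [4,
   6, 7, 12, 35, 38], [4, 6, 7, 12, 38, 46], [1, 3, 9, 13, 27, 56], [1, 3, 9, 24, 27, 56], [3, 4,
   7, 9, 12, 56], [4, 6, 7, 12, 35, 59], [4, 6, 7, 12, 46, 59], [3, 5, 7, 12, 16, 46], [3, 5, 7,
   12, 14, 46], [1, 3, 6, 13, 16, 27], [3, 5, 7, 12, 14, 26], [3, 5, 7, 12, 14, 35], [3, 5, 7, 12,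
   26, 35], [3, 6, 7, 12, 14, 36], [2, 3, 5, 17, 25, 46], [3, 5, 7, 12, 26, 46], [2, 5, 8, 17, 25,
   34], [4, 5, 7, 12, 23, 26], [4, 5, 7, 12, 26, 45], [4, 5, 7, 12, 23, 45], [4, 5, 7, 12, 16,
   36], [3, 4, 5, 7, 12, 46], [2, 5, 8, 17, 34, 36], [2, 5, 8, 17, 34, 46], [1, 3, 4, 27, 34, 56],
   [2, 3, 5, 17, 23, 46], [3, 5, 6, 7, 12, 24], [3, 6, 7, 12, 36, 59], [3, 6, 7, 12, 24, 36], [3,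
   4, 5, 6, 7, 12], [3, 4, 6, 7, 12, 36], [4, 5, 6, 7, 12, 46], [4, 6, 7, 12, 35, 46], [1, 3, 9,
   13, 48, 56], [1, 3, 9, 24, 48, 56], [1, 2, 3, 9, 48, 56], [2, 6, 8, 15, 34, 59], [2, 6, 8, 26,
   34, 59], [1, 5, 8, 26, 34, 36], [1, 5, 8, 23, 26, 34], [1, 3, 6, 13, 36, 48], [1, 5, 8, 23, 34,
   46], [1, 5, 8, 15, 23, 34], [1, 5, 8, 15, 34, 46], [1, 6, 8, 16, 23, 34], [1, 4, 5, 26, 38,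
   45], [1, 5, 8, 26, 34, 46], [4, 5, 7, 12, 38, 45], [2, 5, 8, 14, 34, 46], [2, 5, 8, 25, 34,
   46], [2, 5, 8, 14, 25, 34], [1, 6, 8, 24, 25, 34], [1, 3, 5, 6, 26, 48], [1, 3, 9, 25, 48, 56],
   [1, 3, 9, 26, 48, 56], [4, 5, 6, 12, 38, 56], [1, 3, 5, 26, 35, 48], [2, 5, 8, 25, 34, 36], [1,
   2, 6, 8, 16, 34], [2, 5, 6, 8, 26, 34], [2, 6, 8, 15, 26, 34], [1, 3, 5, 15, 35, 69], [1, 3, 9,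
   24, 25, 56], [1, 4, 5, 15, 45, 69], [1, 3, 9, 25, 46, 56], [1, 3, 9, 13, 25, 56], [1, 3, 9, 13,
   46, 56], [1, 4, 9, 14, 25, 56], [1, 5, 8, 15, 34, 69], [1, 3, 6, 24, 36, 59], [1, 3, 9, 24, 46,
   56], [2, 3, 9, 16, 46, 56], [2, 3, 9, 23, 46, 56], [2, 3, 9, 16, 23, 56], [1, 4, 9, 23, 26,
   56], [1, 3, 4, 5, 24, 69], [1, 5, 8, 23, 34, 69], [1, 5, 8, 24, 34, 69], [3, 4, 6, 12, 34, 59],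
   [1, 3, 5, 24, 35, 69], [1, 2, 3, 9, 45, 56], [1, 2, 3, 9, 23, 56], [2, 3, 9, 23, 45, 56], [1,
   2, 5, 8, 34, 69], [1, 2, 4, 9, 14, 56], [2, 3, 4, 9, 24, 56], [2, 3, 4, 9, 13, 56], [2, 4, 9,
   13, 24, 56], [1, 2, 5, 24, 34, 36], [1, 2, 5, 12, 34, 36], [1, 2, 5, 12, 25, 34], [1, 2, 6, 12,
   26, 34], [1, 2, 5, 24, 34, 46], [1, 2, 5, 12, 34, 46], [1, 2, 9, 12, 34, 56], [3, 4, 5, 12, 26,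
   34], [3, 4, 5, 12, 26, 46], [3, 4, 6, 12, 24, 45], [3, 4, 5, 6, 12, 16], [3, 4, 5, 6, 12, 45],
   [3, 4, 9, 12, 34, 56], [2, 5, 6, 13, 34, 56], [1, 4, 9, 23, 35, 56], [1, 4, 9, 23, 36, 56], [3,
   5, 6, 12, 36, 56], [1, 3, 4, 9, 26, 56], [1, 2, 3, 4, 9, 56], [2, 3, 4, 5, 6, 46], [1, 2, 3, 4,
   5, 46], [1, 2, 3, 4, 6, 46], [1, 2, 3, 5, 6, 46], [1, 2, 4, 5, 6, 46], [1, 3, 4, 5, 6, 46], [1,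
   5, 6, 8, 34, 56], [2, 3, 4, 9, 45, 56], [1, 2, 5, 8, 34, 46], [1, 4, 5, 6, 26, 45], [1, 2, 4,
   5, 6, 26], [1, 2, 3, 4, 5, 26], [2, 3, 4, 5, 6, 26], [1, 2, 3, 4, 6, 26], [1, 2, 3, 5, 6, 26],
   [1, 3, 4, 5, 6, 26], [2, 3, 4, 5, 6, 45], [1, 2, 3, 4, 6, 45], [1, 2, 4, 5, 6, 45], [1, 2, 3,
   4, 5, 45], [1, 2, 3, 5, 6, 45], [1, 3, 4, 5, 6, 45], [3, 4, 5, 12, 26, 36], [3, 4, 6, 12, 23,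
   35], [3, 4, 5, 6, 12, 46], [2, 5, 6, 14, 34, 56], [1, 3, 9, 24, 45, 56], [1, 2, 6, 15, 26, 34],
   [1, 2, 5, 6, 15, 34], [1, 2, 3, 5, 6, 23], [2, 5, 6, 26, 34, 56], [1, 2, 5, 6, 34, 56], [2, 5,
   6, 8, 15, 34], [2, 3, 4, 5, 6, 36], [1, 2, 3, 9, 12, 56], [4, 5, 6, 7, 12, 56], [2, 4, 5, 6,
   16, 35], [2, 3, 4, 5, 6, 35], [1, 3, 4, 9, 34, 56], [2, 5, 6, 8, 34, 56], [1, 2, 4, 12, 35,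
   56], [1, 3, 6, 16, 25, 36], [1, 3, 4, 6, 16, 25], [1, 2, 4, 5, 16, 36], [1, 2, 3, 4, 26, 56],
   [5, 6, 8, 12, 34, 56], [3, 4, 5, 6, 12, 36], [2, 4, 5, 6, 25, 36], [2, 3, 4, 5, 25, 36], [1, 3,
   4, 6, 25, 36], [1, 3, 4, 5, 6, 25], [1, 3, 5, 6, 25, 36], [2, 5, 6, 8, 34, 36], [1, 2, 5, 6, 8,
   34], [1, 2, 3, 4, 6, 36], [1, 2, 4, 5, 6, 36], [1, 2, 3, 4, 5, 36], [1, 2, 3, 5, 6, 36], [1, 3,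
   4, 5, 6, 36], [1, 2, 3, 5, 26, 35], [1, 2, 3, 5, 26, 46], [1, 2, 3, 4, 16, 56], [3, 4, 5, 6,
   12, 35], [2, 3, 4, 9, 34, 56], [1, 2, 4, 9, 35, 56], [2, 4, 5, 6, 35, 46], [1, 2, 4, 6, 35,
   46], [1, 3, 4, 5, 6, 35], [1, 2, 3, 4, 5, 35], [1, 2, 3, 4, 6, 35], [1, 2, 3, 5, 6, 35], [1, 2,
   4, 5, 6, 35]]

/-- The decision tree of the refutation for `sunflower`. -/
def sunflowerTree : List ℕ :=
  [112, 134, 13, 1000, 14, 1001, 23, 1002, 24, 1003, 156, 15, 1004, 25, 1005, 35, 1006, 45, 1007,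
   2000, 15, 36, 1008, 46, 1009, 26, 1010, 106, 1011, 2001, 25, 36, 1012, 46, 1013, 106, 1014,
   2002, 105, 16, 1015, 26, 1016, 36, 1017, 46, 1018, 2003, 35, 46, 1019, 2004, 2005, 156, 15,
   1004, 16, 1020, 25, 1005, 26, 1021, 13, 45, 1022, 46, 1023, 24, 1024, 104, 1025, 2006, 23, 45,
   1026, 46, 1027, 104, 1028, 2007, 103, 14, 1029, 24, 1030, 45, 1031, 46, 1032, 2008, 35, 46,
   1033, 2009, 2010, 13, 24, 1024, 104, 1025, 45, 35, 1034, 26, 1035, 106, 1036, 16, 14, 1037,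
   2011, 2012, 46, 36, 1038, 25, 1039, 105, 1040, 2013, 25, 16, 1041, 106, 1014, 14, 26, 35, 1042,
   2014, 2015, 2016, 26, 15, 1010, 105, 1016, 2017, 2006, 25, 16, 1041, 106, 1014, 36, 35, 1043,
   14, 1044, 104, 1045, 24, 23, 1046, 2018, 2019, 103, 46, 1047, 14, 1029, 2020, 26, 23, 45, 1048,
   2021, 2022, 2023, 15, 26, 1010, 106, 1011, 14, 45, 1049, 23, 1050, 103, 1029, 2024, 105, 16,
   1051, 36, 46, 23, 1052, 35, 1053, 2025, 2026, 2027, 2028, 23, 14, 1050, 104, 1028, 45, 35,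
   1054, 16, 1055, 106, 1056, 2029, 105, 24, 36, 1057, 2030, 2031, 2032, 103, 14, 1029, 24, 1030,
   45, 16, 1058, 26, 1059, 35, 1060, 46, 36, 1061, 2008, 2003, 105, 36, 35, 1053, 2000, 2033,
   2034, 105, 35, 46, 36, 1053, 45, 1062, 2035, 2009, 2010, 2036, 134, 156, 35, 1006, 36, 1063,
   45, 1007, 46, 1064, 13, 25, 1065, 26, 1066, 24, 1067, 102, 1068, 2037, 14, 25, 1069, 26, 1070,
   102, 1071, 2038, 101, 23, 1072, 24, 1073, 25, 1074, 26, 1075, 2039, 15, 26, 1076, 2040, 2041,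
   13, 24, 1067, 102, 1068, 25, 15, 1077, 46, 1078, 106, 1079, 36, 23, 1080, 2042, 2043, 26, 16,
   1081, 45, 1082, 105, 1083, 2044, 45, 36, 1084, 106, 1085, 23, 46, 15, 1086, 2045, 2046, 2047,
   46, 35, 1019, 105, 1018, 2048, 2037, 45, 36, 1084, 106, 1085, 16, 15, 1087, 23, 1088, 102,
   1089, 24, 14, 1090, 2049, 2050, 101, 26, 1091, 23, 1072, 2051, 46, 14, 25, 1092, 2052, 2053,
   2054, 14, 23, 1093, 102, 1071, 46, 16, 1094, 35, 1019, 105, 1018, 2055, 101, 24, 1073, 25, 26,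
   35, 1095, 15, 1096, 2056, 2057, 2058, 2059, 35, 46, 1019, 106, 1097, 16, 15, 1098, 24, 1099,
   102, 1100, 2060, 101, 36, 25, 1101, 2026, 2020, 2061, 101, 23, 1072, 24, 1073, 25, 36, 1102,
   46, 1103, 15, 1096, 26, 16, 1104, 2039, 2003, 105, 16, 15, 1051, 2000, 2003, 2062, 105, 15, 26,
   16, 1051, 25, 1105, 2063, 2040, 2041, 2064, 156, 15, 26, 1076, 102, 1106, 23, 13, 1107, 46,
   1108, 104, 1109, 45, 24, 1110, 2065, 2066, 24, 14, 1111, 36, 1112, 103, 1113, 2067, 36, 45,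
   1114, 104, 1115, 25, 46, 13, 1116, 2068, 2069, 2070, 46, 35, 1033, 103, 1032, 2071, 2072, 36,
   45, 1114, 104, 1115, 14, 13, 1117, 25, 1118, 102, 1119, 26, 16, 1120, 2073, 2074, 101, 24,
   1121, 25, 1074, 2031, 46, 16, 23, 1122, 2075, 2076, 2077, 16, 25, 1123, 102, 1124, 46, 14,
   1094, 35, 1033, 103, 1032, 2078, 101, 26, 1075, 23, 24, 35, 1125, 13, 1126, 2079, 2080, 2081,
   2082, 35, 46, 1033, 104, 1127, 14, 13, 1128, 26, 1129, 102, 1130, 2083, 101, 45, 23, 1131,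
   2084, 2085, 2086, 101, 25, 1074, 26, 1075, 23, 45, 1131, 46, 1132, 13, 1126, 24, 14, 1133,
   2087, 2008, 103, 14, 13, 1134, 2008, 2008, 2088, 103, 13, 24, 14, 1134, 23, 1135, 2089, 2090,
   2089, 2091, 13, 14, 103, 1134, 104, 1136, 35, 46, 1137, 15, 1138, 106, 1139, 36, 25, 26, 1140,
   23, 1141, 2092, 2093, 2094, 36, 45, 1142, 16, 1143, 105, 1144, 2095, 45, 15, 1049, 106, 1145,
   46, 25, 26, 1146, 23, 1147, 2096, 2097, 2094, 46, 16, 1094, 105, 1148, 2095, 2098, 23, 101,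
   1126, 102, 1149, 25, 16, 1150, 106, 1151, 35, 1141, 24, 45, 1152, 2099, 2100, 26, 15, 1153, 36,
   1154, 105, 1155, 2101, 103, 24, 1135, 15, 46, 1156, 35, 1138, 2102, 16, 36, 1143, 2103, 2104,
   35, 36, 104, 15, 1138, 16, 1143, 2104, 2105, 2106, 2107, 15, 35, 1138, 25, 24, 1157, 102, 1158,
   104, 1159, 101, 1096, 2108, 16, 36, 1143, 26, 102, 1160, 2109, 2110, 46, 102, 103, 104, 105,
   106, 101, 36, 1061, 26, 24, 1161, 2110, 2110, 2111, 2112, 2113, 2114, 2115, 2116, 2033, 36, 16,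
   1143, 46, 24, 1162, 102, 1163, 2117, 45, 104, 101, 35, 1164, 25, 24, 1152, 2110, 2033, 2118,
   2084, 2039, 26, 45, 102, 16, 1160, 25, 1165, 46, 106, 1166, 2119, 2087, 106, 103, 25, 1167, 35,
   1060, 2109, 2120, 2049, 102, 104, 105, 101, 106, 103, 16, 1104, 46, 24, 1161, 2110, 2039, 2121,
   2122, 2123, 2124, 2125, 2126, 45, 102, 104, 106, 103, 105, 101, 35, 1060, 25, 24, 1152, 2110,
   2110, 2127, 2128, 2129, 2130, 2131, 2132, 2033, 24, 14, 101, 1133, 102, 1168, 25, 16, 1169,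
   106, 1170, 45, 1152, 23, 35, 1141, 2099, 2133, 26, 15, 1171, 46, 1161, 105, 1172, 2134, 104,
   23, 1173, 15, 36, 1174, 45, 1049, 2102, 16, 35, 1175, 2135, 2104, 45, 46, 103, 15, 1049, 16,
   1094, 2104, 2136, 2137, 2074, 23, 103, 1135, 104, 1173, 25, 35, 1141, 45, 1152, 26, 105, 1105,
   2138, 2139, 26, 101, 35, 1176, 46, 1161, 16, 1104, 2140, 2141, 2142, 25, 45, 1152, 46, 26,
   1161, 15, 36, 1177, 101, 1096, 2143, 36, 101, 1178, 2144, 2033, 103, 104, 15, 1179, 26, 16,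
   1180, 2039, 2039, 2145, 2146, 26, 46, 1161, 16, 101, 1104, 103, 1180, 2147, 35, 36, 101, 1181,
   2148, 2087, 2033, 101, 102, 35, 45, 1182, 36, 46, 1178, 2039, 2110, 46, 36, 1178, 2110, 2110,
   2149, 2150, 15, 16, 105, 1051, 106, 1183, 45, 36, 1184, 103, 1185, 14, 1049, 2151, 25, 102,
   1158, 36, 104, 1186, 2152, 2153, 46, 103, 1187, 2154, 2155, 25, 101, 1096, 102, 1158, 45, 14,
   1049, 23, 35, 1141, 104, 1188, 2108, 2156, 104, 36, 105, 106, 103, 26, 1105, 23, 1188, 2157,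
   2158, 2159, 2160, 2161, 2162, 45, 14, 1049, 46, 26, 1189, 102, 1190, 2149, 36, 106, 101, 35,
   1191, 23, 26, 1154, 2033, 2003, 2163, 2026, 2087, 36, 102, 104, 106, 103, 105, 101, 35, 1053,
   23, 26, 1154, 2164, 2003, 2144, 2165, 2166, 2167, 2168, 2169, 2033, 26, 25, 105, 1105, 106,
   1167, 35, 104, 1192, 46, 1193, 2170, 36, 104, 1194, 2171, 2172, 16, 101, 1104, 102, 1160, 14,
   23, 1195, 46, 1094, 2173, 23, 36, 1154, 2103, 2156, 36, 23, 1154, 101, 102, 35, 1181, 46, 45,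
   1196, 2003, 2003, 2117, 2174, 45, 46, 101, 1196, 2118, 2087, 2033, 35, 46, 103, 36, 1061, 45,
   1060, 14, 16, 1094, 23, 25, 1141, 2008, 2003, 23, 25, 1141, 2033, 2003, 105, 101, 36, 1053, 16,
   14, 1094, 2175, 2175, 2176, 2177, 103, 104, 105, 106, 101, 102, 36, 1053, 23, 25, 1141, 2087,
   2003, 2178, 2148, 2179, 2180, 2181, 2182, 46, 103, 104, 105, 106, 101, 102, 36, 1061, 16, 14,
   1094, 2110, 2110, 2116, 2111, 2112, 2113, 2114, 2115, 2033]

/-- Packings used by the refutation for `path`. -/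
def pathPackings : List (List ℕ) :=
  [[12, 34, 56, 359], [12, 34, 56, 369], [12, 36, 345, 569], [12, 35, 346, 569], [12, 35, 348,
   569], [12, 35, 48, 569], [12, 34, 135, 569], [12, 35, 134, 569], [12, 34, 56, 135], [15, 26,
   34, 356], [15, 34, 356, 127], [15, 34, 356, 27], [12, 34, 56, 235], [15, 34, 124, 356], [12,
   34, 145, 356], [12, 34, 56, 236], [12, 34, 56, 136], [12, 34, 146, 356], [16, 34, 124, 356],
   [16, 25, 34, 356], [16, 24, 35, 346], [26, 34, 356, 17], [16, 34, 356, 27], [13, 24, 56, 345],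
   [12, 34, 245, 356], [12, 34, 246, 356], [12, 46, 134, 356], [12, 35, 156, 48], [15, 34, 126,
   356], [12, 35, 156, 348], [12, 35, 156, 346], [12, 34, 156, 369], [12, 34, 156, 359], [13, 24,
   156, 345], [25, 34, 356, 17], [15, 34, 123, 356], [15, 23, 356, 348], [15, 23, 356, 48], [23,
   45, 125, 356], [24, 35, 125, 346], [13, 45, 125, 356], [12, 45, 234, 356], [14, 35, 127, 569],
   [14, 35, 27, 569], [12, 34, 236, 569], [25, 34, 124, 356], [12, 45, 356, 38], [12, 35, 234,
   569], [12, 34, 235, 569], [12, 34, 136, 569], [25, 34, 356, 127], [12, 35, 256, 48], [12, 35,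
   256, 348], [12, 35, 256, 346], [25, 34, 126, 356], [14, 23, 256, 345], [25, 34, 123, 356], [12,
   45, 134, 356], [12, 35, 346, 48], [14, 35, 346, 127], [14, 35, 346, 27], [12, 45, 356, 348],
   [14, 35, 123, 346], [24, 35, 346, 127], [24, 35, 346, 17], [12, 34, 136, 359], [12, 35, 134,
   369], [12, 35, 234, 369], [12, 34, 236, 359], [34, 123, 356, 17], [34, 123, 356, 27], [13, 356,
   127, 348], [13, 356, 127, 48], [14, 23, 356, 127], [13, 24, 356, 127], [16, 34, 123, 356], [12,
   34, 136, 235], [12, 34, 135, 456], [26, 34, 123, 356], [12, 34, 135, 236], [13, 24, 236, 345],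
   [12, 134, 356, 38], [12, 134, 356, 48], [14, 36, 123, 345], [12, 46, 234, 356], [13, 46, 356,
   127], [16, 34, 356, 127], [26, 34, 356, 127], [12, 34, 135, 369], [12, 34, 135, 256], [13, 24,
   125, 356], [13, 125, 356, 48], [13, 125, 356, 348], [34, 125, 356, 27], [12, 135, 346, 48],
   [12, 135, 346, 38], [13, 24, 156, 346], [12, 36, 134, 156], [34, 124, 356, 17], [13, 24, 126,
   356], [34, 126, 356, 27], [12, 34, 136, 456], [13, 24, 356, 348], [12, 36, 134, 569], [26, 34,
   124, 356], [12, 36, 134, 359], [13, 24, 345, 369], [34, 124, 356, 27], [13, 24, 345, 569], [13,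
   46, 356, 27], [12, 36, 348, 569], [12, 36, 48, 569], [12, 36, 234, 569], [12, 46, 356, 38],
   [16, 34, 125, 356], [12, 36, 156, 345], [12, 36, 156, 348], [12, 36, 156, 48], [16, 24, 356,
   348], [16, 24, 356, 38], [24, 36, 126, 345], [23, 46, 126, 356], [12, 34, 456, 369], [12, 36,
   256, 345], [12, 34, 256, 359], [12, 36, 345, 48], [23, 46, 356, 127], [12, 34, 235, 456], [23,
   46, 356, 17], [14, 36, 345, 27], [12, 34, 456, 359], [14, 36, 345, 127], [12, 36, 234, 359],
   [12, 34, 235, 369], [14, 23, 356, 348], [14, 23, 345, 569], [14, 23, 345, 369], [12, 34, 236,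
   456], [14, 23, 346, 569], [14, 23, 346, 359], [14, 23, 256, 346], [12, 234, 356, 38], [14, 23,
   125, 356], [34, 126, 356, 17], [14, 23, 126, 356], [14, 256, 346, 27], [14, 256, 345, 27], [24,
   346, 17, 359]]

/-- Covers used by the refutation for `path`. -/
def pathCovers : List (List ℕ) :=
  [[2, 3, 16, 17, 23, 56], [1, 2, 3, 12, 13, 56], [1, 2, 3, 12, 23, 56], [1, 3, 25, 46, 48, 56],
   [1, 3, 4, 25, 34, 56], [1, 3, 4, 14, 34, 56], [1, 3, 4, 27, 34, 56], [3, 4, 7, 12, 34, 56], [6,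
   8, 12, 34, 35, 45], [6, 7, 8, 12, 34, 35], [4, 6, 7, 12, 35, 38], [4, 5, 7, 12, 36, 38], [2, 3,
   17, 46, 48, 56], [2, 3, 14, 17, 48, 56], [2, 3, 4, 17, 34, 56], [1, 3, 24, 25, 45, 56], [1, 3,
   13, 24, 25, 56], [1, 3, 13, 25, 45, 56], [1, 3, 24, 25, 36, 59], [1, 4, 25, 35, 38, 69], [5, 8,
   12, 34, 39, 56], [1, 8, 25, 34, 35, 69], [1, 3, 24, 36, 48, 59], [1, 3, 36, 45, 48, 59], [1, 4,
   35, 38, 46, 69], [1, 8, 34, 35, 45, 69], [4, 7, 12, 35, 38, 69], [1, 3, 5, 24, 35, 69], [1, 3,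
   5, 26, 35, 69], [3, 7, 12, 36, 45, 59], [2, 3, 17, 39, 45, 56], [4, 7, 12, 25, 35, 69], [2, 3,
   16, 17, 39, 56], [3, 7, 12, 25, 36, 59], [2, 3, 14, 39, 45, 56], [2, 3, 14, 23, 39, 56], [2, 3,
   23, 39, 45, 56], [2, 3, 14, 35, 36, 48], [2, 3, 35, 36, 45, 48], [2, 4, 35, 36, 38, 46], [2, 8,
   34, 35, 36, 45], [1, 3, 24, 35, 36, 45], [1, 3, 24, 34, 35, 36], [2, 3, 13, 34, 35, 36], [3, 7,
   12, 34, 35, 36], [3, 4, 7, 12, 35, 36], [3, 7, 12, 35, 36, 48], [1, 4, 27, 35, 36, 38], [3, 4,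
   7, 12, 34, 35], [2, 4, 17, 35, 36, 38], [4, 7, 12, 23, 35, 38], [3, 4, 7, 12, 34, 36], [3, 6,
   12, 35, 36, 56], [3, 12, 15, 24, 36, 48], [3, 4, 12, 15, 34, 36], [3, 4, 12, 34, 36, 46], [1,
   23, 24, 34, 39, 56], [2, 3, 23, 39, 48, 56], [3, 4, 12, 34, 36, 59], [1, 8, 23, 34, 39, 56],
   [3, 4, 12, 34, 39, 56], [2, 8, 13, 34, 39, 56], [3, 12, 24, 35, 48, 69], [3, 12, 35, 46, 48,
   69], [3, 4, 12, 34, 35, 69], [3, 7, 12, 14, 35, 69], [4, 7, 12, 13, 39, 56], [1, 15, 27, 34,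
   39, 56], [1, 16, 27, 34, 39, 56], [3, 7, 12, 35, 36, 56], [1, 3, 13, 15, 35, 46], [1, 2, 6, 16,
   34, 35], [4, 7, 12, 13, 38, 56], [2, 3, 14, 16, 35, 48], [1, 2, 3, 16, 35, 48], [1, 2, 8, 34,
   35, 45], [2, 3, 14, 35, 46, 48], [1, 2, 3, 35, 46, 48], [1, 2, 3, 14, 35, 48], [1, 8, 26, 34,
   36, 46], [1, 2, 8, 24, 34, 36], [1, 2, 4, 14, 36, 38], [1, 2, 3, 4, 36, 59], [1, 2, 3, 4, 39,
   56], [1, 8, 24, 34, 39, 56], [1, 2, 8, 34, 36, 59], [2, 3, 4, 34, 39, 56], [1, 6, 8, 34, 39,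
   56], [1, 2, 8, 34, 39, 56], [1, 3, 27, 39, 46, 56], [6, 7, 12, 34, 39, 56], [4, 7, 12, 16, 36,
   59], [4, 7, 12, 26, 36, 59], [1, 2, 3, 12, 39, 56], [1, 3, 6, 16, 24, 36], [1, 4, 23, 26, 35,
   36], [6, 8, 12, 34, 39, 56], [1, 3, 26, 35, 46, 48], [1, 3, 26, 35, 36, 48], [1, 3, 4, 34, 35,
   36], [1, 3, 24, 35, 46, 48], [1, 3, 24, 35, 36, 48], [1, 3, 35, 36, 46, 48], [2, 4, 24, 25, 36,
   38], [2, 4, 35, 36, 38, 45], [2, 8, 34, 35, 36, 46], [2, 3, 17, 34, 35, 36], [4, 7, 12, 36, 38,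
   45], [4, 7, 12, 23, 36, 38], [4, 7, 12, 35, 36, 38], [2, 3, 4, 24, 35, 46], [1, 2, 3, 4, 24,
   35], [4, 7, 12, 23, 38, 56], [1, 2, 3, 26, 35, 69], [1, 3, 4, 26, 35, 69], [2, 3, 4, 26, 35,
   69], [1, 2, 3, 4, 35, 69], [4, 7, 12, 23, 39, 56], [7, 8, 12, 23, 34, 56], [3, 7, 12, 24, 35,
   48], [2, 8, 17, 25, 34, 56], [2, 8, 15, 17, 34, 35], [2, 8, 17, 34, 35, 45], [3, 7, 12, 24, 36,
   48], [2, 8, 17, 26, 34, 56], [2, 8, 16, 17, 34, 36], [2, 8, 17, 34, 36, 46], [2, 8, 17, 34, 39,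
   56], [1, 8, 24, 27, 34, 56], [1, 8, 12, 34, 39, 56], [4, 7, 12, 36, 38, 59], [4, 7, 12, 38, 39,
   56], [2, 8, 12, 34, 39, 56], [4, 7, 12, 36, 38, 56], [7, 8, 12, 34, 39, 56]]

/-- The decision tree of the refutation for `path`. -/
def pathTree : List ℕ :=
  [5, 6, 135, 1000, 136, 1001, 156, 45, 1002, 46, 1003, 134, 1004, 104, 1005, 13, 23, 15, 1006,
   14, 1007, 2000, 2001, 2002, 15, 13, 1008, 26, 1009, 112, 1010, 102, 1011, 25, 14, 23, 1012, 24,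
   1013, 45, 1014, 2003, 2004, 2005, 23, 26, 1015, 25, 1012, 16, 13, 1016, 14, 46, 1017, 24, 1018,
   2006, 2006, 2007, 16, 13, 1016, 25, 1019, 46, 24, 1020, 14, 1017, 26, 45, 101, 1021, 102, 1022,
   2008, 2009, 2006, 2010, 24, 45, 13, 1023, 25, 1024, 46, 26, 1025, 2007, 2010, 46, 14, 26, 1025,
   13, 1026, 2011, 2012, 2013, 2014, 15, 112, 1010, 102, 1011, 16, 104, 1027, 26, 1028, 134, 1029,
   46, 1030, 136, 1031, 135, 1032, 24, 45, 13, 1033, 2015, 2016, 2017, 25, 101, 1034, 23, 13,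
   1035, 134, 1036, 104, 1037, 45, 1038, 2018, 24, 14, 1013, 46, 1039, 2019, 45, 13, 1040, 14,
   1014, 2020, 2021, 23, 13, 1035, 24, 45, 1041, 2022, 2023, 24, 14, 1013, 2024, 2025, 156, 46,
   1003, 134, 1004, 104, 1005, 14, 112, 1042, 13, 1007, 102, 1043, 24, 26, 23, 1044, 25, 1045,
   2026, 2027, 2028, 45, 103, 1046, 23, 24, 1047, 25, 1048, 2029, 13, 16, 1049, 2030, 2031, 24,
   23, 1047, 2032, 2033, 25, 112, 1050, 101, 1034, 26, 104, 1051, 134, 1052, 46, 1053, 16, 1054,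
   14, 45, 23, 1055, 2034, 2035, 2036, 13, 23, 1056, 14, 45, 1057, 2037, 2038, 14, 24, 1045, 2039,
   2040, 46, 104, 1058, 14, 112, 1059, 102, 1060, 16, 1017, 45, 13, 1057, 134, 1061, 2041, 23, 13,
   1062, 2022, 2042, 24, 112, 1063, 101, 1064, 26, 1025, 45, 23, 1041, 2038, 2043, 45, 134, 1061,
   2029, 2044, 135, 13, 16, 1065, 136, 14, 1066, 23, 24, 1067, 45, 134, 1061, 2045, 2046, 2047,
   23, 26, 1068, 2048, 2048, 23, 136, 24, 1067, 26, 1068, 2049, 2050, 2026, 2051, 13, 23, 101,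
   1069, 102, 1070, 112, 134, 1071, 104, 1072, 14, 1073, 24, 1074, 2052, 16, 6, 1075, 25, 1076,
   156, 1049, 135, 1065, 15, 46, 45, 1077, 14, 1017, 2053, 2054, 2055, 26, 6, 1078, 15, 1079, 24,
   45, 1080, 46, 1025, 25, 14, 103, 1081, 104, 1082, 2056, 2057, 2058, 2059, 45, 14, 6, 1083, 15,
   1014, 24, 25, 1024, 2060, 2059, 24, 46, 25, 1024, 6, 1084, 2061, 2062, 2063, 2064, 112, 24,
   1074, 104, 1072, 134, 1071, 6, 46, 1085, 16, 1086, 26, 1087, 2065, 14, 103, 1081, 15, 16, 45,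
   1014, 46, 1017, 2066, 2067, 2068, 2069, 15, 156, 1006, 136, 1088, 25, 26, 1089, 24, 1090, 104,
   1091, 134, 1092, 102, 1093, 2070, 16, 135, 1065, 46, 45, 1077, 104, 1094, 103, 1095, 24, 1096,
   2071, 14, 101, 6, 1097, 45, 1014, 2072, 2073, 2074, 46, 14, 101, 24, 1098, 6, 1026, 2075, 2076,
   2077, 2078, 16, 156, 1049, 135, 1065, 26, 24, 1099, 102, 1100, 2079, 45, 46, 1101, 2080, 2081,
   24, 134, 1102, 6, 14, 156, 1103, 26, 1104, 135, 1105, 46, 1026, 2080, 45, 156, 1002, 136, 1106,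
   25, 1024, 2077, 46, 26, 1025, 2082, 2083, 102, 14, 1107, 45, 156, 1108, 136, 1106, 25, 1024,
   2077, 46, 26, 1025, 2082, 2083, 2084, 6, 102, 101, 46, 1109, 26, 1021, 2085, 2086, 2087, 2088,
   6, 156, 45, 1002, 134, 1110, 104, 1111, 23, 24, 1112, 26, 1044, 25, 1048, 2089, 46, 103, 1113,
   16, 26, 14, 1017, 24, 1025, 2090, 2091, 2092, 2093, 16, 112, 1086, 102, 1022, 15, 25, 1114, 45,
   1115, 134, 1116, 104, 1117, 135, 1032, 2094, 26, 101, 1021, 24, 14, 1018, 134, 1118, 103, 1119,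
   45, 1120, 2095, 46, 136, 23, 1121, 14, 1017, 2096, 2097, 2098, 24, 46, 136, 45, 1122, 14, 1017,
   2099, 2100, 2101, 2102, 26, 112, 1087, 101, 1021, 25, 45, 1123, 135, 1124, 2103, 14, 24, 1104,
   2104, 2105, 45, 104, 1125, 23, 46, 112, 1126, 25, 1127, 101, 1128, 24, 1084, 2104, 14, 112,
   1073, 102, 1129, 15, 1014, 2042, 24, 25, 1024, 2106, 2044, 135, 46, 1130, 14, 112, 1131, 102,
   1129, 15, 1014, 2042, 24, 25, 1024, 2047, 2044, 2107, 23, 135, 136, 24, 1132, 25, 1133, 2049,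
   2048, 2108, 2109, 23, 14, 112, 1073, 134, 1134, 45, 156, 1135, 136, 1136, 15, 1014, 26, 25,
   1055, 46, 1137, 2050, 46, 24, 101, 1098, 2110, 2077, 2111, 46, 156, 1138, 135, 1139, 16, 1017,
   25, 26, 1140, 2108, 2080, 103, 24, 1141, 25, 15, 1142, 26, 101, 102, 104, 16, 1143, 135, 1068,
   136, 1133, 2112, 2113, 2114, 2115, 2116, 26, 16, 1144, 2082, 2083, 2117, 25, 156, 1048, 136,
   1133, 26, 135, 1068, 24, 45, 1024, 46, 1025, 2112, 2118, 15, 45, 135, 46, 1130, 16, 1032, 2119,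
   2120, 2121, 2122, 26, 156, 1044, 135, 1068, 16, 46, 136, 45, 1122, 15, 1031, 2123, 2124, 2125,
   2126, 2127, 14, 46, 16, 1017, 45, 135, 1130, 136, 1122, 15, 1014, 2128, 26, 24, 1025, 25, 102,
   1145, 2129, 2130, 2130, 45, 15, 1014, 25, 24, 1024, 26, 102, 1146, 2129, 2026, 2026, 2131, 24,
   45, 25, 1024, 26, 46, 1025, 16, 101, 1143, 2132, 2026, 2127, 46, 26, 1025, 101, 135, 1147,
   2133, 2132, 2131, 2134]

theorem check_bowtie : checkTree 5 2 [(0, 1, 2), (0, 3, 4)] bowtiePackings bowtieCovers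
    bowtieTree = true := by
  decide +kernel

theorem check_looseTriangle : checkTree 6 3 [(0, 1, 2), (0, 3, 4), (1, 3, 5)]
    looseTrianglePackings looseTriangleCovers looseTriangleTree = true := by
  decide +kernel

theorem check_path : checkTree 7 3 [(0, 1, 2), (0, 3, 4), (3, 5, 6)] pathPackings pathCovers
    pathTree = true := by
  decide +kernel

theorem check_sunflower : checkTree 7 3 [(0, 1, 2), (0, 3, 4), (0, 5, 6)] sunflowerPackings
    sunflowerCovers sunflowerTree = true := by
  decide +kernel

theorem getD_inj_of_nodup {α : Type*} {l : List α} (hl : l.Nodup) {a : α} {i j : ℕ}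
    (hi : i < l.length) (hj : j < l.length) : l.getD i a = l.getD j a ↔ i = j := by
  rw [List.getD_eq_getElem _ _ hi, List.getD_eq_getElem _ _ hj, hl.getElem_inj_iff]

section Tuza

variable {V : Type*} [DecidableEq V] {G : SimpleGraph V} {n : ℕ}

theorem hitBy_bowtie {e f : Finset V} {u : V} (hne : e ≠ f) (hM : TriMatching G {e, f})
    (hmax : ∀ M', TriMatching G M' → M'.card ≤ 2) (hue : u ∈ e) (huf : u ∈ f) :
    HitBy G (2 * 2) := by
  have hef := hM.2 e (by simp) f (by simp) hne
  obtain ⟨a, b, hua, hub, hab, rfl⟩ := exists_eq_insert_of_mem (hM.1 e (by simp)).1 hue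
  obtain ⟨c, d, huc, hud, hcd, rfl⟩ := exists_eq_insert_of_mem (hM.1 f (by simp)).1 huf
  have h := fun v h₁ h₂ => eq_of_mem_inter hef (b := v) hue huf h₁ h₂
  simp only [Finset.mem_insert, Finset.mem_singleton] at h
  have hp : [u, a, b, c, d].Nodup := by
    simp only [List.nodup_cons, List.mem_cons, List.not_mem_nil]
    grind
  exact hitBy_of_checkTree (p := fun i => [u, a, b, c, d].getD i u) check_bowtie hM
    (Finset.card_pair hne) hmax (fun i hi j hj => (getD_inj_of_nodup hp hi hj).1)
    (by simp [tripleImage])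

theorem hitBy_sunflower {e f g : Finset V} {u : V} (hef : e ≠ f) (heg : e ≠ g) (hfg : f ≠ g)
    (hM : TriMatching G {e, f, g}) (hmax : ∀ M', TriMatching G M' → M'.card ≤ 3) (hue : u ∈ e)
    (huf : u ∈ f) (hug : u ∈ g) : HitBy G (2 * 3) := by
  have hef' := hM.2 e (by simp) f (by simp) hef
  have heg' := hM.2 e (by simp) g (by simp) heg
  have hfg' := hM.2 f (by simp) g (by simp) hfg
  obtain ⟨a, b, hua, hub, hab, rfl⟩ := exists_eq_insert_of_mem (hM.1 e (by simp)).1 hue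
  obtain ⟨c, d, huc, hud, hcd, rfl⟩ := exists_eq_insert_of_mem (hM.1 f (by simp)).1 huf
  obtain ⟨x, y, hux, huy, hxy, rfl⟩ := exists_eq_insert_of_mem (hM.1 g (by simp)).1 hug
  have h₁ := fun v => eq_of_mem_inter hef' (b := v) hue huf
  have h₂ := fun v => eq_of_mem_inter heg' (b := v) hue hug
  have h₃ := fun v => eq_of_mem_inter hfg' (b := v) huf hug
  simp only [Finset.mem_insert, Finset.mem_singleton] at h₁ h₂ h₃
  have hp : [u, a, b, c, d, x, y].Nodup := by
    have := And.intro (h₁ a) (h₁ b)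
    have := And.intro (h₂ a) (h₂ b)
    have := And.intro (h₃ c) (h₃ d)
    clear hef heg hfg hM hmax hef' heg' hfg' hue huf hug h₁ h₂ h₃
    simp only [List.nodup_cons, List.mem_cons, List.not_mem_nil, List.nodup_nil]
    grind
  exact hitBy_of_checkTree (p := fun i => [u, a, b, c, d, x, y].getD i u) check_sunflower hM
    (Finset.card_eq_three.2 ⟨_, _, _, hef, heg, hfg, rfl⟩) hmax
    (fun i hi j hj => (getD_inj_of_nodup hp hi hj).1) (by simp [tripleImage])

theorem hitBy_path {e f g : Finset V} {u w : V} (hef : e ≠ f) (heg : e ≠ g) (hfg : f ≠ g)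
    (hM : TriMatching G {e, f, g}) (hmax : ∀ M', TriMatching G M' → M'.card ≤ 3)
    (hdisj : Disjoint e g) (hue : u ∈ e) (huf : u ∈ f) (hwf : w ∈ f) (hwg : w ∈ g) :
    HitBy G (2 * 3) := by
  have hef' := hM.2 e (by simp) f (by simp) hef
  have hfg' := hM.2 f (by simp) g (by simp) hfg
  have heg' := Finset.disjoint_left.1 hdisj
  have huw : u ≠ w := fun h => heg' hue (h ▸ hwg)
  obtain ⟨a, b, hua, hub, hab, rfl⟩ := exists_eq_insert_of_mem (hM.1 e (by simp)).1 hue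
  obtain ⟨c, huc, hwc, rfl⟩ :=
    exists_eq_insert_of_mem_of_mem (hM.1 f (by simp)).1 huf hwf huw
  obtain ⟨x, y, hwx, hwy, hxy, rfl⟩ := exists_eq_insert_of_mem (hM.1 g (by simp)).1 hwg
  have h₁ := fun v => eq_of_mem_inter hef' (b := v) hue huf
  have h₃ := fun v => eq_of_mem_inter hfg' (b := v) hwf hwg
  simp only [Finset.mem_insert, Finset.mem_singleton] at h₁ heg' h₃
  have hp : [u, a, b, w, c, x, y].Nodup := by
    simp only [List.nodup_cons, List.mem_cons, List.not_mem_nil]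
    grind
  exact hitBy_of_checkTree (p := fun i => [u, a, b, w, c, x, y].getD i u) check_path hM
    (Finset.card_eq_three.2 ⟨_, _, _, hef, heg, hfg, rfl⟩) hmax
    (fun i hi j hj => (getD_inj_of_nodup hp hi hj).1) (by simp [tripleImage])

theorem hitBy_looseTriangle {e f g : Finset V} {u v w : V} (hef : e ≠ f) (heg : e ≠ g)
    (hfg : f ≠ g) (hM : TriMatching G {e, f, g})
    (hmax : ∀ M', TriMatching G M' → M'.card ≤ 3) (hue : u ∈ e) (huf : u ∈ f) (hve : v ∈ e)
    (hvg : v ∈ g) (hwf : w ∈ f) (hwg : w ∈ g) (hug : u ∉ g) : HitBy G (2 * 3) := by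
  have hef' := hM.2 e (by simp) f (by simp) hef
  have heg' := hM.2 e (by simp) g (by simp) heg
  have hfg' := hM.2 f (by simp) g (by simp) hfg
  have huv : u ≠ v := fun h => hug (h ▸ hvg)
  have huw : u ≠ w := fun h => hug (h ▸ hwg)
  have hvw : v ≠ w := fun h => huv (eq_of_mem_inter hef' hue huf hve (h ▸ hwf))
  obtain ⟨a, hua, hva, rfl⟩ :=
    exists_eq_insert_of_mem_of_mem (hM.1 e (by simp)).1 hue hve huv
  obtain ⟨b, hub, hwb, rfl⟩ :=
    exists_eq_insert_of_mem_of_mem (hM.1 f (by simp)).1 huf hwf huw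
  obtain ⟨c, hvc, hwc, rfl⟩ :=
    exists_eq_insert_of_mem_of_mem (hM.1 g (by simp)).1 hvg hwg hvw
  have h₁ := fun z => eq_of_mem_inter hef' (b := z) hue huf
  have h₂ := fun z => eq_of_mem_inter heg' (b := z) hve hvg
  have h₃ := fun z => eq_of_mem_inter hfg' (b := z) hwf hwg
  simp only [Finset.mem_insert, Finset.mem_singleton] at h₁ h₂ h₃ hug
  have hp : [u, v, a, w, b, c].Nodup := by
    simp only [List.nodup_cons, List.mem_cons, List.not_mem_nil]
    grind
  exact hitBy_of_checkTree (p := fun i => [u, v, a, w, b, c].getD i u) check_looseTriangle hM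
    (Finset.card_eq_three.2 ⟨_, _, _, hef, heg, hfg, rfl⟩) hmax
    (fun i hi j hj => (getD_inj_of_nodup hp hi hj).1) (by simp [tripleImage])

/-- A packing triangle that meets no other one can be removed at the price of two edges. -/
theorem hitBy_succ_of_isolated
    (ih : ∀ G : SimpleGraph V, (∀ M, TriMatching G M → M.card ≤ n) → HitBy G (2 * n))
    {M : Finset (Finset V)} (hM : TriMatching G M) (hn : M.card = n + 1)
    (hmax : ∀ M', TriMatching G M' → M'.card ≤ n + 1) {e : Finset V} (he : e ∈ M)
    (hiso : ∀ f ∈ M, f ≠ e → Disjoint e f) : HitBy G (2 * (n + 1)) := by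
  classical
  obtain ⟨D, hD, hDe⟩ := exists_hit_of_isolated hM (hn ▸ hmax) he hiso
  let G' : SimpleGraph V :=
    { Adj := fun u v => G.Adj u v ∧ {u, v} ∉ D
      symm := ⟨fun u v h => ⟨h.1.symm, by rw [Finset.pair_comm]; exact h.2⟩⟩
      loopless := ⟨fun u h => G.loopless.irrefl u h.1⟩ }
  have hG : ∀ t, IsTriangle G' t → IsTriangle G t := fun t ht =>
    ⟨ht.1, fun u hu v hv huv => (ht.2 u hu v hv huv).1⟩
  have hG' : ∀ t, IsTriangle G' t → ∀ d ∈ D, d ⊆ t → d.card ≠ 2 := by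
    intro t ht d hd hdt hd2
    obtain ⟨u, v, huv, rfl⟩ := Finset.card_eq_two.1 hd2
    exact (ht.2 u (hdt (by simp)) v (hdt (by simp)) huv).2 hd
  obtain ⟨C, hC, hCt⟩ := ih G' fun M' hM' => by
    have hdisj : ∀ t ∈ M', (t ∩ e).card < 2 := by
      intro t ht
      by_contra! h
      obtain ⟨d, hd, hdt, hd2⟩ := hDe t (hG t (hM'.1 t ht)) h
      exact hG' t (hM'.1 t ht) d hd hdt hd2
    have heM' : e ∉ M' := fun h => by
      have := hdisj e h
      rw [Finset.inter_self, (hM.1 e he).1] at this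
      omega
    have := hmax (insert e M') ⟨?_, ?_⟩
    · rw [Finset.card_insert_of_notMem heM'] at this
      omega
    · have := hM'.1
      have := hM.1 e he
      grind
    · have := hM'.2
      grind [Finset.inter_comm]
  refine ⟨C ∪ D, (Finset.card_union_le _ _).trans (by omega), fun t ht => ?_⟩
  by_cases h : ∃ d ∈ D, d ⊆ t ∧ d.card = 2
  · obtain ⟨d, hd, h⟩ := h
    exact ⟨d, Finset.mem_union_right _ hd, h⟩
  · obtain ⟨c, hc, h⟩ := hCt t ⟨ht.1, fun u hu v hv huv => ⟨ht.2 u hu v hv huv, fun hd =>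
      h ⟨_, hd, by grind, Finset.card_pair huv⟩⟩⟩
    exact ⟨c, Finset.mem_union_left _ hc, h⟩

/-- To bound the number of hitting edges by twice the packing number `n + 1`, one may assume that
there is a packing of that size in which every triangle meets another one. -/
theorem hitBy_succ
    (ih : ∀ G : SimpleGraph V, (∀ M, TriMatching G M → M.card ≤ n) → HitBy G (2 * n))
    (hmax : ∀ M', TriMatching G M' → M'.card ≤ n + 1)
    (h : ∀ M, TriMatching G M → M.card = n + 1 →
      (∀ e ∈ M, ∃ f ∈ M, f ≠ e ∧ ¬ Disjoint e f) → HitBy G (2 * (n + 1))) :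
    HitBy G (2 * (n + 1)) := by
  by_cases hex : ∃ M, TriMatching G M ∧ M.card = n + 1
  · obtain ⟨M, hM, hn⟩ := hex
    by_cases hiso : ∀ e ∈ M, ∃ f ∈ M, f ≠ e ∧ ¬ Disjoint e f
    · exact h M hM hn hiso
    · push Not at hiso
      obtain ⟨e, he, hiso⟩ := hiso
      exact hitBy_succ_of_isolated ih hM hn hmax he hiso
  · refine (ih G fun M hM => ?_).mono (by omega)
    have := hmax M hM
    have : M.card ≠ n + 1 := fun h => hex ⟨M, hM, h⟩
    omega

theorem hitBy_zero (hmax : ∀ M, TriMatching G M → M.card ≤ 0) : HitBy G (2 * 0) := by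
  refine ⟨∅, by simp, fun t ht => ?_⟩
  have := hmax {t} ⟨by simpa using ht, by simp⟩
  simp at this

theorem hitBy_one (hmax : ∀ M, TriMatching G M → M.card ≤ 1) : HitBy G (2 * 1) := by
  refine hitBy_succ (fun _ => hitBy_zero) hmax fun M hM hn hiso => ?_
  obtain ⟨e, rfl⟩ := Finset.card_eq_one.1 hn
  simp at hiso

theorem hitBy_two (hmax : ∀ M, TriMatching G M → M.card ≤ 2) : HitBy G (2 * 2) := by
  refine hitBy_succ (fun _ => hitBy_one) hmax fun M hM hn hiso => ?_
  obtain ⟨e, f, hef, rfl⟩ := Finset.card_eq_two.1 hn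
  obtain ⟨f', hf', hne, h⟩ := hiso e (by simp)
  obtain rfl : f' = f := by simpa [hne] using hf'
  obtain ⟨u, hue, huf⟩ := Finset.not_disjoint_iff.1 h
  exact hitBy_bowtie hef hM hmax hue huf

theorem hitBy_three (hmax : ∀ M, TriMatching G M → M.card ≤ 3) : HitBy G (2 * 3) := by
  refine hitBy_succ (fun _ => hitBy_two) hmax fun M hM hn hiso => ?_
  obtain ⟨e, f, g, hef, heg, hfg, rfl⟩ := Finset.card_eq_three.1 hn
  have path : ∀ e f g : Finset V, e ≠ f → e ≠ g → f ≠ g → TriMatching G {e, f, g} →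
      Disjoint e g → ¬ Disjoint e f → ¬ Disjoint f g → HitBy G (2 * 3) := by
    intro e f g hef heg hfg hM hd h₁ h₂
    obtain ⟨u, hue, huf⟩ := Finset.not_disjoint_iff.1 h₁
    obtain ⟨w, hwf, hwg⟩ := Finset.not_disjoint_iff.1 h₂
    exact hitBy_path hef heg hfg hM hmax hd hue huf hwf hwg
  have he := hiso e (by simp)
  have hf := hiso f (by simp)
  have hg := hiso g (by simp)
  simp only [Finset.mem_insert, Finset.mem_singleton] at he hf hg
  by_cases h₁ : Disjoint e f
  · refine path e g f heg hef hfg.symm ?_ h₁ (by grind) (by grind)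
    rwa [Finset.pair_comm]
  by_cases h₂ : Disjoint e g
  · exact path e f g hef heg hfg hM h₂ h₁ (by grind)
  by_cases h₃ : Disjoint f g
  · refine path f e g hef.symm hfg heg ?_ h₃ (by rwa [disjoint_comm]) h₂
    rwa [Finset.insert_comm]
  obtain ⟨u, hue, huf⟩ := Finset.not_disjoint_iff.1 h₁
  obtain ⟨v, hve, hvg⟩ := Finset.not_disjoint_iff.1 h₂
  obtain ⟨w, hwf, hwg⟩ := Finset.not_disjoint_iff.1 h₃
  by_cases hug : u ∈ g
  · exact hitBy_sunflower hef heg hfg hM hmax hue huf hug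
  · exact hitBy_looseTriangle hef heg hfg hM hmax hue huf hve hvg hwf hwg hug

end Tuza

/-- If a finite simple graph `G` has no 4 pairwise edge-disjoint triangles, then
Tuza's conjecture holds for `G`: `τ_t(G) ≤ 2 ν_t(G)`. -/
theorem stmt3 {V : Type*} [Fintype V] [DecidableEq V] (G : SimpleGraph V)
    (h4 : ¬ ∃ M, TriMatching G M ∧ M.card = 4)
    (n : ℕ) (hex : ∃ M, TriMatching G M ∧ M.card = n)
    (hmax : ∀ M, TriMatching G M → M.card ≤ n) :
    ∃ C, TriCover G C ∧ C.card ≤ 2 * n := by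
  have h : HitBy G (2 * n) := by
    obtain ⟨M, hM, rfl⟩ := hex
    have hlt : M.card ≤ 3 := by
      by_contra! hcard
      obtain ⟨M', hM', h4'⟩ := Finset.exists_subset_card_eq (Nat.succ_le_of_lt hcard)
      exact h4 ⟨M', ⟨fun t ht => hM.1 t (hM' ht), fun t ht s hs =>
        hM.2 t (hM' ht) s (hM' hs)⟩, h4'⟩
    interval_cases M.card
    exacts [hitBy_zero hmax, hitBy_one hmax, hitBy_two hmax, hitBy_three hmax]
  exact h.exists_triCover
end
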